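/- (Almost-sure law of large numbers for G-equation travel times.) Assume the G-equation hypotheses on (c,v) over a probability space (Ω,F,P), assume each travel time τ^{t_0}(x_0, x, ·) is measurable in ω, and assume lim_{s→∞} s^α φ_H(s) = 0 for some α > 0, where H := (c,v). Then there is M ≥ 1 such that for each unit vector e ∈ S^{d-1} there exist a number τ̄(e) ∈ [M^{-1}, M] and a set Ω_e ⊆ Ω with P[Ω_e] = 1 such that for every (t_0, x_0) ∈ ℝ^{d+1} and every ω ∈ Ω_e: lim_{r→∞} τ^{t_0}(x_0, x_0 + re, ω)/r = lim_{r→∞} E[τ^{t_0}(x_0, x_0 + re, ·)]/r = τ̄(e). Moreover, for all e, e' ∈ S^{d-1}: max{ |τ̄(e) − τ̄(e')|, |1/τ̄(e) − 1/τ̄(e')| } ≤ M^3|e − e'|. -/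

import Mathlib

open MeasureTheory Filter Metric

noncomputable section

/-- `ℝ^d` with the Euclidean norm. -/
abbrev Euc (d : ℕ) : Type := EuclideanSpace ℝ (Fin d)

/-- `(t₁, x₁)` is reachable from `(t₀, x₀)`: there is an absolutely continuous path
`γ : [t₀,t₁] → ℝ^d` (given by the integral of its a.e. derivative `g`) with `γ(t₀) = x₀`,
`γ(t₁) = x₁`, and `|γ'(t) − v(t,γ(t))| ≤ c(t,γ(t))` for a.e. `t ∈ [t₀,t₁]`. -/
def Reachable {d : ℕ} (c : ℝ → Euc d → ℝ) (v : ℝ → Euc d → Euc d)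
    (t0 : ℝ) (x0 : Euc d) (t1 : ℝ) (x1 : Euc d) : Prop :=
  t0 ≤ t1 ∧ ∃ γ g : ℝ → Euc d,
    IntervalIntegrable g volume t0 t1 ∧
    (∀ t ∈ Set.Icc t0 t1, γ t = x0 + ∫ s in t0..t, g s) ∧
    γ t1 = x1 ∧
    ∀ᵐ s ∂(volume.restrict (Set.Icc t0 t1)), ‖g s - v s (γ s)‖ ≤ c s (γ s)

/-- The reachable set `Γ(t; t₀, x₀)`. -/
def reachSet {d : ℕ} (c : ℝ → Euc d → ℝ) (v : ℝ → Euc d → Euc d)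
    (t t0 : ℝ) (x0 : Euc d) : Set (Euc d) :=
  {x | Reachable c v t0 x0 (t0 + t) x}

/-- The travel time `τ^{t₀}(x₀, x) = inf { t ≥ 0 : x ∈ Γ(t; t₀, x₀) }`. -/
def travelTime {d : ℕ} (c : ℝ → Euc d → ℝ) (v : ℝ → Euc d → Euc d)
    (t0 : ℝ) (x0 x : Euc d) : ℝ :=
  sInf {t | 0 ≤ t ∧ x ∈ reachSet c v t t0 x0}

/-- The σ-algebra `F_t^+(H)` generated by `H(s,x,·) = (c(s,x,·), v(s,x,·))` for `s ≥ t`. -/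
def sigmaPlus {d : ℕ} {Ω : Type*} [MeasurableSpace Ω]
    (c : ℝ → Euc d → Ω → ℝ) (v : ℝ → Euc d → Ω → Euc d) (t : ℝ) : MeasurableSpace Ω :=
  ⨆ (s : ℝ) (_ : t ≤ s) (x : Euc d),
    MeasurableSpace.comap (fun ω => (c s x ω, v s x ω)) inferInstance

/-- The σ-algebra `F_t^-(H)` generated by `H(s,x,·) = (c(s,x,·), v(s,x,·))` for `s ≤ t`. -/
def sigmaMinus {d : ℕ} {Ω : Type*} [MeasurableSpace Ω]
    (c : ℝ → Euc d → Ω → ℝ) (v : ℝ → Euc d → Ω → Euc d) (t : ℝ) : MeasurableSpace Ω :=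
  ⨆ (s : ℝ) (_ : s ≤ t) (x : Euc d),
    MeasurableSpace.comap (fun ω => (c s x ω, v s x ω)) inferInstance

/-- The mixing coefficient `φ_H(s)` of `H = (c,v)`. -/
def phiH {d : ℕ} {Ω : Type*} [MeasurableSpace Ω] (P : Measure Ω)
    (c : ℝ → Euc d → Ω → ℝ) (v : ℝ → Euc d → Ω → Euc d) (s : ℝ) : ℝ :=
  sSup {r | ∃ t : ℝ, ∃ Ev Fv : Set Ω,
    MeasurableSet[sigmaMinus c v t] Ev ∧ MeasurableSet[sigmaPlus c v (t + s)] Fv ∧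
    0 < P Ev ∧ r = |(P (Fv ∩ Ev)).toReal / (P Ev).toReal - (P Fv).toReal|}

/-- regularity of a deterministic field -/
structure GReg {d : ℕ} (K Lc : ℝ) (δ : ℝ → ℝ) (c : ℝ → Euc d → ℝ) (v : ℝ → Euc d → Euc d) :
    Prop where
  cpos : ∀ t x, 0 ≤ c t x
  cK : ∀ t x, c t x ≤ K
  vK : ∀ t x, ‖v t x‖ ≤ K
  δpos : ∀ ε, 0 < ε → 0 < δ ε
  md : ∀ ε, 0 < ε → ∀ t t' : ℝ, |t - t'| ≤ δ ε → ∀ x,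
    |c t x - c t' x| ≤ ε ∧ ‖v t x - v t' x‖ ≤ ε
  lip : ∀ t x x', |c t x - c t x'| ≤ Lc * ‖x - x'‖ ∧ ‖v t x - v t x'‖ ≤ Lc * ‖x - x'‖

section
variable {d : ℕ} {c : ℝ → Euc d → ℝ} {v : ℝ → Euc d → Euc d}

lemma reach_refl (t : ℝ) (x : Euc d) : Reachable c v t x t x := by
  refine ⟨le_rfl, fun _ => x, fun _ => 0, by simp, ?_, rfl, ?_⟩
  · intro s _; simp
  · simp

lemma reach_trans {t0 t1 t2 : ℝ} {x0 x1 x2 : Euc d} (h1 : Reachable c v t0 x0 t1 x1)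
    (h2 : Reachable c v t1 x1 t2 x2) : Reachable c v t0 x0 t2 x2 := by
  obtain ⟨h01, γ1, g1, i1, p1, e1, a1⟩ := h1
  obtain ⟨h12, γ2, g2, i2, p2, e2, a2⟩ := h2
  set g : ℝ → Euc d := fun s => if s ≤ t1 then g1 s else g2 s with hg
  set γ : ℝ → Euc d := fun s => if s ≤ t1 then γ1 s else γ2 s with hγ
  have gi1 : IntervalIntegrable g volume t0 t1 := by
    refine i1.congr ?_
    rw [Set.uIoc_of_le h01]
    intro s hs
    simp [hg, hs.2]
  have gi2 : IntervalIntegrable g volume t1 t2 := by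
    refine i2.congr ?_
    rw [Set.uIoc_of_le h12]
    intro s hs
    simp [hg, hs.1]
  have I1 : ∀ t ∈ Set.Icc t0 t1, ∫ s in t0..t, g s = ∫ s in t0..t, g1 s := by
    intro t ht
    apply intervalIntegral.integral_congr
    rw [Set.uIcc_of_le ht.1]
    intro s hs
    simp [hg, hs.2.trans ht.2]
  have I2 : ∀ t ∈ Set.Icc t1 t2, ∫ s in t1..t, g s = ∫ s in t1..t, g2 s := by
    intro t ht
    apply intervalIntegral.integral_congr_ae
    rw [Set.uIoc_of_le ht.1]
    refine Eventually.of_forall ?_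
    intro s hs
    simp [hg, hs.1]
  refine ⟨h01.trans h12, γ, g, gi1.trans gi2, ?_, ?_, ?_⟩
  · intro t ht
    by_cases h : t ≤ t1
    · simp only [hγ, h, if_true]
      rw [I1 t ⟨ht.1, h⟩, p1 t ⟨ht.1, h⟩]
    · simp only [hγ, h, if_false]
      push Not at h
      rw [← intervalIntegral.integral_add_adjacent_intervals (b := t1) gi1
        (gi2.mono_set (by rw [Set.uIcc_of_le h.le, Set.uIcc_of_le h12]; exact Set.Icc_subset_Icc_right ht.2)),
        I1 t1 ⟨h01, le_rfl⟩, I2 t ⟨h.le, ht.2⟩, p2 t ⟨h.le, ht.2⟩, ← e1, p1 t1 ⟨h01, le_rfl⟩]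
      abel
  · by_cases h : t2 ≤ t1
    · have : t2 = t1 := le_antisymm h h12
      subst this
      simp only [hγ, le_refl, if_true]
      have := p2 t2 ⟨le_rfl, le_rfl⟩
      rw [intervalIntegral.integral_same, e2] at this
      rw [e1, this]; simp
    · simp [hγ, h, e2]
  · rw [ae_restrict_iff' measurableSet_Icc] at a1 a2 ⊢
    filter_upwards [a1, a2] with s h1 h2 hs
    by_cases h : s ≤ t1
    · simpa [hg, hγ, h] using h1 ⟨hs.1, h⟩
    · have h' := (not_le.1 h).le
      simpa [hg, hγ, h] using h2 ⟨h', hs.2⟩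

lemma reach_linear {t h : ℝ} (hh : 0 ≤ h) (x g : Euc d)
    (H : ∀ s ∈ Set.Icc t (t + h), ‖g - v s (x + (s - t) • g)‖ ≤ c s (x + (s - t) • g)) :
    Reachable c v t x (t + h) (x + h • g) := by
  refine ⟨by linarith, fun s => x + (s - t) • g, fun _ => g, by simp, ?_, by simp, ?_⟩
  · intro s hs; simp
  · rw [ae_restrict_iff' measurableSet_Icc]
    exact Eventually.of_forall H

lemma reach_dist {K : ℝ} (hc : ∀ t x, c t x ≤ K) (hv : ∀ t x, ‖v t x‖ ≤ K)
    {t0 t1 : ℝ} {x0 x1 : Euc d} (h : Reachable c v t0 x0 t1 x1) :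
    ‖x1 - x0‖ ≤ 2 * K * (t1 - t0) := by
  obtain ⟨h01, γ, g, i, p, e, a⟩ := h
  rw [← e, p t1 ⟨h01, le_rfl⟩, add_sub_cancel_left]
  have := intervalIntegral.norm_integral_le_of_norm_le_const_ae (a := t0) (b := t1) (f := g)
    (C := 2 * K) ?_
  · rwa [abs_of_nonneg (by linarith)] at this
  · rw [ae_restrict_iff' measurableSet_Icc] at a
    filter_upwards [a] with s hs hm
    rw [Set.uIoc_of_le h01] at hm
    have h1 := hs ⟨hm.1.le, hm.2⟩
    have h2 := hc s (γ s)
    have h3 := hv s (γ s)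
    have := norm_add_le (g s - v s (γ s)) (v s (γ s))
    rw [sub_add_cancel] at this
    linarith

/-- time reversal -/
lemma reach_reverse {t0 t1 : ℝ} {x0 x1 : Euc d}
    (h : Reachable (fun t x => c (-t) x) (fun t x => - v (-t) x) (-t1) x1 (-t0) x0) :
    Reachable c v t0 x0 t1 x1 := by
  obtain ⟨h01, γ, g, i, p, e, a⟩ := h
  have h01' : t0 ≤ t1 := by linarith
  have i' : IntervalIntegrable (fun s => - g (-s)) volume t0 t1 := by
    have := (i.comp_mul_left (c := -1)).neg
    simp at this
    exact this.symm
  have hx0 : γ (-t0) = x1 + ∫ s in (-t1)..(-t0), g s := p _ ⟨by linarith, le_rfl⟩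
  refine ⟨h01', fun s => γ (-s), fun s => - g (-s), i', ?_, ?_, ?_⟩
  · intro t ht
    have hp := p (-t) ⟨by linarith [ht.2], by linarith [ht.1]⟩
    simp only [intervalIntegral.integral_neg, intervalIntegral.integral_comp_neg]
    rw [hp, ← e, hx0, ← intervalIntegral.integral_add_adjacent_intervals
      (a := -t1) (b := -t) (c := -t0)]
    · abel
    · refine i.mono_set ?_
      rw [Set.uIcc_of_le (by linarith [ht.2]), Set.uIcc_of_le (by linarith)]
      exact Set.Icc_subset_Icc_right (by linarith [ht.1])
    · refine i.mono_set ?_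
      rw [Set.uIcc_of_le (by linarith [ht.1]), Set.uIcc_of_le (by linarith)]
      exact Set.Icc_subset_Icc_left (by linarith [ht.2])
  · have hp := p (-t1) ⟨le_rfl, by linarith⟩
    simpa using hp
  · rw [ae_restrict_iff' measurableSet_Icc] at a ⊢
    have := (quasiMeasurePreserving_neg (volume : Measure ℝ)).ae a
    filter_upwards [this] with s hs hm
    have := hs ⟨by linarith [hm.2], by linarith [hm.1]⟩
    simp only [neg_neg] at this
    rw [← norm_neg, show -(-g (-s) - v s (γ (-s))) = g (-s) - -v s (γ (-s)) by abel]
    exact this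

/-- space-time shift -/
lemma reach_shift (s : ℝ) (y : Euc d) {t0 t1 : ℝ} {x0 x1 : Euc d}
    (h : Reachable (fun t x => c (t + s) (x + y)) (fun t x => v (t + s) (x + y)) t0 x0 t1 x1) :
    Reachable c v (t0 + s) (x0 + y) (t1 + s) (x1 + y) := by
  obtain ⟨h01, γ, g, i, p, e, a⟩ := h
  refine ⟨by linarith, fun t => γ (t - s) + y, fun t => g (t - s), ?_, ?_, by simp [e], ?_⟩
  · simpa using i.comp_sub_right s
  · intro t ht
    simp only
    rw [p (t - s) ⟨by linarith [ht.1], by linarith [ht.2]⟩,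
      intervalIntegral.integral_comp_sub_right]
    simp only [add_sub_cancel_right]
    abel
  · rw [ae_restrict_iff' measurableSet_Icc] at a ⊢
    have := (measurePreserving_sub_right (volume : Measure ℝ) s).quasiMeasurePreserving.ae a
    filter_upwards [this] with t ht hm
    simpa using ht ⟨by linarith [hm.1], by linarith [hm.2]⟩

lemma reach_shift_iff (s : ℝ) (y : Euc d) {t0 t1 : ℝ} {x0 x1 : Euc d} :
    Reachable (fun t x => c (t + s) (x + y)) (fun t x => v (t + s) (x + y)) t0 x0 t1 x1 ↔
    Reachable c v (t0 + s) (x0 + y) (t1 + s) (x1 + y) := by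
  refine ⟨reach_shift s y, fun h => ?_⟩
  have := reach_shift (c := fun t x => c (t + s) (x + y)) (v := fun t x => v (t + s) (x + y))
    (-s) (-y) (t0 := t0 + s) (x0 := x0 + y) (t1 := t1 + s) (x1 := x1 + y) (by simpa using h)
  simpa using this

end

/-- trace as a continuous linear map -/
noncomputable def trC (d : ℕ) : (Euc d →L[ℝ] Euc d) →L[ℝ] ℝ :=
  LinearMap.toContinuousLinearMap
    ((LinearMap.trace ℝ (Euc d)) ∘ₗ (ContinuousLinearMap.coeLM (R := ℝ) (S := ℝ) (M := Euc d) (N₃ := Euc d)))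

lemma trC_apply {d : ℕ} (A : Euc d →L[ℝ] Euc d) :
    trC d A = LinearMap.trace ℝ (Euc d) A.toLinearMap := rfl

lemma hasFDerivAt_shift {d : ℕ} {v : Euc d → Euc d} {A : Euc d →L[ℝ] Euc d} {x y : Euc d}
    (h : HasFDerivAt v A (x + y)) : HasFDerivAt (fun x => v (x + y)) A x := by
  have := h.comp x ((hasFDerivAt_id x).add_const y)
  rw [ContinuousLinearMap.comp_id] at this
  exact this

lemma param_diff {d : ℕ} {α : Type*} [MeasurableSpace α] (ν : Measure α) [IsProbabilityMeasure ν]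
    (F : α → Euc d → Euc d) (F' : α → Euc d → Euc d →L[ℝ] Euc d) (B C : ℝ) (hC : 0 ≤ C)
    (hm : ∀ x, AEStronglyMeasurable (fun a => F a x) ν)
    (hm' : ∀ x, AEStronglyMeasurable (fun a => F' a x) ν)
    (hB : ∀ x, ∀ᵐ a ∂ν, ‖F a x‖ ≤ B)
    (hl : ∀ᵐ a ∂ν, ∀ x y, ‖F a x - F a y‖ ≤ C * ‖x - y‖)
    (hd : ∀ x, ∀ᵐ a ∂ν, HasFDerivAt (F a) (F' a x) x) (x : Euc d) :
    Integrable (fun a => F' a x) ν ∧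
    HasFDerivAt (fun x => ∫ a, F a x ∂ν) (∫ a, F' a x ∂ν) x ∧ ‖∫ a, F' a x ∂ν‖ ≤ C := by
  have key := hasFDerivAt_integral_of_dominated_loc_of_lip (μ := ν) (F := fun x a => F a x)
    (F' := fun a => F' a x) (x₀ := x) (bound := fun _ => C) (s := Set.univ) (𝕜 := ℝ) univ_mem
    (Eventually.of_forall hm) ⟨hm x, HasFiniteIntegral.of_bounded (hB x)⟩ (hm' x) ?_
    (integrable_const _) (hd x)
  · refine ⟨key.1, key.2, ?_⟩
    have := norm_integral_le_of_norm_le_const (μ := ν) (f := fun a => F' a x) (C := C) ?_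
    · simpa using this
    · filter_upwards [hl, hd x] with a h1 h2
      have : LipschitzWith (Real.toNNReal C) (F a) := by
        refine LipschitzWith.of_dist_le_mul fun x y => ?_
        rw [dist_eq_norm, dist_eq_norm, Real.coe_toNNReal _ hC]; exact h1 x y
      have := h2.le_of_lipschitz this
      rwa [Real.coe_toNNReal _ hC] at this
  · filter_upwards [hl] with a h1
    refine (LipschitzWith.of_dist_le_mul fun x y => ?_).lipschitzOnWith
    rw [dist_eq_norm, dist_eq_norm, Real.coe_nnabs, abs_of_nonneg hC]; exact h1 x y

/-- mollification -/
lemma mollify {d : ℕ} (v : Euc d → Euc d) (L K η : ℝ) (hL : 0 ≤ L) (hη : 0 < η)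
    (hl : ∀ x y, ‖v x - v y‖ ≤ L * ‖x - y‖) (hK : ∀ x, ‖v x‖ ≤ K)
    (hdiv : ∀ᵐ x, LinearMap.trace ℝ (Euc d) (fderiv ℝ v x).toLinearMap = 0) :
    ∃ (u : Euc d → Euc d) (u' : Euc d → Euc d →L[ℝ] Euc d), (∀ x, HasFDerivAt u (u' x) x) ∧
      (∀ x, ‖u' x‖ ≤ L) ∧ (∀ x, trC d (u' x) = 0) ∧ (∀ x, ‖u x‖ ≤ K) ∧
      ∀ x, ‖u x - v x‖ ≤ L * η := by
  have hlip : LipschitzWith (Real.toNNReal L) v := by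
    refine LipschitzWith.of_dist_le_mul fun x y => ?_
    rw [dist_eq_norm, dist_eq_norm, Real.coe_toNNReal _ hL]; exact hl x y
  set ν := ProbabilityTheory.cond (volume : Measure (Euc d)) (ball 0 η) with hν
  have : IsProbabilityMeasure ν := ProbabilityTheory.cond_isProbabilityMeasure_of_finite
    (measure_ball_pos _ _ hη).ne' measure_ball_lt_top.ne
  have hac : ν ≪ volume := ProbabilityTheory.cond_absolutelyContinuous
  have hball : ∀ᵐ y ∂ν, y ∈ ball (0 : Euc d) η := ProbabilityTheory.ae_cond_mem measurableSet_ball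
  have hae : ∀ x : Euc d, ∀ᵐ y ∂ν, DifferentiableAt ℝ v (x + y) ∧ trC d (fderiv ℝ v (x + y)) = 0 := by
    intro x
    apply hac.ae_le
    exact (quasiMeasurePreserving_add_left volume x).ae
      ((hlip.ae_differentiableAt (μ := volume)).and hdiv)
  have hvm : Continuous v := hlip.continuous
  have hfm : Measurable (fderiv ℝ v) := measurable_fderiv ℝ v
  have hint : ∀ x : Euc d, Integrable (fun y => v (x + y)) ν := fun x =>
    ⟨(by fun_prop : Continuous fun y => v (x + y)).aestronglyMeasurable,
      HasFiniteIntegral.of_bounded (C := K) (Eventually.of_forall fun y => hK _)⟩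
  have key := param_diff ν (fun y x => v (x + y)) (fun y x => fderiv ℝ v (x + y)) K L hL
    (fun x => (by fun_prop : Continuous fun y => v (x + y)).aestronglyMeasurable)
    (fun x => (hfm.comp (measurable_const_add x)).aestronglyMeasurable)
    (fun x => Eventually.of_forall fun y => hK _)
    (Eventually.of_forall fun y x x' => by simpa using hl (x + y) (x' + y))
    (fun x => by
      filter_upwards [hae x] with y hy
      exact hasFDerivAt_shift hy.1.hasFDerivAt)
  refine ⟨fun x => ∫ y, v (x + y) ∂ν, fun x => ∫ y, fderiv ℝ v (x + y) ∂ν,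
    fun x => (key x).2.1, fun x => (key x).2.2, fun x => ?_, fun x => ?_, fun x => ?_⟩
  · rw [← ContinuousLinearMap.integral_comp_comm _ (key x).1]
    rw [integral_congr_ae (g := fun _ => (0:ℝ))]
    · simp
    · filter_upwards [hae x] with y hy using hy.2
  · simpa using norm_integral_le_of_norm_le_const (μ := ν) (f := fun y => v (x + y)) (C := K)
      (Eventually.of_forall fun y => hK _)
  · have : (∫ y, v (x + y) ∂ν) - v x = ∫ y, (v (x + y) - v x) ∂ν := by
      rw [integral_sub (hint x) (integrable_const _)]; simp
    rw [this]
    have := norm_integral_le_of_norm_le_const (μ := ν) (f := fun y => v (x + y) - v x) (C := L * η) ?_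
    · simpa using this
    · filter_upwards [hball] with y hy
      refine (hl _ _).trans ?_
      rw [add_sub_cancel_left]
      exact mul_le_mul_of_nonneg_left (mem_ball_zero_iff.1 hy).le hL

local notation "⟪" x "," y "⟫" => inner ℝ x y

lemma trC_smulRight {d : ℕ} (f : Euc d →L[ℝ] ℝ) (x : Euc d) : trC d (f.smulRight x) = f x :=
  LinearMap.trace_smulRight (f : Euc d →ₗ[ℝ] ℝ) x

lemma corr_deriv {d : ℕ} (u p : Euc d → Euc d) (u' p' : Euc d → Euc d →L[ℝ] Euc d)
    (hu : ∀ x, HasFDerivAt u (u' x) x) (hp : ∀ x, HasFDerivAt p (p' x) x)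
    (K L ε C Y : ℝ) (hL : 0 ≤ L) (hK0 : 0 ≤ K) (hε : 0 ≤ ε) (hC : 0 ≤ C) (hY : 0 ≤ Y)
    (hu' : ∀ x, ‖u' x‖ ≤ L) (htr : ∀ x, trC d (u' x) = 0) (hK : ∀ x, ‖u x‖ ≤ K)
    (hpε : ∀ x, ‖p x‖ ≤ ε) (hpC : ∀ x, ‖p' x‖ ≤ C)
    (hsym : ∀ x y z, ⟪p' x y, z⟫ = ⟪y, p' x z⟫)
    (y : Euc d) (s : ℝ) (hy : ‖y‖ ≤ Y) (x : Euc d) :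
    ∃ F' : Euc d →L[ℝ] Euc d,
      HasFDerivAt (fun x => - u (x + y) + (⟪p x, u (x + s • y)⟫ • y - ⟪p x, y⟫ • u (x + s • y))) F' x ∧
      ‖F'‖ ≤ L + 2 * (C * K + ε * L) * Y ∧ trC d F' = ⟪p x, u' (x + s • y) y⟫ := by
  have h1 : ∀ z, HasFDerivAt (fun x => u (x + z)) (u' (x + z)) x := fun z => hasFDerivAt_shift (hu _)
  have h2 := ((hp x).inner ℝ (h1 (s • y))).smul_const y
  have h3 := ((hp x).inner ℝ (hasFDerivAt_const y x)).smul (h1 (s • y))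
  have h4 := (h1 y).neg.add (h2.sub h3)
  refine ⟨_, h4, ?_, ?_⟩
  · refine ContinuousLinearMap.opNorm_le_bound _ (by positivity) fun k => ?_
    simp only [_root_.add_apply, _root_.sub_apply,
      _root_.neg_apply, ContinuousLinearMap.smulRight_apply,
      ContinuousLinearMap.comp_apply, ContinuousLinearMap.prod_apply, fderivInnerCLM_apply,
      _root_.smul_apply, _root_.zero_apply, inner_zero_right, zero_add]
    have e1 : ∀ z, ‖u' z k‖ ≤ L * ‖k‖ := fun z => (u' z).le_of_opNorm_le (hu' z) k
    have e2 : ‖p' x k‖ ≤ C * ‖k‖ := (p' x).le_of_opNorm_le (hpC x) k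
    have e3 : |⟪p x, u' (x + s • y) k⟫| ≤ ε * (L * ‖k‖) :=
      (abs_real_inner_le_norm _ _).trans (mul_le_mul (hpε x) (e1 _) (norm_nonneg _) hε)
    have e4 : |⟪p' x k, u (x + s • y)⟫| ≤ C * ‖k‖ * K :=
      (abs_real_inner_le_norm _ _).trans (mul_le_mul e2 (hK _) (norm_nonneg _) (by positivity))
    have e5 : |⟪p x, y⟫| ≤ ε * Y :=
      (abs_real_inner_le_norm _ _).trans (mul_le_mul (hpε x) hy (norm_nonneg _) hε)
    have e6 : |⟪p' x k, y⟫| ≤ C * ‖k‖ * Y :=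
      (abs_real_inner_le_norm _ _).trans (mul_le_mul e2 hy (norm_nonneg _) (by positivity))
    have f1 : ‖(⟪p x, u' (x + s • y) k⟫ + ⟪p' x k, u (x + s • y)⟫) • y‖
        ≤ (ε * (L * ‖k‖) + C * ‖k‖ * K) * Y := by
      rw [norm_smul]
      exact mul_le_mul ((abs_add_le _ _).trans (add_le_add e3 e4)) hy (norm_nonneg _) (by positivity)
    have f2 : ‖⟪p x, y⟫ • (u' (x + s • y)) k‖ ≤ ε * Y * (L * ‖k‖) := by
      rw [norm_smul]
      exact mul_le_mul e5 (e1 _) (norm_nonneg _) (by positivity)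
    have f3 : ‖⟪p' x k, y⟫ • u (x + s • y)‖ ≤ C * ‖k‖ * Y * K := by
      rw [norm_smul]
      exact mul_le_mul e6 (hK _) (norm_nonneg _) (by positivity)
    refine (norm_add_le _ _).trans ?_
    refine (add_le_add_right ((norm_sub_le _ _).trans (add_le_add_right (norm_add_le _ _) _)) _).trans ?_
    rw [norm_neg]
    have := e1 (x + y)
    nlinarith
  · simp only [map_add, map_sub, map_neg, htr, map_smul]
    simp only [trC_smulRight]
    simp [fderivInnerCLM_apply]
    have h5 := real_inner_comm y (p' x (u (x + s • y)))
    rw [hsym x y]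
    linarith

/-- the box -/
def gbox (d : ℕ) (ℓ : ℝ) : Set (Euc d) := {y : Euc d | ∀ i, y i ∈ Set.Icc (0:ℝ) ℓ}

lemma gbox_preimage (d : ℕ) (ℓ : ℝ) :
    gbox d ℓ = (MeasurableEquiv.toLp 2 (Fin d → ℝ)).symm ⁻¹' (Set.pi Set.univ fun _ => Set.Icc 0 ℓ) := by
  ext y; simp [gbox, Pi.le_def, forall_and]

lemma gbox_meas (d : ℕ) (ℓ : ℝ) : MeasurableSet (gbox d ℓ) := by
  rw [gbox_preimage]
  exact (MeasurableEquiv.measurable _) (MeasurableSet.univ_pi fun _ => measurableSet_Icc)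

lemma gbox_vol (d : ℕ) (ℓ : ℝ) (h : 0 < ℓ) : volume (gbox d ℓ) = ENNReal.ofReal (ℓ ^ d) := by
  rw [gbox_preimage, (EuclideanSpace.volume_preserving_symm_measurableEquiv_toLp (Fin d)).measure_preimage_equiv,
    volume_pi_pi]
  simp [ENNReal.ofReal_pow h.le]

lemma gbox_norm {d : ℕ} {ℓ : ℝ} (h : 0 < ℓ) {y : Euc d} (hy : y ∈ gbox d ℓ) : ‖y‖ ≤ Real.sqrt d * ℓ := by
  rw [EuclideanSpace.norm_eq]
  have : ∑ i, ‖y i‖ ^ 2 ≤ d * ℓ ^ 2 := by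
    calc ∑ i, ‖y i‖ ^ 2 ≤ ∑ i : Fin d, ℓ ^ 2 := by
          refine Finset.sum_le_sum fun i _ => ?_
          rw [Real.norm_eq_abs, abs_of_nonneg (hy i).1]
          exact pow_le_pow_left₀ (hy i).1 (hy i).2 2
      _ = d * ℓ ^ 2 := by simp
  calc _ ≤ Real.sqrt (d * ℓ ^ 2) := Real.sqrt_le_sqrt this
    _ = _ := by rw [Real.sqrt_mul (by positivity), Real.sqrt_sq h.le]

lemma gbox_avg {d : ℕ} {ℓ : ℝ} (h : 0 < ℓ) (f : Euc d → Euc d) :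
    ∫ y, f y ∂(ProbabilityTheory.cond volume (gbox d ℓ)) = (ℓ ^ d)⁻¹ • ∫ y in gbox d ℓ, f y := by
  rw [ProbabilityTheory.cond, integral_smul_measure, gbox_vol d ℓ h, ENNReal.toReal_inv,
    ENNReal.toReal_ofReal (by positivity)]

lemma gbox_prob (d : ℕ) {ℓ : ℝ} (h : 0 < ℓ) :
    IsProbabilityMeasure (ProbabilityTheory.cond (volume : Measure (Euc d)) (gbox d ℓ)) := by
  apply ProbabilityTheory.cond_isProbabilityMeasure_of_finite
  · rw [gbox_vol d ℓ h]; simp; positivity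
  · rw [gbox_vol d ℓ h]; simp

lemma corrector {d : ℕ} (u p : Euc d → Euc d) (u' p' : Euc d → Euc d →L[ℝ] Euc d)
    (hu : ∀ x, HasFDerivAt u (u' x) x) (hp : ∀ x, HasFDerivAt p (p' x) x)
    (K L ε C Y a ℓ : ℝ) (hL : 0 ≤ L) (hK0 : 0 ≤ K) (hε : 0 ≤ ε) (hC : 0 ≤ C) (hℓ : 0 < ℓ)
    (hY : Y = Real.sqrt d * ℓ)
    (hu' : ∀ x, ‖u' x‖ ≤ L) (htr : ∀ x, trC d (u' x) = 0) (hK : ∀ x, ‖u x‖ ≤ K)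
    (hpε : ∀ x, ‖p x‖ ≤ ε) (hpC : ∀ x, ‖p' x‖ ≤ C)
    (hsym : ∀ x y z, ⟪p' x y, z⟫ = ⟪y, p' x z⟫)
    (ha : ∀ x, ‖(ℓ ^ d)⁻¹ • ∫ y in gbox d ℓ, u (x + y)‖ ≤ a) :
    ∃ (w : Euc d → Euc d) (w' : Euc d → Euc d →L[ℝ] Euc d), (∀ x, HasFDerivAt w (w' x) x) ∧
      (∀ x, ‖w' x‖ ≤ L + (L + 2 * (C * K + ε * L) * Y)) ∧
      (∀ x, trC d (w' x) + ⟪p x, w x⟫ = 0) ∧ ∀ x, ‖w x - u x‖ ≤ a + 2 * (ε * K * Y) := by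
  have hY0 : 0 ≤ Y := by rw [hY]; positivity
  have hcu : Continuous u := continuous_iff_continuousAt.2 fun x => (hu x).continuousAt
  have hcp : Continuous p := continuous_iff_continuousAt.2 fun x => (hp x).continuousAt
  have hu'm : Measurable u' := by
    have : u' = fderiv ℝ u := by ext1 x; exact (hu x).fderiv.symm
    rw [this]; exact measurable_fderiv ℝ u
  set νb := ProbabilityTheory.cond (volume : Measure (Euc d)) (gbox d ℓ) with hνb
  have := gbox_prob d hℓ
  set νs := (volume : Measure ℝ).restrict (Set.Icc 0 1) with hνs
  have : IsProbabilityMeasure νs := ⟨by simp [hνs]⟩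
  set ν := νb.prod νs with hν
  have hbox : ∀ᵐ q ∂ν, ‖q.1‖ ≤ Y := by
    have h1 : ∀ᵐ y ∂νb, ‖y‖ ≤ Y := by
      filter_upwards [ProbabilityTheory.ae_cond_mem (μ := volume) (gbox_meas d ℓ)] with y hy
      rw [hY]; exact gbox_norm hℓ hy
    exact Measure.quasiMeasurePreserving_fst.ae h1
  set G : Euc d × ℝ → Euc d → Euc d := fun q x =>
    ⟪p x, u (x + q.2 • q.1)⟫ • q.1 - ⟪p x, q.1⟫ • u (x + q.2 • q.1) with hG
  set F : Euc d × ℝ → Euc d → Euc d := fun q x => - u (x + q.1) + G q x with hF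
  have hFc : Continuous (Function.uncurry F) := by
    simp only [hF, hG, Function.uncurry_def]
    fun_prop
  have hder := corr_deriv u p u' p' hu hp K L ε C Y hL hK0 hε hC hY0 hu' htr hK hpε hpC hsym
  have hGb : ∀ x, ∀ q : Euc d × ℝ, ‖q.1‖ ≤ Y → ‖G q x‖ ≤ 2 * (ε * K * Y) := by
    intro x q hq
    have e3 : |⟪p x, u (x + q.2 • q.1)⟫| ≤ ε * K :=
      (abs_real_inner_le_norm _ _).trans (mul_le_mul (hpε x) (hK _) (norm_nonneg _) hε)
    have e5 : |⟪p x, q.1⟫| ≤ ε * Y :=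
      (abs_real_inner_le_norm _ _).trans (mul_le_mul (hpε x) hq (norm_nonneg _) hε)
    refine (norm_sub_le _ _).trans ?_
    rw [norm_smul, norm_smul, Real.norm_eq_abs, Real.norm_eq_abs]
    have f1 := mul_le_mul e3 hq (norm_nonneg _) (by positivity)
    have f2 := mul_le_mul e5 (hK (x + q.2 • q.1)) (norm_nonneg _) (by positivity)
    linarith
  have hGm : ∀ x, AEStronglyMeasurable (fun q => G q x) ν := fun x =>
    (by simp only [hG]; fun_prop : Continuous fun q => G q x).aestronglyMeasurable
  have hGi : ∀ x, Integrable (fun q => G q x) ν := fun x =>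
    ⟨hGm x, HasFiniteIntegral.of_bounded (C := 2 * (ε * K * Y)) (by
      filter_upwards [hbox] with q hq using hGb x q hq)⟩
  have hui : ∀ x, Integrable (fun q : Euc d × ℝ => u (x + q.1)) ν := fun x =>
    ⟨(by fun_prop : Continuous fun q : Euc d × ℝ => u (x + q.1)).aestronglyMeasurable,
      HasFiniteIntegral.of_bounded (C := K) (Eventually.of_forall fun q => hK _)⟩
  have hui1 : ∀ x, Integrable (fun y : Euc d => u (x + y)) νb := fun x =>
    ⟨(by fun_prop : Continuous fun y : Euc d => u (x + y)).aestronglyMeasurable,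
      HasFiniteIntegral.of_bounded (C := K) (Eventually.of_forall fun q => hK _)⟩
  have hFm : ∀ x, AEStronglyMeasurable (fun q => F q x) ν := fun x =>
    (hui x).1.neg.add (hGm x)
  have hFi : ∀ x, Integrable (fun q => F q x) ν := fun x => (hui x).neg.add (hGi x)
  have hlb : 0 ≤ L + 2 * (C * K + ε * L) * Y := by positivity
  have key := param_diff ν F (fun q x => fderiv ℝ (F q) x) (K + 2 * (ε * K * Y))
    (L + 2 * (C * K + ε * L) * Y) hlb hFm
    (fun x => ((measurable_fderiv_with_param ℝ hFc).comp
      (measurable_id.prodMk measurable_const)).aestronglyMeasurable)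
    (fun x => by
      filter_upwards [hbox] with q hq
      refine (norm_add_le _ _).trans (add_le_add ?_ (hGb x q hq))
      rw [norm_neg]; exact hK _)
    (by
      filter_upwards [hbox] with q hq x y
      refine Convex.norm_image_sub_le_of_norm_fderiv_le (𝕜 := ℝ) (s := Set.univ) ?_ ?_ convex_univ
        (Set.mem_univ _) (Set.mem_univ _)
      · intro z _
        obtain ⟨F', h1, -, -⟩ := hder q.1 q.2 hq z
        exact h1.differentiableAt
      · intro z _
        obtain ⟨F', h1, h2, -⟩ := hder q.1 q.2 hq z
        rw [h1.fderiv]; exact h2)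
    (fun x => by
      filter_upwards [hbox] with q hq
      obtain ⟨F', h1, -, -⟩ := hder q.1 q.2 hq x
      exact h1.differentiableAt.hasFDerivAt)
  have hA : ∀ x, ∫ q : Euc d × ℝ, u (x + q.1) ∂ν = ∫ y, u (x + y) ∂νb := by
    intro x
    rw [hν, integral_prod _ (hui x)]
    simp
  have hFTC : ∀ x y, ∫ s, u' (x + s • y) y ∂νs = u (x + y) - u x := by
    intro x y
    rw [hνs, integral_Icc_eq_integral_Ioc, ← intervalIntegral.integral_of_le zero_le_one]
    have := intervalIntegral.integral_eq_sub_of_hasDerivAt (a := (0:ℝ)) (b := 1)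
      (f := fun s : ℝ => u (x + s • y)) (f' := fun s => u' (x + s • y) y) ?_ ?_
    · simpa using this
    · intro s _
      have h1 : HasDerivAt (fun s : ℝ => x + s • y) y s := by
        simpa using ((hasDerivAt_id s).smul_const y).const_add x
      exact (hu _).comp_hasDerivAt s h1
    · rw [intervalIntegrable_iff_integrableOn_Ioc_of_le zero_le_one]
      refine ⟨?_, HasFiniteIntegral.of_bounded (C := L * ‖y‖) (Eventually.of_forall fun s =>
        (u' _).le_of_opNorm_le (hu' _) y)⟩
      refine Measurable.aestronglyMeasurable ?_
      exact (ContinuousLinearMap.measurable_apply y).comp (hu'm.comp (by fun_prop))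
  have hDm : ∀ x, Integrable (fun q : Euc d × ℝ => u' (x + q.2 • q.1) q.1) ν := by
    intro x
    refine ⟨?_, HasFiniteIntegral.of_bounded (C := L * Y) (by
      filter_upwards [hbox] with q hq
      exact ((u' _).le_of_opNorm_le (hu' _) _).trans (mul_le_mul_of_nonneg_left hq hL))⟩
    refine Measurable.aestronglyMeasurable ?_
    exact (isBoundedBilinearMap_apply (𝕜 := ℝ) (E := Euc d) (F := Euc d)).continuous.measurable.comp
      ((hu'm.comp (by fun_prop : Measurable fun q : Euc d × ℝ => x + q.2 • q.1)).prodMk measurable_fst)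
  refine ⟨fun x => u x + ∫ q, F q x ∂ν, fun x => u' x + ∫ q, fderiv ℝ (F q) x ∂ν,
    fun x => (hu x).add (key x).2.1, fun x => (norm_add_le _ _).trans (add_le_add (hu' x) (key x).2.2),
    fun x => ?_, fun x => ?_⟩
  · rw [map_add, htr, ← ContinuousLinearMap.integral_comp_comm _ (key x).1]
    have e1 : ∫ q, trC d (fderiv ℝ (F q) x) ∂ν = ⟪p x, ∫ y, u (x + y) ∂νb⟫ - ⟪p x, u x⟫ := by
      calc ∫ q, trC d (fderiv ℝ (F q) x) ∂ν = ∫ q : Euc d × ℝ, ⟪p x, u' (x + q.2 • q.1) q.1⟫ ∂ν := by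
            apply integral_congr_ae
            filter_upwards [hbox] with q hq
            obtain ⟨F', h1, -, h3⟩ := hder q.1 q.2 hq x
            rw [← h3]; congr 1; exact h1.fderiv
        _ = ⟪p x, ∫ q : Euc d × ℝ, u' (x + q.2 • q.1) q.1 ∂ν⟫ := integral_inner (hDm x) _
        _ = _ := by
            rw [hν, integral_prod _ (hDm x)]
            simp only [hFTC]
            rw [integral_sub (hui1 x) (integrable_const _), inner_sub_right]
            simp
    have e2 : ⟪p x, ∫ q, F q x ∂ν⟫ = - ⟪p x, ∫ y, u (x + y) ∂νb⟫ := by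
      rw [← integral_inner (hFi x), ← hA, ← integral_inner (hui x), ← integral_neg]
      congr 1; ext q
      simp only [hF, hG, inner_add_right, inner_sub_right, inner_smul_right, inner_neg_right]
      ring
    rw [e1, inner_add_right, e2]
    ring
  · rw [add_sub_cancel_left]
    have : ∫ q, F q x ∂ν = - (∫ y, u (x + y) ∂νb) + ∫ q, G q x ∂ν := by
      rw [← hA, ← integral_neg]
      exact integral_add (hui x).neg (hGi x)
    rw [this]
    refine (norm_add_le _ _).trans (add_le_add ?_ ?_)
    · rw [norm_neg, hνb, gbox_avg hℓ]; exact ha x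
    · have := norm_integral_le_of_norm_le_const (μ := ν) (f := fun q => G q x) (C := 2 * (ε * K * Y)) (by
        filter_upwards [hbox] with q hq using hGb x q hq)
      simpa using this

lemma prod_one_add_bd {ι : Type*} [DecidableEq ι] (s : Finset ι) : ∃ A : ℝ, 0 ≤ A ∧ ∀ (ε : ℝ) (x : ι → ℝ), 0 ≤ ε →
    ε ≤ 1 → (∀ i, |x i| ≤ ε) → |∏ i ∈ s, (1 + x i) - 1 - ∑ i ∈ s, x i| ≤ A * ε ^ 2 ∧ |∑ i ∈ s, x i| ≤ A * ε := by
  induction s using Finset.induction_on with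
  | empty => exact ⟨0, le_rfl, fun ε x _ _ _ => by simp⟩
  | insert a s ha ih =>
    obtain ⟨A, hA, H⟩ := ih
    refine ⟨3 * A + 1, by positivity, fun ε x h0 h1 hx => ?_⟩
    obtain ⟨H1, H2⟩ := H ε x h0 h1 hx
    rw [Finset.prod_insert ha, Finset.sum_insert ha]
    set P := ∏ i ∈ s, (1 + x i)
    set S := ∑ i ∈ s, x i
    have hxa := hx a
    constructor
    · have e1 : |P - 1| ≤ 2 * A * ε := by
        have : P - 1 = (P - 1 - S) + S := by ring
        rw [this]
        refine (abs_add_le _ _).trans ?_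
        nlinarith [mul_le_mul_of_nonneg_left h1 (mul_nonneg hA h0)]
      have e2 : |x a * (P - 1)| ≤ ε * (2 * A * ε) := by
        rw [abs_mul]; exact mul_le_mul hxa e1 (abs_nonneg _) h0
      have : (1 + x a) * P - 1 - (x a + S) = (P - 1 - S) + x a * (P - 1) := by ring
      rw [this]
      refine (abs_add_le _ _).trans ?_
      nlinarith [sq_nonneg ε]
    · refine (abs_add_le _ _).trans ?_
      nlinarith [mul_nonneg hA h0]

lemma det_lb_matrix (d : ℕ) : ∃ C : ℝ, 0 ≤ C ∧ ∀ (M : Matrix (Fin d) (Fin d) ℝ) (ε : ℝ), 0 ≤ ε → ε ≤ 1 →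
    (∀ i j, |M i j| ≤ ε) → 1 + M.trace - C * ε ^ 2 ≤ (1 + M).det := by
  obtain ⟨A, hA, H⟩ := prod_one_add_bd (Finset.univ : Finset (Fin d))
  set N : ℝ := ∑ σ ∈ (Finset.univ : Finset (Equiv.Perm (Fin d))).erase 1, (2:ℝ) ^ d with hN
  have hN0 : 0 ≤ N := by positivity
  refine ⟨A + N, by positivity, fun M ε h0 h1 hM => ?_⟩
  rw [Matrix.det_apply', ← Finset.add_sum_erase _ _ (Finset.mem_univ (1 : Equiv.Perm (Fin d)))]
  have e1 := (H ε (fun i => M i i) h0 h1 (fun i => hM i i)).1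
  have e2 : |∑ σ ∈ (Finset.univ : Finset (Equiv.Perm (Fin d))).erase 1,
      ((Equiv.Perm.sign σ : ℤ) : ℝ) * ∏ i, (1 + M) (σ i) i| ≤ N * ε ^ 2 := by
    refine (Finset.abs_sum_le_sum_abs _ _).trans ?_
    rw [hN, Finset.sum_mul]
    refine Finset.sum_le_sum fun σ hσ => ?_
    have hs : |((Equiv.Perm.sign σ : ℤ) : ℝ)| = 1 := by
      rcases Int.units_eq_one_or (Equiv.Perm.sign σ) with h | h <;> simp [h]
    rw [abs_mul, hs, one_mul, Finset.abs_prod]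
    have hne : σ ≠ 1 := (Finset.mem_erase.1 hσ).1
    obtain ⟨i, hi⟩ : ∃ i, σ i ≠ i := by
      by_contra h
      push Not at h
      exact hne (Equiv.ext h)
    have hj : σ (σ i) ≠ σ i := fun h => hi (σ.injective h)
    have hb : ∀ k, |(1 + M) (σ k) k| ≤ 2 := by
      intro k
      rw [Matrix.add_apply]
      refine (abs_add_le _ _).trans ?_
      have : |(1 : Matrix (Fin d) (Fin d) ℝ) (σ k) k| ≤ 1 := by
        rw [Matrix.one_apply]; split_ifs <;> simp
      linarith [hM (σ k) k]
    have hoff : ∀ k, σ k ≠ k → |(1 + M) (σ k) k| ≤ ε := by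
      intro k hk
      rw [Matrix.add_apply, Matrix.one_apply_ne hk, zero_add]
      exact hM _ _
    rw [← Finset.mul_prod_erase _ _ (Finset.mem_univ i),
      ← Finset.mul_prod_erase _ _ (Finset.mem_erase.2 ⟨hi, Finset.mem_univ (σ i)⟩)]
    have hr : ∏ k ∈ (Finset.univ.erase i).erase (σ i), |(1 + M) (σ k) k| ≤ 2 ^ d := by
      calc _ ≤ ∏ k ∈ (Finset.univ.erase i).erase (σ i), (2:ℝ) :=
            Finset.prod_le_prod (fun _ _ => abs_nonneg _) fun k _ => hb k
        _ = 2 ^ (((Finset.univ : Finset (Fin d)).erase i).erase (σ i)).card := by simp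
        _ ≤ 2 ^ d := by
            refine pow_le_pow_right₀ (by norm_num) ?_
            refine (Finset.card_le_univ _).trans (by simp)
    have hr0 : 0 ≤ ∏ k ∈ (Finset.univ.erase i).erase (σ i), |(1 + M) (σ k) k| :=
      Finset.prod_nonneg fun _ _ => abs_nonneg _
    calc _ ≤ ε * (ε * 2 ^ d) := mul_le_mul (hoff i hi) (mul_le_mul (hoff _ hj) hr hr0 h0)
            (by positivity) h0
      _ = _ := by ring
  have e3 : ((Equiv.Perm.sign (1 : Equiv.Perm (Fin d)) : ℤ) : ℝ) * ∏ i, (1 + M) ((1 : Equiv.Perm (Fin d)) i) i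
      = ∏ i, (1 + M i i) := by simp
  rw [e3]
  have e4 : M.trace = ∑ i, M i i := rfl
  rw [e4]
  have := abs_le.1 e1
  have := abs_le.1 e2
  nlinarith

lemma det_lb (d : ℕ) : ∃ C : ℝ, 0 ≤ C ∧ ∀ (X : Euc d →L[ℝ] Euc d) (ε : ℝ), 0 ≤ ε → ε ≤ 1 →
    ‖X‖ ≤ ε → 1 + trC d X - C * ε ^ 2 ≤ (ContinuousLinearMap.id ℝ (Euc d) + X).det := by
  obtain ⟨C, hC, H⟩ := det_lb_matrix d
  refine ⟨C, hC, fun X ε h0 h1 hX => ?_⟩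
  set b := (EuclideanSpace.basisFun (Fin d) ℝ).toBasis with hb
  have e := H (LinearMap.toMatrix b b X.toLinearMap) ε h0 h1 (by
    intro i j
    rw [LinearMap.toMatrix_apply]
    have h2 : (b.repr (X.toLinearMap (b j))) i = X (b j) i := by simp [hb]
    rw [h2]
    have h3 := PiLp.norm_apply_le (X (b j)) i
    rw [Real.norm_eq_abs] at h3
    refine h3.trans ?_
    have := X.le_of_opNorm_le hX (b j)
    have h4 : ‖b j‖ = 1 := by simp [hb]
    rw [h4, mul_one] at this
    exact this)
  rw [← LinearMap.trace_eq_matrix_trace ℝ b] at e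
  have h5 : (1 + LinearMap.toMatrix b b X.toLinearMap) = LinearMap.toMatrix b b
      ((ContinuousLinearMap.id ℝ (Euc d) + X).toLinearMap) := by
    rw [show (ContinuousLinearMap.id ℝ (Euc d) + X).toLinearMap = LinearMap.id + X.toLinearMap from rfl,
      map_add, LinearMap.toMatrix_id]
  rw [h5, LinearMap.det_toMatrix] at e
  exact e

/-- the weight -/
noncomputable def wgt (d : ℕ) (R : ℝ) (x : Euc d) : ℝ := ((R ^ 2 + ‖x‖ ^ 2) ^ (d + 1))⁻¹

/-- gradient of the log of the weight -/
noncomputable def wgrad (d : ℕ) (R : ℝ) (x : Euc d) : Euc d := (-(2 * (d + 1)) * (R ^ 2 + ‖x‖ ^ 2)⁻¹) • x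

lemma wgt_pos {d : ℕ} {R : ℝ} (hR : 1 ≤ R) (x : Euc d) : 0 < wgt d R x := by
  unfold wgt; positivity

lemma wgt_cont {d : ℕ} {R : ℝ} (hR : 1 ≤ R) : Continuous (wgt d R) := by
  unfold wgt
  refine Continuous.inv₀ (by fun_prop) fun x => ?_
  positivity

lemma wgt_lower {d : ℕ} {R : ℝ} (hR : 1 ≤ R) (x z : Euc d) :
    wgt d R x * (1 + ⟪wgrad d R x, z⟫ - (d + 1) * ‖z‖ ^ 2) ≤ wgt d R (x + z) := by
  unfold wgt wgrad
  rw [inner_smul_left, norm_add_sq_real]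
  simp only [conj_trivial]
  set D := R ^ 2 + ‖x‖ ^ 2 with hD
  set i := ⟪x, z⟫
  have hD1 : 1 ≤ D := by nlinarith [sq_nonneg ‖x‖]
  have hD' : 0 < D + (2 * i + ‖z‖ ^ 2) := by
    have h1 : D + (2 * i + ‖z‖ ^ 2) = R ^ 2 + ‖x + z‖ ^ 2 := by
      rw [norm_add_sq_real]; ring
    rw [h1]; positivity
  have e0 : R ^ 2 + (‖x‖ ^ 2 + 2 * i + ‖z‖ ^ 2) = D + (2 * i + ‖z‖ ^ 2) := by rw [hD]; ring
  rw [e0]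
  set e := 2 * i + ‖z‖ ^ 2 with he
  have hDp : 0 < D := by linarith
  have hb := one_add_mul_le_pow (a := - e / (D + e)) (by
    rw [le_div_iff₀ hD']; linarith) (d + 1)
  have h2 : 1 + - e / (D + e) = D / (D + e) := by field_simp; ring
  rw [h2, div_pow] at hb
  have h3 : - e / D ≤ - e / (D + e) := by
    rw [div_le_div_iff₀ hDp hD']; nlinarith [sq_nonneg e]
  have h4 : ‖z‖ ^ 2 / D ≤ ‖z‖ ^ 2 := div_le_self (sq_nonneg _) hD1
  have h5 : 1 + (-(2 * ((d:ℝ) + 1)) * D⁻¹ * i) - (d + 1) * ‖z‖ ^ 2 ≤ 1 + ((d + 1 : ℕ) : ℝ) * (- e / (D + e)) := by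
    have h6 : - e / D = - 2 * i * D⁻¹ - ‖z‖ ^ 2 / D := by rw [he]; field_simp; ring
    have h7 : - 2 * i * D⁻¹ - ‖z‖ ^ 2 ≤ - e / (D + e) := by linarith
    push_cast
    have h8 : (0:ℝ) ≤ (d:ℝ) + 1 := by positivity
    have := mul_le_mul_of_nonneg_left h7 h8
    linarith
  have h9 := h5.trans hb
  rw [inv_mul_le_iff₀ (by positivity)]
  rw [← div_eq_mul_inv]
  exact h9

lemma wgt_upper {d : ℕ} {R ρ : ℝ} (hR : 1 ≤ R) (x z : Euc d) (hz : ‖z‖ ≤ ρ) :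
    wgt d R (x + z) ≤ (2 + 2 * ρ ^ 2) ^ (d + 1) * wgt d R x := by
  unfold wgt
  have h1 : ‖x‖ ≤ ‖x + z‖ + ρ := by
    have := norm_sub_le (x + z) z
    rw [add_sub_cancel_right] at this; linarith
  have hρ : 0 ≤ ρ := (norm_nonneg _).trans hz
  have h2 : R ^ 2 + ‖x‖ ^ 2 ≤ (2 + 2 * ρ ^ 2) * (R ^ 2 + ‖x + z‖ ^ 2) := by
    have h3 : ‖x‖ ^ 2 ≤ (‖x + z‖ + ρ) ^ 2 := pow_le_pow_left₀ (norm_nonneg _) h1 2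
    have h4 : (‖x + z‖ + ρ) ^ 2 ≤ 2 * ‖x + z‖ ^ 2 + 2 * ρ ^ 2 := by nlinarith [sq_nonneg (‖x + z‖ - ρ)]
    have h5 : 1 ≤ R ^ 2 := by nlinarith
    nlinarith [sq_nonneg ‖x + z‖, sq_nonneg ρ, mul_nonneg (sq_nonneg ρ) (sq_nonneg ‖x + z‖),
      mul_nonneg (sq_nonneg ρ) (by linarith : 0 ≤ R ^ 2 - 1)]
  rw [← div_eq_mul_inv, le_div_iff₀ (by positivity), inv_mul_le_iff₀ (by positivity), ← mul_pow]
  refine pow_le_pow_left₀ (by positivity) ?_ _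
  linarith

lemma wgt_integrable {d : ℕ} {R : ℝ} (hR : 1 ≤ R) : Integrable (wgt d R) := by
  have h := integrable_rpow_neg_one_add_norm_sq (E := Euc d) (μ := volume) (r := 2 * (d + 1)) (by
    simp; norm_cast; omega)
  refine h.mono' (wgt_cont hR).aestronglyMeasurable (Eventually.of_forall fun x => ?_)
  rw [Real.norm_eq_abs, abs_of_pos (wgt_pos hR x)]
  have e : -(2 * ((d:ℝ) + 1)) / 2 = -((d + 1 : ℕ) : ℝ) := by push_cast; ring
  rw [e, Real.rpow_neg (by positivity), Real.rpow_natCast]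
  unfold wgt
  refine inv_anti₀ (by positivity) (pow_le_pow_left₀ (by positivity) ?_ _)
  nlinarith

lemma wgrad_norm {d : ℕ} {R : ℝ} (hR : 1 ≤ R) (x : Euc d) : ‖wgrad d R x‖ ≤ (d + 1) / R := by
  unfold wgrad
  have hD : 0 < R ^ 2 + ‖x‖ ^ 2 := by positivity
  rw [norm_smul, Real.norm_eq_abs, abs_mul, abs_neg, abs_of_nonneg (by positivity : (0:ℝ) ≤ 2 * ((d:ℝ) + 1)),
    abs_of_pos (by positivity), le_div_iff₀ (by positivity)]
  have : 2 * ‖x‖ * R ≤ R ^ 2 + ‖x‖ ^ 2 := by nlinarith [sq_nonneg (R - ‖x‖)]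
  have h2 : (R ^ 2 + ‖x‖ ^ 2)⁻¹ * (2 * ‖x‖ * R) ≤ 1 := by
    rw [inv_mul_le_iff₀ hD]; linarith
  have h3 : (0:ℝ) ≤ (d:ℝ) + 1 := by positivity
  nlinarith [mul_le_mul_of_nonneg_left h2 h3]

lemma wgrad_deriv {d : ℕ} {R : ℝ} (hR : 1 ≤ R) (x : Euc d) :
    ∃ p' : Euc d →L[ℝ] Euc d, HasFDerivAt (wgrad d R) p' x ∧ ‖p'‖ ≤ 6 * (d + 1) ∧
      ∀ y z, ⟪p' y, z⟫ = ⟪y, p' z⟫ := by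
  have hD : 0 < R ^ 2 + ‖x‖ ^ 2 := by positivity
  have hD1 : 1 ≤ R ^ 2 + ‖x‖ ^ 2 := by nlinarith [sq_nonneg ‖x‖]
  have h1 : HasFDerivAt (fun x : Euc d => R ^ 2 + ‖x‖ ^ 2) (2 • innerSL ℝ x) x :=
    ((hasStrictFDerivAt_norm_sq x).hasFDerivAt).const_add _
  have h2 := (((hasDerivAt_inv hD.ne').comp_hasFDerivAt x h1).const_mul (-(2 * ((d:ℝ) + 1)))).smul (hasFDerivAt_id x)
  refine ⟨_, h2, ?_, ?_⟩
  · refine ContinuousLinearMap.opNorm_le_bound _ (by positivity) fun k => ?_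
    simp only [_root_.add_apply, _root_.smul_apply, ContinuousLinearMap.smulRight_apply,
      ContinuousLinearMap.id_apply, smul_eq_mul, Function.comp_apply, innerSL_apply_apply, id]
    set D := R ^ 2 + ‖x‖ ^ 2 with hDd
    have hn : (0:ℝ) ≤ (d:ℝ) + 1 := by positivity
    have hi1 : D⁻¹ ≤ 1 := inv_le_one_of_one_le₀ hD1
    have hx2 : ‖x‖ ^ 2 ≤ D ^ 2 := by nlinarith [sq_nonneg R]
    have g1 : ‖(-(2 * ((d:ℝ) + 1)) * D⁻¹) • k‖ ≤ 2 * (d + 1) * ‖k‖ := by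
      rw [norm_smul, Real.norm_eq_abs, abs_mul, abs_neg, abs_of_nonneg (by positivity : (0:ℝ) ≤ 2 * ((d:ℝ) + 1)),
        abs_of_pos (by positivity)]
      refine mul_le_mul_of_nonneg_right ?_ (norm_nonneg _)
      exact mul_le_of_le_one_right (by positivity) hi1
    have g2 : ‖(-(2 * ((d:ℝ) + 1)) * (-(D ^ 2)⁻¹ * 2 • ⟪x, k⟫)) • x‖ ≤ 4 * (d + 1) * ‖k‖ := by
      rw [norm_smul, Real.norm_eq_abs, two_nsmul]
      have : |-(2 * ((d:ℝ) + 1)) * (-(D ^ 2)⁻¹ * (⟪x, k⟫ + ⟪x, k⟫))| = 4 * (d + 1) * ((D ^ 2)⁻¹ * |⟪x, k⟫|) := by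
        rw [show -(2 * ((d:ℝ) + 1)) * (-(D ^ 2)⁻¹ * (⟪x, k⟫ + ⟪x, k⟫)) = (4 * (d + 1) * (D ^ 2)⁻¹) * ⟪x, k⟫ by ring,
          abs_mul, abs_of_nonneg (by positivity)]
        ring
      rw [this]
      have h6 := abs_real_inner_le_norm x k
      have h7 : (D ^ 2)⁻¹ * |⟪x, k⟫| * ‖x‖ ≤ ‖k‖ := by
        rw [mul_assoc, inv_mul_le_iff₀ (by positivity)]
        calc _ ≤ ‖x‖ * ‖k‖ * ‖x‖ := mul_le_mul_of_nonneg_right h6 (norm_nonneg _)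
          _ = ‖x‖ ^ 2 * ‖k‖ := by ring
          _ ≤ _ := mul_le_mul_of_nonneg_right hx2 (norm_nonneg _)
      rw [mul_assoc]
      exact mul_le_mul_of_nonneg_left h7 (by positivity)
    refine (norm_add_le _ _).trans ?_
    linarith
  · intro y z
    simp [inner_add_left, inner_add_right, inner_smul_left, inner_smul_right]
    rw [real_inner_comm y x]
    ring_nf

/-- the weighted measure -/
noncomputable def wmu (d : ℕ) (R : ℝ) : Measure (Euc d) :=
  volume.withDensity (fun x => ENNReal.ofReal (wgt d R x))

lemma wmu_finite (d : ℕ) {R : ℝ} (hR : 1 ≤ R) : IsFiniteMeasure (wmu d R) :=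
  isFiniteMeasure_withDensity_ofReal (wgt_integrable hR).2

lemma wmu_le_vol (d : ℕ) {R : ℝ} (hR : 1 ≤ R) (A : Set (Euc d)) (hA : MeasurableSet A) : wmu d R A ≤ volume A := by
  rw [wmu, withDensity_apply _ hA]
  calc _ ≤ ∫⁻ x in A, 1 := by
        refine lintegral_mono fun x => ?_
        rw [ENNReal.ofReal_le_one]
        unfold wgt
        refine inv_le_one_of_one_le₀ (one_le_pow₀ ?_)
        nlinarith [sq_nonneg ‖x‖]
    _ = _ := by simp

lemma wmu_ge_vol (d : ℕ) {R : ℝ} (hR : 1 ≤ R) (ρ : ℝ) (A : Set (Euc d)) (hA : MeasurableSet A)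
    (hAρ : ∀ x ∈ A, ‖x‖ ≤ ρ) :
    ENNReal.ofReal (((R ^ 2 + ρ ^ 2) ^ (d + 1))⁻¹) * volume A ≤ wmu d R A := by
  rw [wmu, withDensity_apply _ hA, ← setLIntegral_const]
  refine setLIntegral_mono' hA fun x hx => ENNReal.ofReal_le_ofReal ?_
  unfold wgt
  refine inv_anti₀ (by positivity) (pow_le_pow_left₀ (by positivity) ?_ _)
  have := pow_le_pow_left₀ (norm_nonneg _) (hAρ x hx) 2
  linarith

lemma wmu_pos (d : ℕ) {R : ℝ} (hR : 1 ≤ R) : 0 < (wmu d R).real Set.univ := by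
  have := wmu_finite d hR
  rw [measureReal_def]
  refine ENNReal.toReal_pos ?_ (measure_ne_top _ _)
  intro h
  have h1 := wmu_ge_vol d hR 1 (ball 0 1) measurableSet_ball (fun x hx => (mem_ball_zero_iff.1 hx).le)
  have h2 : wmu d R (ball 0 1) = 0 := measure_mono_null (Set.subset_univ _) h
  rw [h2, nonpos_iff_eq_zero, mul_eq_zero] at h1
  rcases h1 with h1 | h1
  · rw [ENNReal.ofReal_eq_zero] at h1
    have : 0 < ((R ^ 2 + (1:ℝ) ^ 2) ^ (d + 1))⁻¹ := by positivity
    linarith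
  · exact (measure_ball_pos volume (0 : Euc d) one_pos).ne' h1

lemma euler_inj {d : ℕ} {w : Euc d → Euc d} {w' : Euc d → Euc d →L[ℝ] Euc d} {L h : ℝ}
    (hw : ∀ x, HasFDerivAt w (w' x) x) (hL : ∀ x, ‖w' x‖ ≤ L) (hh : 0 ≤ h) (hhL : h * L < 1) :
    Function.Injective (fun x => x + h • w x) := by
  intro x y hxy
  have h1 : ‖w y - w x‖ ≤ L * ‖y - x‖ := by
    refine Convex.norm_image_sub_le_of_norm_fderiv_le (𝕜 := ℝ) (s := Set.univ) ?_ ?_ convex_univ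
        (Set.mem_univ _) (Set.mem_univ _)
    · exact fun z _ => (hw z).differentiableAt
    · exact fun z _ => by rw [(hw z).fderiv]; exact hL z
  have h2 : x - y = h • (w y - w x) := by
    simp only at hxy
    rw [smul_sub, sub_eq_sub_iff_add_eq_add, add_comm (h • w y), hxy]
  have h3 : ‖x - y‖ ≤ h * (L * ‖x - y‖) := by
    conv_lhs => rw [h2, norm_smul, Real.norm_eq_abs, abs_of_nonneg hh]
    rw [norm_sub_rev x y]
    exact mul_le_mul_of_nonneg_left h1 hh
  by_contra hne
  have : 0 < ‖x - y‖ := norm_pos_iff.2 (sub_ne_zero.2 hne)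
  nlinarith

lemma euler_arith {h A0 C1 C2 α : ℝ} (hh : 0 < h) (hhle : h ≤ 1) (hA0p : 0 ≤ A0) (hC1p : 0 ≤ C1)
    (hC2p : 0 ≤ C2) (hαb : |α| ≤ A0) (hs1 : h * A0 + C1 * h ≤ 1) (hs2 : h * A0 + C2 * h ≤ 1) :
    0 ≤ 1 + h * α - C1 * h ^ 2 ∧ 0 ≤ 1 - h * α - C2 * h ^ 2 ∧
    1 - (A0 ^ 2 + C1 + C2 + A0 * (C1 + C2)) * h ^ 2 ≤
      (1 + h * α - C1 * h ^ 2) * (1 - h * α - C2 * h ^ 2) := by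
  have hαh : |h * α| ≤ h * A0 := by rw [abs_mul, abs_of_pos hh]; exact mul_le_mul_of_nonneg_left hαb hh.le
  have hαh' := abs_le.1 hαh
  have hhh2 : h ^ 2 ≤ h := by nlinarith
  have hq1 : C1 * h ^ 2 ≤ C1 * h := mul_le_mul_of_nonneg_left hhh2 hC1p
  have hq2 : C2 * h ^ 2 ≤ C2 * h := mul_le_mul_of_nonneg_left hhh2 hC2p
  refine ⟨by linarith, by linarith, ?_⟩
  have k5 : 1 - (A0 ^ 2 + C1 + C2 + A0 * (C1 + C2)) * h ^ 2 ≤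
      (1 + h * α - C1 * h ^ 2) * (1 - h * α - C2 * h ^ 2) := by
    have z1 : (h * α) ^ 2 ≤ h ^ 2 * A0 ^ 2 := by
      rw [← mul_pow]; exact sq_le_sq' (by linarith) (by linarith)
    have z2 : h * α * (C2 - C1) ≤ A0 * (C1 + C2) := by
      have : |h * α * (C2 - C1)| ≤ A0 * (C1 + C2) := by
        rw [abs_mul]
        refine mul_le_mul (hαh.trans ?_) ?_ (abs_nonneg _) hA0p
        · nlinarith
        · rw [abs_le]; constructor <;> linarith
      exact (abs_le.1 this).2
    have z3 := mul_le_mul_of_nonneg_left z2 (sq_nonneg h)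
    have z4 : 0 ≤ C1 * C2 * (h ^ 2) ^ 2 := by positivity
    nlinarith
  exact k5

set_option maxHeartbeats 800000 in
lemma euler_mass (d : ℕ) {R L W : ℝ} (hR : 1 ≤ R) (hL0 : 0 ≤ L) (hW0 : 0 ≤ W) :
    ∃ C h0 : ℝ, 0 ≤ C ∧ 0 < h0 ∧ h0 * L < 1 ∧ h0 ≤ 1 ∧
    ∀ (w : Euc d → Euc d) (w' : Euc d → Euc d →L[ℝ] Euc d), (∀ x, HasFDerivAt w (w' x) x) →
      (∀ x, ‖w' x‖ ≤ L) → (∀ x, ‖w x‖ ≤ W) → (∀ x, trC d (w' x) + ⟪wgrad d R x, w x⟫ = 0) →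
      ∀ h, 0 < h → h ≤ h0 → ∀ A, MeasurableSet A →
        ENNReal.ofReal (1 - C * h ^ 2) * wmu d R A ≤ wmu d R ((fun x => x + h • w x) '' A) := by
  obtain ⟨Cd, hCd, hdet⟩ := det_lb d
  set A0 : ℝ := (d + 1) * W with hA0
  set C1 := Cd * L ^ 2 with hC1
  set C2 : ℝ := (d + 1) * W ^ 2 with hC2
  have hA0p : 0 ≤ A0 := by positivity
  have hC1p : 0 ≤ C1 := by positivity
  have hC2p : 0 ≤ C2 := by positivity
  have hden : 0 < 2 * (1 + L + A0 + C1 + C2) := by positivity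
  have hh0 : (1 / (2 * (1 + L + A0 + C1 + C2))) * (2 * (1 + L + A0 + C1 + C2)) = 1 := by field_simp
  set h0 := 1 / (2 * (1 + L + A0 + C1 + C2)) with hh0d
  have hh0p : 0 < h0 := by positivity
  refine ⟨A0 ^ 2 + C1 + C2 + A0 * (C1 + C2), h0, by positivity, hh0p, by nlinarith, by nlinarith, ?_⟩
  intro w w' hw hL hW htr h hh hhh A hA
  have hh1 : h * (2 * (1 + L + A0 + C1 + C2)) ≤ 1 := by
    exact (mul_le_mul_of_nonneg_right hhh hden.le).trans hh0.le
  have hhle : h ≤ 1 := by nlinarith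
  have hhL : h * L ≤ 1 := by nlinarith
  have hinj : Function.Injective (fun x => x + h • w x) := euler_inj hw hL hh.le (by nlinarith)
  have hcw : Continuous w := continuous_iff_continuousAt.2 fun x => (hw x).continuousAt
  have hmi : MeasurableSet ((fun x => x + h • w x) '' A) :=
    hA.image_of_continuousOn_injOn (by fun_prop) hinj.injOn
  rw [wmu, withDensity_apply _ hmi, withDensity_apply _ hA, ← lintegral_const_mul _ (by
    exact (wgt_cont hR).measurable.ennreal_ofReal)]
  rw [lintegral_image_eq_lintegral_abs_det_fderiv_mul volume hA (f := fun x => x + h • w x)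
    (f' := fun x => ContinuousLinearMap.id ℝ (Euc d) + h • w' x)
    (fun x _ => ((hasFDerivAt_id x).add ((hw x).const_smul h)).hasFDerivWithinAt) hinj.injOn]
  refine lintegral_mono fun x => ?_
  rw [← ENNReal.ofReal_mul' (wgt_pos hR x).le, ← ENNReal.ofReal_mul (abs_nonneg _)]
  refine ENNReal.ofReal_le_ofReal ?_
  have hd1 := hdet (h • w' x) (h * L) (by positivity) hhL (by
    rw [norm_smul, Real.norm_eq_abs, abs_of_pos hh]; exact mul_le_mul_of_nonneg_left (hL x) hh.le)
  have hf1 := wgt_lower hR x (h • w x)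
  set α := trC d (w' x) with hα
  have hin : ⟪wgrad d R x, w x⟫ = - α := by linarith [htr x]
  have hαb : |α| ≤ A0 := by
    have e1 : |⟪wgrad d R x, w x⟫| ≤ (d + 1) * W := by
      refine (abs_real_inner_le_norm _ _).trans (mul_le_mul ?_ (hW x) (norm_nonneg _) (by positivity))
      refine (wgrad_norm hR x).trans (div_le_self (by positivity) hR)
    rwa [hin, abs_neg] at e1
  rw [map_smul, smul_eq_mul, ← hα, mul_pow] at hd1
  rw [inner_smul_right, hin, norm_smul, Real.norm_eq_abs, abs_of_pos hh, mul_pow] at hf1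
  set F := wgt d R x with hF
  have hFp : 0 < F := wgt_pos hR x
  have hab := abs_le.1 hαb
  have hW2 : ‖w x‖ ^ 2 ≤ W ^ 2 := pow_le_pow_left₀ (norm_nonneg _) (hW x) 2
  have k1 : 1 + h * α - C1 * h ^ 2 ≤ |(ContinuousLinearMap.id ℝ (Euc d) + h • w' x).det| := by
    refine le_trans ?_ (hd1.trans (le_abs_self _))
    rw [hC1]; nlinarith
  have k2 : F * (1 - h * α - C2 * h ^ 2) ≤ wgt d R (x + h • w x) := by
    refine le_trans ?_ hf1
    refine mul_le_mul_of_nonneg_left ?_ hFp.le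
    have : ((d:ℝ) + 1) * (h ^ 2 * ‖w x‖ ^ 2) ≤ C2 * h ^ 2 := by
      rw [hC2]
      have : h ^ 2 * ‖w x‖ ^ 2 ≤ h ^ 2 * W ^ 2 := mul_le_mul_of_nonneg_left hW2 (sq_nonneg h)
      have h9 : (0:ℝ) ≤ d + 1 := by positivity
      nlinarith
    linarith
  obtain ⟨k3, k4, k5⟩ := euler_arith hh hhle hA0p hC1p hC2p hαb (by nlinarith) (by nlinarith)
  calc (1 - (A0 ^ 2 + C1 + C2 + A0 * (C1 + C2)) * h ^ 2) * F
      ≤ ((1 + h * α - C1 * h ^ 2) * (1 - h * α - C2 * h ^ 2)) * F :=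
        mul_le_mul_of_nonneg_right k5 hFp.le
    _ = (1 + h * α - C1 * h ^ 2) * (F * (1 - h * α - C2 * h ^ 2)) := by ring
    _ ≤ _ := mul_le_mul k1 k2 (by positivity) (abs_nonneg _)

/-- a translate with large overlap -/
lemma exists_translate {d : ℕ} (ρ : ℝ) (hρ : 0 < ρ) (A B : Set (Euc d)) (hA : MeasurableSet A) (hB : MeasurableSet B)
    (hAρ : A ⊆ ball 0 ρ) (hBρ : B ⊆ ball 0 ρ) :
    ∃ z : Euc d, ‖z‖ < 2 * ρ ∧
      volume A * volume B ≤ volume (ball (0 : Euc d) (2 * ρ)) * volume {x | x ∈ A ∧ x + z ∈ B} := by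
  by_contra hcon
  push Not at hcon
  have hAf : volume A ≠ ⊤ := ((measure_mono hAρ).trans_lt measure_ball_lt_top).ne
  have hBf : volume B ≠ ⊤ := ((measure_mono hBρ).trans_lt measure_ball_lt_top).ne
  -- Tonelli
  have hmeas : MeasurableSet {q : Euc d × Euc d | q.2 ∈ A ∧ q.2 + q.1 ∈ B} :=
    (measurable_snd hA).inter ((measurable_snd.add measurable_fst) hB)
  have e1 : ∫⁻ z, volume {x | x ∈ A ∧ x + z ∈ B} = volume A * volume B := by
    have := Measure.measure_prod_null (μ := (volume : Measure (Euc d))) (ν := (volume : Measure (Euc d))) hmeas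
    have h1 := Measure.prod_apply (μ := (volume : Measure (Euc d))) (ν := (volume : Measure (Euc d))) hmeas
    have h2 := Measure.prod_apply_symm (μ := (volume : Measure (Euc d))) (ν := (volume : Measure (Euc d))) hmeas
    rw [h1] at h2
    have h3 : ∀ z : Euc d, (Prod.mk z ⁻¹' {q : Euc d × Euc d | q.2 ∈ A ∧ q.2 + q.1 ∈ B}) = {x | x ∈ A ∧ x + z ∈ B} :=
      fun z => rfl
    simp only [h3] at h2
    rw [h2]
    have h4 : ∀ x : Euc d, volume ((fun z => (z, x)) ⁻¹' {q : Euc d × Euc d | q.2 ∈ A ∧ q.2 + q.1 ∈ B})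
        = A.indicator (fun _ => volume B) x := by
      intro x
      by_cases hx : x ∈ A
      · have : ((fun z => (z, x)) ⁻¹' {q : Euc d × Euc d | q.2 ∈ A ∧ q.2 + q.1 ∈ B}) = (fun z => x + z) ⁻¹' B := by
          ext z; simp [hx]
        rw [this, measure_preimage_add]
        simp [hx]
      · simp [hx]
    simp only [h4]
    rw [lintegral_indicator hA]
    simp [mul_comm]
  have e2 : ∀ z : Euc d, z ∉ ball (0 : Euc d) (2 * ρ) → volume {x | x ∈ A ∧ x + z ∈ B} = 0 := by
    intro z hz
    have : {x | x ∈ A ∧ x + z ∈ B} = ∅ := by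
      ext x
      simp only [Set.mem_ofPred_eq, Set.mem_empty_iff_false, iff_false, not_and]
      intro h1 h2
      apply hz
      have h3 := mem_ball_zero_iff.1 (hAρ h1)
      have h4 := mem_ball_zero_iff.1 (hBρ h2)
      rw [mem_ball_zero_iff]
      have := norm_sub_le (x + z) x
      rw [add_sub_cancel_left] at this
      linarith
    rw [this]; simp
  set V := volume (ball (0 : Euc d) (2 * ρ)) with hV
  have hV0 : V ≠ 0 := (measure_ball_pos _ _ (by positivity)).ne'
  have hVt : V ≠ ⊤ := measure_ball_lt_top.ne
  have e3 : ∫⁻ z, volume {x | x ∈ A ∧ x + z ∈ B} = ∫⁻ z in ball (0 : Euc d) (2 * ρ), volume {x | x ∈ A ∧ x + z ∈ B} := by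
    rw [← lintegral_indicator measurableSet_ball]
    congr 1; ext z
    by_cases hz : z ∈ ball (0 : Euc d) (2 * ρ)
    · simp only [Set.indicator_of_mem hz]
    · rw [Set.indicator_of_notMem hz, e2 z hz]
  have hgm : Measurable fun z => volume {x | x ∈ A ∧ x + z ∈ B} :=
    measurable_measure_prodMk_left hmeas
  have e4 : ∫⁻ z in ball (0 : Euc d) (2 * ρ), V * volume {x | x ∈ A ∧ x + z ∈ B} <
      ∫⁻ z in ball (0 : Euc d) (2 * ρ), volume A * volume B := by
    refine lintegral_strict_mono_of_ae_le_of_ae_lt_on (s := ball (0 : Euc d) (2 * ρ)) ?_ ?_ ?_ ?_ ?_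
    · exact measurable_const.aemeasurable
    · rw [lintegral_const_mul _ hgm, ← e3, e1]
      exact ENNReal.mul_ne_top hVt (ENNReal.mul_ne_top hAf hBf)
    · rw [EventuallyLE, ae_restrict_iff' measurableSet_ball]
      exact Eventually.of_forall fun z hz => (hcon z (mem_ball_zero_iff.1 hz)).le
    · simpa [hV] using hV0
    · exact Eventually.of_forall fun z hz => hcon z (mem_ball_zero_iff.1 hz)
  rw [lintegral_const_mul _ hgm, ← e3, e1, setLIntegral_const, ← hV, mul_comm] at e4
  exact lt_irrefl _ e4

lemma isop (d : ℕ) {R : ℝ} (hR : 1 ≤ R) (m0 : ℝ) (hm0 : 0 < m0) : ∃ q : ℝ, 0 < q ∧ ∀ A : Set (Euc d),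
    MeasurableSet A → m0 ≤ (wmu d R).real A → m0 ≤ (wmu d R).real Aᶜ → ∀ δ, 0 < δ → δ ≤ 1 →
      (wmu d R).real A + δ * q ≤ (wmu d R).real (thickening δ A) := by
  have := wmu_finite d hR
  set μ := wmu d R with hμ
  obtain ⟨n, hn⟩ : ∃ n : ℕ, μ (ball (0 : Euc d) (n + 1))ᶜ < ENNReal.ofReal (m0 / 2) := by
    have h1 : Tendsto (fun n : ℕ => μ (ball (0 : Euc d) (n + 1))ᶜ) atTop (nhds (μ (⋂ n : ℕ, (ball (0 : Euc d) (n + 1))ᶜ))) := by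
      refine tendsto_measure_iInter_atTop (fun n => measurableSet_ball.compl.nullMeasurableSet) ?_ ⟨0, measure_ne_top _ _⟩
      intro i j hij
      exact Set.compl_subset_compl.2 (ball_subset_ball (by gcongr))
    have h2 : (⋂ n : ℕ, (ball (0 : Euc d) (n + 1))ᶜ) = ∅ := by
      ext x
      simp only [Set.mem_iInter, Set.mem_compl_iff, mem_ball_zero_iff, Set.mem_empty_iff_false, iff_false, not_forall,
        not_not]
      obtain ⟨n, hn⟩ := exists_nat_gt ‖x‖
      exact ⟨n, by linarith⟩
    rw [h2, measure_empty] at h1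
    exact (h1.eventually_lt_const (by simpa using hm0)).exists
  set ρ : ℝ := n + 1 with hρd
  have hρ : 0 < ρ := by positivity
  have half : ∀ A : Set (Euc d), MeasurableSet A → m0 ≤ μ.real A → ENNReal.ofReal (m0 / 2) ≤ volume (A ∩ ball 0 ρ) := by
    intro A hA hmA
    refine le_trans ?_ (wmu_le_vol d hR _ (hA.inter measurableSet_ball))
    have h3 : μ A ≤ μ (A ∩ ball 0 ρ) + μ (ball (0 : Euc d) ρ)ᶜ := by
      refine (measure_mono ?_).trans (measure_union_le _ _)
      intro x hx
      by_cases h : x ∈ ball (0 : Euc d) ρ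
      · exact Or.inl ⟨hx, h⟩
      · exact Or.inr h
    have h4 : ENNReal.ofReal m0 ≤ μ A := by
      rw [measureReal_def] at hmA
      exact (ENNReal.ofReal_le_iff_le_toReal (measure_ne_top _ _)).2 hmA
    have h5 : ENNReal.ofReal (m0 / 2) + ENNReal.ofReal (m0 / 2) ≤ μ (A ∩ ball 0 ρ) + ENNReal.ofReal (m0 / 2) := by
      rw [← ENNReal.ofReal_add (by positivity) (by positivity), add_halves]
      exact h4.trans (h3.trans (by gcongr))
    exact (ENNReal.add_le_add_iff_right ENNReal.ofReal_ne_top).1 h5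
  set V := (volume (ball (0 : Euc d) (2 * ρ))).toReal with hV
  have hVpos : 0 < V := ENNReal.toReal_pos (measure_ball_pos _ _ (by positivity)).ne' measure_ball_lt_top.ne
  set cm : ℝ := ((R ^ 2 + (3 * ρ) ^ 2) ^ (d + 1))⁻¹ with hcm
  have hcmp : 0 < cm := by positivity
  refine ⟨cm * (m0 / 2) ^ 2 / (V * (2 * ρ + 1)), by positivity, ?_⟩
  intro A hA hmA hmAc δ hδ hδ1
  obtain ⟨z, hz, hzV⟩ := exists_translate ρ hρ (A ∩ ball 0 ρ) (Aᶜ ∩ ball 0 ρ) (hA.inter measurableSet_ball)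
    (hA.compl.inter measurableSet_ball) Set.inter_subset_right Set.inter_subset_right
  set E := {x | x ∈ A ∩ ball 0 ρ ∧ x + z ∈ Aᶜ ∩ ball 0 ρ} with hE
  set N : ℕ := ⌊2 * ρ / δ⌋₊ + 1 with hN
  have hNpos : (0:ℝ) < N := by positivity
  have hN1 : 2 * ρ / δ < N := by rw [hN]; push_cast; exact Nat.lt_floor_add_one _
  have hN2 : (N : ℝ) ≤ (2 * ρ + 1) / δ := by
    rw [hN]; push_cast
    have h1 : (⌊2 * ρ / δ⌋₊ : ℝ) ≤ 2 * ρ / δ := Nat.floor_le (by positivity)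
    have h2 : 1 ≤ 1 / δ := by rw [le_div_iff₀ hδ]; linarith
    rw [add_div]; linarith
  set y : Euc d := (N : ℝ)⁻¹ • z with hy
  have hyz : (N : ℝ) • y = z := by rw [hy, smul_smul, mul_inv_cancel₀ hNpos.ne', one_smul]
  have hyδ : ‖y‖ < δ := by
    rw [hy, norm_smul, norm_inv, Real.norm_natCast, inv_mul_lt_iff₀ hNpos]
    rw [div_lt_iff₀ hδ] at hN1
    linarith
  set S := (thickening δ A \ A) ∩ ball 0 (3 * ρ) with hS
  have hSm : MeasurableSet S := (isOpen_thickening.measurableSet.diff hA).inter measurableSet_ball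
  have hcov : E ⊆ ⋃ k ∈ Finset.range N, (fun x => x + ((k : ℝ) + 1) • y) ⁻¹' S := by
    intro x hx
    have hex : ∃ k : ℕ, x + (k : ℝ) • y ∉ A := ⟨N, by rw [hyz]; exact hx.2.1⟩
    classical
    set k := Nat.find hex with hk
    have hk1 : x + (k : ℝ) • y ∉ A := Nat.find_spec hex
    have hk0 : k ≠ 0 := by
      intro h0
      rw [h0] at hk1
      apply hk1
      simpa using hx.1.1
    have hkN : k ≤ N := Nat.find_min' hex (by rw [hyz]; exact hx.2.1)
    obtain ⟨j, hj⟩ := Nat.exists_eq_succ_of_ne_zero hk0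
    have hj1 : x + (j : ℝ) • y ∈ A := by
      by_contra hcon
      exact Nat.find_min hex (m := j) (by omega) hcon
    simp only [Set.mem_iUnion]
    refine ⟨j, Finset.mem_range.2 (by omega), ?_⟩
    have hjk : (k : ℝ) = (j : ℝ) + 1 := by rw [hj]; push_cast; ring
    rw [hjk] at hk1
    refine ⟨⟨?_, hk1⟩, ?_⟩
    · rw [mem_thickening_iff]
      refine ⟨_, hj1, ?_⟩
      rw [dist_eq_norm, add_sub_add_left_eq_sub, ← sub_smul]
      simpa using hyδ
    · rw [mem_ball_zero_iff]
      have h1 := mem_ball_zero_iff.1 hx.1.2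
      have h2 : ‖((j:ℝ) + 1) • y‖ ≤ ‖z‖ := by
        rw [← hyz, norm_smul _ y, norm_smul _ y]
        refine mul_le_mul_of_nonneg_right ?_ (norm_nonneg y)
        rw [← hjk, Real.norm_natCast, Real.norm_natCast]
        exact_mod_cast hkN
      have := norm_add_le x (((j:ℝ) + 1) • y)
      linarith
  have hvE : volume E ≤ N * volume S := by
    refine (measure_mono hcov).trans ((measure_biUnion_finset_le _ _).trans ?_)
    calc ∑ k ∈ Finset.range N, volume ((fun x => x + ((k : ℝ) + 1) • y) ⁻¹' S)
        = ∑ k ∈ Finset.range N, volume S := by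
          refine Finset.sum_congr rfl fun k _ => ?_
          exact measure_preimage_add_right volume _ S
      _ = N * volume S := by simp
      _ ≤ N * volume S := le_rfl
  have hSf : volume S ≠ ⊤ := ((measure_mono Set.inter_subset_right).trans_lt measure_ball_lt_top).ne
  have hSμ : cm * (volume S).toReal ≤ μ.real S := by
    have h1 := wmu_ge_vol d hR (3 * ρ) S hSm (fun x hx => (mem_ball_zero_iff.1 hx.2).le)
    have h2 := ENNReal.toReal_mono (measure_ne_top _ _) h1
    rwa [ENNReal.toReal_mul, ENNReal.toReal_ofReal hcmp.le] at h2
  have hmain : (m0 / 2) ^ 2 ≤ V * (N * (volume S).toReal) := by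
    have h1 : ENNReal.ofReal (m0 / 2) * ENNReal.ofReal (m0 / 2) ≤ volume (ball (0 : Euc d) (2 * ρ)) * (N * volume S) :=
      (mul_le_mul' (half A hA hmA) (half Aᶜ hA.compl hmAc)).trans (hzV.trans (by gcongr))
    have h2 := ENNReal.toReal_mono (ENNReal.mul_ne_top measure_ball_lt_top.ne
      (ENNReal.mul_ne_top (ENNReal.natCast_ne_top _) hSf)) h1
    rw [ENNReal.toReal_mul, ENNReal.toReal_mul, ENNReal.toReal_mul, ENNReal.toReal_ofReal (by positivity),
      ENNReal.toReal_natCast] at h2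
    rw [sq]; exact h2
  have hth : μ.real A + μ.real S ≤ μ.real (thickening δ A) := by
    rw [← measureReal_union (by
      rw [Set.disjoint_left]; intro x hx hxS; exact hxS.1.2 hx) hSm]
    refine measureReal_mono ?_
    rintro x (hx | hx)
    · exact self_subset_thickening hδ A hx
    · exact hx.1.1
  refine le_trans ?_ hth
  refine add_le_add_right ?_ _
  refine le_trans ?_ hSμ
  rw [mul_div_assoc', div_le_iff₀ (by positivity)]
  have hNδ : (N : ℝ) * δ ≤ 2 * ρ + 1 := by rwa [le_div_iff₀ hδ] at hN2
  have hS0 : 0 ≤ (volume S).toReal := ENNReal.toReal_nonneg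
  calc δ * (cm * (m0 / 2) ^ 2) ≤ δ * (cm * (V * (N * (volume S).toReal))) := by gcongr
    _ = cm * (volume S).toReal * (V * (N * δ)) := by ring
    _ ≤ _ := by gcongr

/-- class of admissible fields with uniform constants -/
structure GCls {d : ℕ} (K Lc : ℝ) (δ : ℝ → ℝ) (ℓ a b : ℝ) (c : ℝ → Euc d → ℝ) (v : ℝ → Euc d → Euc d) :
    Prop extends GReg K Lc δ c v where
  cb : ∀ t x, b ≤ c t x
  div : ∀ t, ∀ᵐ x, LinearMap.trace ℝ (Euc d) (fderiv ℝ (v t) x).toLinearMap = 0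
  avg : ∀ t x, ‖(ℓ ^ d)⁻¹ • ∫ y in gbox d ℓ, v t (x + y)‖ ≤ a

/-- constraints on the constants -/
structure GConst (K Lc ℓ a b : ℝ) : Prop where
  K1 : 1 ≤ K
  Lc0 : 0 ≤ Lc
  ℓ0 : 0 < ℓ
  a0 : 0 ≤ a
  ab : a < b

lemma GCls.shift {d : ℕ} {K Lc ℓ a b : ℝ} {δ : ℝ → ℝ} {c : ℝ → Euc d → ℝ} {v : ℝ → Euc d → Euc d}
    (h : GCls K Lc δ ℓ a b c v) (s : ℝ) (y : Euc d) :
    GCls K Lc δ ℓ a b (fun t x => c (t + s) (x + y)) (fun t x => v (t + s) (x + y)) where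
  cpos t x := h.cpos _ _
  cK t x := h.cK _ _
  vK t x := h.vK _ _
  δpos := h.δpos
  md ε hε t t' htt x := h.md ε hε _ _ (by rwa [add_sub_add_right_eq_sub]) _
  lip t x x' := by
    have := h.lip (t + s) (x + y) (x' + y)
    rwa [add_sub_add_right_eq_sub] at this
  cb t x := h.cb _ _
  div t := by
    have h1 := (measurePreserving_add_right (volume : Measure (Euc d)) y).quasiMeasurePreserving.ae (h.div (t + s))
    filter_upwards [h1] with x hx
    rw [fderiv_comp_add_right]
    exact hx
  avg t x := by
    have := h.avg (t + s) (x + y)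
    simpa only [add_right_comm x _ y] using this

lemma GCls.rev {d : ℕ} {K Lc ℓ a b : ℝ} {δ : ℝ → ℝ} {c : ℝ → Euc d → ℝ} {v : ℝ → Euc d → Euc d}
    (h : GCls K Lc δ ℓ a b c v) :
    GCls K Lc δ ℓ a b (fun t x => c (-t) x) (fun t x => - v (-t) x) where
  cpos t x := h.cpos _ _
  cK t x := h.cK _ _
  vK t x := by rw [norm_neg]; exact h.vK _ _
  δpos := h.δpos
  md ε hε t t' htt x := by
    have := h.md ε hε (-t) (-t') (by rwa [neg_sub_neg, abs_sub_comm]) x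
    rwa [neg_sub_neg, norm_sub_rev (v (-t') x)]
  lip t x x' := by
    have := h.lip (-t) x x'
    rwa [neg_sub_neg, norm_sub_rev (v (-t) x')]
  cb t x := h.cb _ _
  div t := by
    filter_upwards [h.div (-t)] with x hx
    have : fderiv ℝ (fun x => - v (-t) x) x = - fderiv ℝ (v (-t)) x := fderiv_fun_neg
    rw [this]
    rw [← trC_apply] at hx ⊢
    rw [map_neg, hx, neg_zero]
  avg t x := by
    rw [integral_neg, smul_neg, norm_neg]
    exact h.avg _ _

lemma wfield (d : ℕ) {K Lc ℓ a b : ℝ} (hc : GConst K Lc ℓ a b) :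
    ∃ R L' W κ : ℝ, 1 ≤ R ∧ 0 ≤ L' ∧ 0 ≤ W ∧ 0 < κ ∧ κ ≤ b ∧ 
    ∀ (δ : ℝ → ℝ) (c : ℝ → Euc d → ℝ) (v : ℝ → Euc d → Euc d), GCls K Lc δ ℓ a b c v → ∀ t,
      ∃ (w : Euc d → Euc d) (w' : Euc d → Euc d →L[ℝ] Euc d), (∀ x, HasFDerivAt w (w' x) x) ∧
        (∀ x, ‖w' x‖ ≤ L') ∧ (∀ x, ‖w x‖ ≤ W) ∧ (∀ x, trC d (w' x) + ⟪wgrad d R x, w x⟫ = 0) ∧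
        ∀ x, ‖w x - v t x‖ ≤ b - κ := by
  obtain ⟨hK1, hLc, hℓ, ha, hab⟩ := hc
  set G := b - a with hG
  have hGp : 0 < G := by linarith
  set Y := Real.sqrt d * ℓ with hY
  have hY0 : 0 ≤ Y := by positivity
  set R := max 1 (8 * (d + 1) * K * Y / G) with hR
  have hR1 : 1 ≤ R := le_max_left _ _
  have hR2 : 8 * (d + 1) * K * Y ≤ R * G := by
    rw [← div_le_iff₀ hGp]; exact le_max_right _ _
  set ε : ℝ := (d + 1) / R with hε
  have hRp : 0 < R := by linarith
  have hε0 : 0 ≤ ε := by positivity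
  have hεs : 2 * (ε * K * Y) ≤ G / 4 := by
    have : ε * R = d + 1 := by rw [hε]; field_simp
    have : R * (2 * (ε * K * Y)) ≤ R * (G / 4) := by
      have e : R * (2 * (ε * K * Y)) = 2 * (ε * R) * K * Y := by ring
      rw [e, this]; linarith
    exact le_of_mul_le_mul_left this hRp
  set η := G / (8 * (Lc + 1)) with hη
  have hηp : 0 < η := by positivity
  have hηL : Lc * η ≤ G / 8 := by
    rw [hη, mul_div_assoc', div_le_iff₀ (by positivity)]
    nlinarith
  refine ⟨R, Lc + (Lc + 2 * (6 * (d + 1) * K + ε * Lc) * Y), K + b, G / 2, hR1, by positivity, by linarith,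
    by linarith, by linarith, ?_⟩
  intro δ c v h t
  obtain ⟨u, u', hu, hu', htr, huK, huv⟩ := mollify (v t) Lc K η hLc hηp (fun x y => (h.lip t x y).2) (h.vK t)
    (h.div t)
  choose p' hp hpC hps using fun x => wgrad_deriv (d := d) hR1 x
  have huc : Continuous u := continuous_iff_continuousAt.2 fun x => (hu x).continuousAt
  have hvc : Continuous (v t) := by
    have : LipschitzWith Lc.toNNReal (v t) := by
      refine LipschitzWith.of_dist_le_mul fun x y => ?_
      rw [dist_eq_norm, dist_eq_norm, Real.coe_toNNReal _ hLc]
      exact (h.lip t x y).2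
    exact this.continuous
  have hbox : ∀ x, ‖(ℓ ^ d)⁻¹ • ∫ y in gbox d ℓ, u (x + y)‖ ≤ a + G / 8 := by
    intro x
    have := gbox_prob d hℓ
    have h1 := h.avg t x
    rw [← gbox_avg hℓ] at h1 ⊢
    set ν := ProbabilityTheory.cond (volume : Measure (Euc d)) (gbox d ℓ)
    have i1 : Integrable (fun y => u (x + y)) ν :=
      Integrable.of_bound (by fun_prop) K (Eventually.of_forall fun y => huK _)
    have i2 : Integrable (fun y => v t (x + y)) ν :=
      Integrable.of_bound (by fun_prop) K (Eventually.of_forall fun y => h.vK _ _)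
    have h2 : ‖∫ y, (u (x + y) - v t (x + y)) ∂ν‖ ≤ Lc * η * ν.real Set.univ :=
      norm_integral_le_of_norm_le_const (Eventually.of_forall fun y => huv _)
    rw [integral_sub i1 i2, probReal_univ, mul_one] at h2
    have h3 := norm_sub_norm_le (∫ y, u (x + y) ∂ν) (∫ y, v t (x + y) ∂ν)
    linarith
  obtain ⟨w, w', hw, hw', hwt, hwu⟩ := corrector u (wgrad d R) u' p' hu hp K Lc ε (6 * (d + 1)) Y (a + G / 8) ℓ
    hLc (by linarith) hε0 (by positivity) hℓ hY hu' htr huK (wgrad_norm hR1) hpC hps hbox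
  have hwv : ∀ x, ‖w x - v t x‖ ≤ b - G / 2 := by
    intro x
    have h1 := norm_sub_le_norm_sub_add_norm_sub (w x) (u x) (v t x)
    have h2 := hwu x
    have h3 := huv x
    linarith
  refine ⟨w, w', hw, hw', fun x => ?_, hwt, hwv⟩
  have h1 := norm_sub_norm_le (w x) (v t x)
  have h2 := hwv x
  have h3 := h.vK t x
  linarith

lemma euler_reach {d : ℕ} {K Lc ℓ a b : ℝ} {δ : ℝ → ℝ} {c : ℝ → Euc d → ℝ} {v : ℝ → Euc d → Euc d}
    (hLc : 0 ≤ Lc) (H : GCls K Lc δ ℓ a b c v) {κ W h t : ℝ} (hκ : 0 < κ) (hh : 0 ≤ h) (hδ : h ≤ δ (κ / 4))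
    (hL : Lc * (h * (W + κ)) ≤ κ / 4) {w : Euc d → Euc d} (hW : ∀ x, ‖w x‖ ≤ W)
    (hw : ∀ x, ‖w x - v t x‖ ≤ b - κ) (x z : Euc d) (hz : ‖z‖ ≤ κ / 2) :
    Reachable c v t x (t + h) (x + h • (w x + z)) := by
  refine reach_linear hh x _ fun s hs => ?_
  set g := w x + z with hg
  have hs1 : 0 ≤ s - t := by linarith [hs.1]
  have hs2 : s - t ≤ h := by linarith [hs.2]
  have h1 : ‖g‖ ≤ W + κ := by
    have := norm_add_le (w x) z
    have := hW x
    linarith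
  have h2 : ‖v t x - v s x‖ ≤ κ / 4 := (H.md (κ / 4) (by positivity) t s (by
    rw [abs_sub_comm, abs_of_nonneg hs1]; linarith) x).2
  have h3 : ‖v s x - v s (x + (s - t) • g)‖ ≤ κ / 4 := by
    refine ((H.lip s _ _).2).trans (le_trans ?_ hL)
    rw [sub_add_cancel_left, norm_neg, norm_smul, Real.norm_eq_abs, abs_of_nonneg hs1]
    exact mul_le_mul_of_nonneg_left (mul_le_mul hs2 h1 (norm_nonneg _) hh) hLc
  have h4 := H.cb s (x + (s - t) • g)
  have e : g - v s (x + (s - t) • g) = (w x - v t x) + z + (v t x - v s x) + (v s x - v s (x + (s - t) • g)) := by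
    rw [hg]; abel
  rw [e]
  refine (norm_add_le _ _).trans ?_
  have h5 := norm_add_le (w x - v t x + z) (v t x - v s x)
  have h6 := norm_add_le (w x - v t x) z
  have h7 := hw x
  linarith

lemma small_pos (f g : ℝ) (hf : 0 < f) (hg : 0 ≤ g) : 0 < f / (g + 1) ∧ ∀ h, h ≤ f / (g + 1) → 0 ≤ h → g * h ≤ f := by
  refine ⟨by positivity, fun h h1 h2 => ?_⟩
  rw [le_div_iff₀ (by positivity)] at h1
  linarith

set_option maxHeartbeats 1600000 in
lemma growth (d : ℕ) {K Lc ℓ a b : ℝ} (hc : GConst K Lc ℓ a b) (δ : ℝ → ℝ) (hδ : ∀ ε, 0 < ε → 0 < δ ε) :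
    ∃ R T : ℝ, 1 ≤ R ∧ 0 < T ∧ ∀ (c : ℝ → Euc d → ℝ) (v : ℝ → Euc d → Euc d),
      GCls K Lc δ ℓ a b c v → ∀ t x, ‖x‖ ≤ 1 → ∃ A, IsOpen A ∧ (∀ y ∈ A, Reachable c v t x (t + T) y) ∧
        5 / 8 * (wmu d R).real Set.univ ≤ (wmu d R).real A := by
  obtain ⟨R, L', W, κ, hR, hL', hW, hκ, -, hwf⟩ := wfield d hc
  obtain ⟨C, h0, hC, hh0, hh0L, hh01, hem⟩ := euler_mass d hR hL' hW
  have := wmu_finite d hR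
  set μ := wmu d R with hμ
  set mtot := μ.real Set.univ with hmt
  have hmtot : 0 < mtot := wmu_pos d hR
  obtain ⟨hs1, hs1'⟩ := small_pos (κ / 4) (Lc * (W + κ)) (by positivity) (mul_nonneg hc.Lc0 (by linarith))
  set h1 := min 1 (min (δ (κ / 4)) (κ / 4 / (Lc * (W + κ) + 1))) with hh1
  have hh1p : 0 < h1 := lt_min one_pos (lt_min (hδ _ (by positivity)) hs1)
  have hh1o : h1 ≤ 1 := min_le_left _ _
  have hh1δ : h1 ≤ δ (κ / 4) := (min_le_right _ _).trans (min_le_left _ _)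
  have hh1s : h1 ≤ κ / 4 / (Lc * (W + κ) + 1) := (min_le_right _ _).trans (min_le_right _ _)
  have hreg : ∀ h, 0 ≤ h → h ≤ h1 → h ≤ δ (κ / 4) ∧ Lc * (h * (W + κ)) ≤ κ / 4 := by
    intro h ha hb
    refine ⟨hb.trans hh1δ, ?_⟩
    have := hs1' h (hb.trans hh1s) ha
    linarith
  set ρ := 1 + W + κ with hρ
  set cm := ((R ^ 2 + ρ ^ 2) ^ (d + 1))⁻¹ with hcm
  have hcmp : 0 < cm := by positivity
  set m1 := min (cm * (volume (ball (0 : Euc d) (h1 * (κ / 2)))).toReal) (mtot / 2) with hm1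
  have hvb : 0 < (volume (ball (0 : Euc d) (h1 * (κ / 2)))).toReal :=
    ENNReal.toReal_pos (measure_ball_pos _ _ (by positivity)).ne' measure_ball_lt_top.ne
  have hm1p : 0 < m1 := lt_min (by positivity) (by positivity)
  have hm1h : m1 ≤ mtot / 2 := min_le_right _ _
  obtain ⟨q, hq, hiso⟩ := isop d hR (min (m1 / 2) (mtot / 4)) (lt_min (by positivity) (by positivity))
  obtain ⟨hs2, hs2'⟩ := small_pos (m1 / 2) (C * mtot) (by positivity) (by positivity)
  obtain ⟨hs3, hs3'⟩ := small_pos (κ * q / 4) (C * mtot) (by positivity) (by positivity)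
  obtain ⟨hs4, hs4'⟩ := small_pos 1 (κ / 2) (by positivity) (by positivity)
  obtain ⟨h, hhp, hhh1, hhh0, hh2, hh3, hh4⟩ : ∃ h : ℝ, 0 < h ∧ h ≤ h1 ∧ h ≤ h0 ∧ C * mtot * h ≤ m1 / 2 ∧
      C * mtot * h ≤ κ * q / 4 ∧ κ / 2 * h ≤ 1 := by
    set h := min h1 (min h0 (min (m1 / 2 / (C * mtot + 1)) (min (κ * q / 4 / (C * mtot + 1)) (1 / (κ / 2 + 1)))))
    have hp : 0 < h := lt_min hh1p (lt_min hh0 (lt_min hs2 (lt_min hs3 hs4)))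
    refine ⟨h, hp, min_le_left _ _, (min_le_right _ _).trans (min_le_left _ _), hs2' h ?_ hp.le, hs3' h ?_ hp.le,
      hs4' h ?_ hp.le⟩
    · exact (min_le_right _ _).trans ((min_le_right _ _).trans (min_le_left _ _))
    · exact (min_le_right _ _).trans ((min_le_right _ _).trans ((min_le_right _ _).trans (min_le_left _ _)))
    · exact (min_le_right _ _).trans ((min_le_right _ _).trans ((min_le_right _ _).trans (min_le_right _ _)))
  set θ := h * κ * q / 4 with hθ
  have hθp : 0 < θ := by positivity
  obtain ⟨N, hN⟩ := exists_nat_ge (mtot / θ)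
  have hNθ : mtot ≤ N * θ := by rwa [div_le_iff₀ hθp] at hN
  refine ⟨R, h1 + N * h, hR, by positivity, ?_⟩
  intro c v H t x hx
  have key : ∀ n : ℕ, ∃ A, IsOpen A ∧ (∀ y ∈ A, Reachable c v t x (t + (h1 + n * h)) y) ∧
      min (m1 + n * θ) (5 / 8 * mtot) ≤ μ.real A := by
    intro n
    induction n with
    | zero =>
      obtain ⟨w, w', hw, hw', hwW, hwt, hwv⟩ := hwf δ c v H t
      refine ⟨ball (x + h1 • w x) (h1 * (κ / 2)), isOpen_ball, fun y hy => ?_, ?_⟩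
      · rw [mem_ball, dist_eq_norm] at hy
        obtain ⟨r1, r2⟩ := hreg h1 hh1p.le le_rfl
        have := euler_reach hc.Lc0 H hκ hh1p.le r1 r2 hwW hwv x (h1⁻¹ • (y - (x + h1 • w x))) (by
          rw [norm_smul, norm_inv, Real.norm_eq_abs, abs_of_pos hh1p, inv_mul_le_iff₀ hh1p]
          exact hy.le)
        rw [smul_add, smul_smul, mul_inv_cancel₀ hh1p.ne', one_smul, ← add_assoc, add_sub_cancel] at this
        simpa using this
      · refine (min_le_left _ _).trans ?_
        simp only [Nat.cast_zero, zero_mul, add_zero]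
        refine (min_le_left _ _).trans ?_
        have g1 := wmu_ge_vol d hR ρ (ball (x + h1 • w x) (h1 * (κ / 2))) measurableSet_ball (fun y hy => by
          rw [mem_ball, dist_eq_norm] at hy
          have e1 : ‖y‖ ≤ ‖y - (x + h1 • w x)‖ + ‖x + h1 • w x‖ := by
            simpa using norm_add_le (y - (x + h1 • w x)) (x + h1 • w x)
          have e2 := norm_add_le x (h1 • w x)
          have e3 : ‖h1 • w x‖ ≤ W := by
            rw [norm_smul, Real.norm_eq_abs, abs_of_pos hh1p]
            have := hwW x
            nlinarith [norm_nonneg (w x)]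
          have : h1 * (κ / 2) ≤ κ := by nlinarith
          linarith)
        have g2 := ENNReal.toReal_mono (measure_ne_top _ _) g1
        rw [ENNReal.toReal_mul, ENNReal.toReal_ofReal hcmp.le, Measure.addHaar_ball_center] at g2
        exact g2
    | succ n ih =>
      obtain ⟨A, hAo, hAr, hAm⟩ := ih
      set t' := t + (h1 + n * h) with ht'
      obtain ⟨w, w', hw, hw', hwW, hwt, hwv⟩ := hwf δ c v H t'
      have hA1 : m1 ≤ μ.real A := le_trans (le_min (by nlinarith [Nat.cast_nonneg (α := ℝ) n]) (by linarith)) hAm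
      set B := (fun x => x + h • w x) '' A with hB
      have hcw : Continuous w := continuous_iff_continuousAt.2 fun x => (hw x).continuousAt
      have hhL : h * L' < 1 := lt_of_le_of_lt (mul_le_mul_of_nonneg_right hhh0 hL') hh0L
      have hBm : MeasurableSet B := hAo.measurableSet.image_of_continuousOn_injOn (by fun_prop)
        (euler_inj hw hw' hhp.le hhL).injOn
      have hmass : μ.real A - C * h ^ 2 * mtot ≤ μ.real B := by
        have g1 := hem w w' hw hw' hwW hwt h hhp hhh0 A hAo.measurableSet
        have g2 := ENNReal.toReal_mono (measure_ne_top _ _) g1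
        rw [ENNReal.toReal_mul, ENNReal.toReal_ofReal'] at g2
        have g3 : (1 - C * h ^ 2) * μ.real A ≤ μ.real B :=
          (mul_le_mul_of_nonneg_right (le_max_left _ _) measureReal_nonneg).trans g2
        have g4 : μ.real A ≤ mtot := measureReal_mono (Set.subset_univ _)
        have g5 : C * h ^ 2 * μ.real A ≤ C * h ^ 2 * mtot := mul_le_mul_of_nonneg_left g4 (by positivity)
        linarith
      have hh1' : h ≤ 1 := hhh0.trans hh01
      have hCh : C * h ^ 2 * mtot ≤ h * (κ * q / 4) := by
        have := mul_le_mul_of_nonneg_left hh3 hhp.le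
        linarith
      have hCh2 : C * h ^ 2 * mtot ≤ m1 / 2 := by
        have : C * mtot * h * h ≤ m1 / 2 * 1 := mul_le_mul hh2 hh1' hhp.le (by positivity)
        linarith
      refine ⟨thickening (h * (κ / 2)) B, isOpen_thickening, fun y hy => ?_, ?_⟩
      · rw [mem_thickening_iff] at hy
        obtain ⟨_, ⟨x1, hx1, rfl⟩, hy⟩ := hy
        simp only [dist_eq_norm] at hy
        obtain ⟨r1, r2⟩ := hreg h hhp.le hhh1
        have := euler_reach hc.Lc0 H hκ hhp.le r1 r2 hwW hwv x1 (h⁻¹ • (y - (x1 + h • w x1))) (by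
          rw [norm_smul, norm_inv, Real.norm_eq_abs, abs_of_pos hhp, inv_mul_le_iff₀ hhp]
          exact hy.le)
        rw [smul_add, smul_smul, mul_inv_cancel₀ hhp.ne', one_smul, ← add_assoc, add_sub_cancel] at this
        have e : t' + h = t + (h1 + ((n + 1 : ℕ) : ℝ) * h) := by rw [ht']; push_cast; ring
        rw [← e]
        exact reach_trans (hAr x1 hx1) this
      · by_cases hBc : min (m1 / 2) (mtot / 4) ≤ μ.real Bᶜ
        · have g := hiso B hBm ((min_le_left _ _).trans (by linarith)) hBc (h * (κ / 2)) (by positivity) (by linarith)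
          have g2 : μ.real A + θ ≤ μ.real (thickening (h * (κ / 2)) B) := by
            rw [hθ]; linarith
          refine le_trans ?_ g2
          rcases le_total (m1 + n * θ) (5 / 8 * mtot) with g3 | g3
          · rw [min_eq_left g3] at hAm
            refine (min_le_left _ _).trans ?_
            push_cast; linarith
          · rw [min_eq_right g3] at hAm
            exact (min_le_right _ _).trans (by linarith)
        · have g1 : μ.real Bᶜ ≤ mtot / 4 := (le_of_not_ge hBc).trans (min_le_right _ _)
          rw [measureReal_compl hBm] at g1
          have g2 : μ.real B ≤ μ.real (thickening (h * (κ / 2)) B) :=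
            measureReal_mono (self_subset_thickening (by positivity) B)
          refine (min_le_right _ _).trans ?_
          linarith
  obtain ⟨A, hAo, hAr, hAm⟩ := key N
  refine ⟨A, hAo, hAr, le_trans (le_min (by linarith) le_rfl) hAm⟩

/-- exact-time local controllability -/
lemma ctl_local (d : ℕ) {K Lc ℓ a b : ℝ} (hc : GConst K Lc ℓ a b) (δ : ℝ → ℝ) (hδ : ∀ ε, 0 < ε → 0 < δ ε) :
    ∃ T : ℝ, 0 < T ∧ ∀ (c : ℝ → Euc d → ℝ) (v : ℝ → Euc d → Euc d),
      GCls K Lc δ ℓ a b c v → ∀ t x y, ‖y - x‖ ≤ 1 → Reachable c v t x (t + T) y := by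
  obtain ⟨R, T, hR, hT, hg⟩ := growth d hc δ hδ
  have := wmu_finite d hR
  have hpos := wmu_pos d hR
  refine ⟨2 * T, by positivity, fun c v H t x y hxy => ?_⟩
  have H1 := H.shift 0 x
  obtain ⟨A, hAo, hAr, hAm⟩ := hg _ _ H1 t 0 (by simp)
  obtain ⟨B, hBo, hBr, hBm⟩ := hg _ _ H1.rev (-(t + 2 * T)) (y - x) hxy
  have hne : (A ∩ B).Nonempty := by
    by_contra hcon
    rw [Set.not_nonempty_iff_eq_empty] at hcon
    have h1 := measureReal_union (μ := wmu d R) (Set.disjoint_iff_inter_eq_empty.2 hcon) hBo.measurableSet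
    have h2 : (wmu d R).real (A ∪ B) ≤ (wmu d R).real Set.univ := measureReal_mono (Set.subset_univ _)
    linarith
  obtain ⟨z, hzA, hzB⟩ := hne
  have r1 := hAr z hzA
  have r2 := hBr z hzB
  rw [show -(t + 2 * T) + T = -(t + T) by ring] at r2
  have r3 := reach_shift 0 x (reach_trans r1 (reach_reverse r2))
  simpa using r3

lemma extend_reach {d : ℕ} {K Lc ℓ a b : ℝ} (hc : GConst K Lc ℓ a b) {δ : ℝ → ℝ} 
    {c : ℝ → Euc d → ℝ} {v : ℝ → Euc d → Euc d} (H : GCls K Lc δ ℓ a b c v) (t : ℝ) (x : Euc d) (s : ℝ)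
    (hs : 0 ≤ s) : ∃ z, Reachable c v t x (t + s) z := by
  have hb : 0 < b := hc.a0.trans_lt hc.ab
  have hK := hc.K1
  have hLc := hc.Lc0
  obtain ⟨hs1, hs1'⟩ := small_pos (b / 4) (Lc * (K + b)) (by positivity) (by positivity)
  set h1 := min (δ (b / 4)) (b / 4 / (Lc * (K + b) + 1)) with hh1
  have hh1p : 0 < h1 := lt_min (H.δpos _ (by positivity)) hs1
  obtain ⟨N, hN⟩ := exists_nat_gt (s / h1)
  have hN0 : (0:ℝ) < N := lt_of_le_of_lt (by positivity) hN
  have hst : s / N ≤ h1 := by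
    rw [div_lt_iff₀ hh1p] at hN
    rw [div_le_iff₀ hN0]; linarith
  have key : ∀ n : ℕ, ∃ z, Reachable c v t x (t + n * (s / N)) z := by
    intro n
    induction n with
    | zero => exact ⟨x, by simpa using reach_refl t x⟩
    | succ n ih =>
      obtain ⟨z, hz⟩ := ih
      have := euler_reach (t := t + n * (s / N)) (κ := b) (W := K) hLc H hb (h := s / N) (by positivity)
        (hst.trans (min_le_left _ _)) (by
          have := hs1' (s / N) (hst.trans (min_le_right _ _)) (by positivity)
          linarith) (w := v (t + n * (s / N))) (H.vK _) (by simp) z 0 (by simp; positivity)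
      refine ⟨z + (s / N) • (v (t + n * (s / N)) z + 0), ?_⟩
      rw [show t + ((n + 1 : ℕ) : ℝ) * (s / N) = t + n * (s / N) + s / N by push_cast; ring]
      exact reach_trans hz this
  have := key N
  rwa [mul_div_cancel₀ _ hN0.ne'] at this

/-- global exact-time control -/
structure Ctl {d : ℕ} (K T0 : ℝ) (c : ℝ → Euc d → ℝ) (v : ℝ → Euc d → Euc d) : Prop where
  ctl : ∀ t x y r, T0 * (1 + ‖y - x‖) ≤ r → Reachable c v t x (t + r) y
  dst : ∀ t x t1 y, Reachable c v t x t1 y → ‖y - x‖ ≤ 2 * K * (t1 - t)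

lemma ctl_global (d : ℕ) {K Lc ℓ a b : ℝ} (hc : GConst K Lc ℓ a b) (δ : ℝ → ℝ) (hδ : ∀ ε, 0 < ε → 0 < δ ε) :
    ∃ T0 : ℝ, 1 ≤ T0 ∧ ∀ (c : ℝ → Euc d → ℝ) (v : ℝ → Euc d → Euc d),
      GCls K Lc δ ℓ a b c v → Ctl K T0 c v := by
  obtain ⟨T, hT, hloc⟩ := ctl_local d hc δ hδ
  have hK := hc.K1
  refine ⟨max 1 (T * (2 + 2 * K * T)), le_max_left _ _, fun c v H => ⟨fun t x y r hr => ?_,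
    fun t x t1 y h => reach_dist H.cK H.vK h⟩⟩
  have chain : ∀ (n : ℕ) t z y, ‖y - z‖ ≤ n → Reachable c v t z (t + n * T) y := by
    intro n
    induction n with
    | zero =>
      intro t z y h
      have : y = z := by
        rw [← sub_eq_zero, ← norm_le_zero_iff]; simpa using h
      subst this
      simpa using reach_refl t y
    | succ n ih =>
      intro t z y h
      set lam : ℝ := 1 / (n + 1) with hlam
      have hn1 : (0:ℝ) < n + 1 := by positivity
      have hl0 : 0 ≤ lam := by positivity
      have hl : lam * (n + 1) = 1 := by rw [hlam]; field_simp
      push_cast at h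
      have r1 := hloc c v H t z (z + lam • (y - z)) (by
        rw [add_sub_cancel_left, norm_smul, Real.norm_eq_abs, abs_of_nonneg hl0, ← hl]
        exact mul_le_mul_of_nonneg_left h hl0)
      have r2 := ih (t + T) (z + lam • (y - z)) y (by
        have e : y - (z + lam • (y - z)) = (1 - lam) • (y - z) := by rw [sub_smul, one_smul]; abel
        have hl1 : 0 ≤ 1 - lam := by nlinarith
        rw [e, norm_smul, Real.norm_eq_abs, abs_of_nonneg hl1]
        have := mul_le_mul_of_nonneg_left h hl1
        nlinarith)
      have := reach_trans r1 r2
      rwa [show t + ((n + 1 : ℕ) : ℝ) * T = t + T + n * T by push_cast; ring]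
  set D := ‖y - x‖ with hD
  have hD0 : 0 ≤ D := norm_nonneg _
  have hr2 : T * (2 + 2 * K * T) * (1 + D) ≤ r :=
    (mul_le_mul_of_nonneg_right (le_max_right _ _) (by linarith)).trans hr
  have hKT : 0 ≤ K * T := by positivity
  have hr0 : 0 ≤ r := le_trans (by positivity) hr2
  set n := ⌊r / T⌋₊ with hn
  have h1 : (n:ℝ) * T ≤ r := by rw [← le_div_iff₀ hT]; exact Nat.floor_le (by positivity)
  have h2 : r / T < n + 1 := Nat.lt_floor_add_one _
  have h2' : r < (n + 1) * T := by rwa [div_lt_iff₀ hT] at h2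
  obtain ⟨z, hz⟩ := extend_reach hc H t x (r - n * T) (by linarith)
  have hzd := reach_dist H.cK H.vK hz
  have hzd' : ‖z - x‖ ≤ 2 * K * T := hzd.trans (mul_le_mul_of_nonneg_left (by linarith) (by positivity))
  have h3 : (2 + 2 * K * T) * (1 + D) ≤ r / T := by
    rw [le_div_iff₀ hT]; linarith
  have r2 := chain n (t + (r - n * T)) z y (by
    have := norm_sub_le_norm_sub_add_norm_sub y x z
    rw [norm_sub_rev x z] at this
    nlinarith)
  rw [show t + r = t + (r - n * T) + n * T by ring]
  exact reach_trans hz r2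

section tt
variable {d : ℕ} {K T0 : ℝ} {c : ℝ → Euc d → ℝ} {v : ℝ → Euc d → Euc d}

lemma tt_nonneg (c : ℝ → Euc d → ℝ) (v : ℝ → Euc d → Euc d) (t : ℝ) (x y : Euc d) : 0 ≤ travelTime c v t x y :=
  Real.sInf_nonneg fun _ h => h.1

lemma tt_le {t r : ℝ} {x y : Euc d} (h : Reachable c v t x (t + r) y) : travelTime c v t x y ≤ r :=
  csInf_le ⟨0, fun _ h => h.1⟩ ⟨by linarith [h.1], h⟩

lemma tt_ub (C : Ctl K T0 c v) (t : ℝ) (x y : Euc d) : travelTime c v t x y ≤ T0 * (1 + ‖y - x‖) :=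
  tt_le (C.ctl t x y _ le_rfl)

lemma tt_exists (C : Ctl K T0 c v) (t : ℝ) (x y : Euc d) {r : ℝ} (hr : travelTime c v t x y < r) :
    ∃ s, 0 ≤ s ∧ s < r ∧ travelTime c v t x y ≤ s ∧ Reachable c v t x (t + s) y := by
  have h1 := C.ctl t x y _ le_rfl
  have hne : {s | 0 ≤ s ∧ y ∈ reachSet c v s t x}.Nonempty := ⟨_, by linarith [h1.1], h1⟩
  obtain ⟨s, hs, hsr⟩ := exists_lt_of_csInf_lt hne hr
  exact ⟨s, hs.1, hsr, tt_le hs.2, hs.2⟩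

lemma tt_lb (C : Ctl K T0 c v) (hK : 0 < K) (t : ℝ) (x y : Euc d) : ‖y - x‖ ≤ 2 * K * travelTime c v t x y := by
  refine le_of_forall_pos_le_add fun ε hε => ?_
  obtain ⟨s, -, h2, -, h4⟩ := tt_exists C t x y (r := travelTime c v t x y + ε / (2 * K))
    (by linarith [show 0 < ε / (2 * K) by positivity])
  have h5 := C.dst _ _ _ _ h4
  have h6 : 2 * K * (t + s - t) ≤ 2 * K * (travelTime c v t x y + ε / (2 * K)) :=
    mul_le_mul_of_nonneg_left (by linarith) (by positivity)
  rw [mul_add, mul_div_cancel₀ _ (by positivity)] at h6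
  linarith

lemma tt_after (C : Ctl K T0 c v) {t t1 : ℝ} {x x1 : Euc d} (z : Euc d) (h : Reachable c v t x t1 x1) :
    travelTime c v t x z ≤ (t1 - t) + travelTime c v t1 x1 z := by
  refine le_of_forall_pos_le_add fun ε hε => ?_
  obtain ⟨s, -, h2, -, h4⟩ := tt_exists C t1 x1 z (lt_add_of_pos_right _ hε)
  have := tt_le (t := t) (r := t1 - t + s) (by
    rw [show t + (t1 - t + s) = t1 + s by ring]; exact reach_trans h h4)
  linarith

lemma tt_target (C : Ctl K T0 c v) (t : ℝ) (x z z1 : Euc d) :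
    travelTime c v t x z1 ≤ travelTime c v t x z + T0 * (1 + ‖z1 - z‖) := by
  refine le_of_forall_pos_le_add fun ε hε => ?_
  obtain ⟨s, -, h2, -, h4⟩ := tt_exists C t x z (lt_add_of_pos_right _ hε)
  have := tt_le (reach_trans h4 (C.ctl (t + s) z z1 _ le_rfl) |> fun h => by rwa [add_assoc] at h)
  linarith

lemma tt_reach (C : Ctl K T0 c v) {t σ : ℝ} {x y : Euc d} (h : travelTime c v t x y + T0 < σ) :
    Reachable c v t x (t + σ) y := by
  obtain ⟨s, -, h2, -, h4⟩ := tt_exists C t x y (r := σ - T0) (by linarith)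
  have := reach_trans h4 (C.ctl (t + s) y y (σ - s) (by simp; linarith))
  rwa [show t + s + (σ - s) = t + σ by ring] at this

lemma tt_shift (c : ℝ → Euc d → ℝ) (v : ℝ → Euc d → Euc d) (s : ℝ) (p : Euc d) (t : ℝ) (x y : Euc d) :
    travelTime (fun t x => c (t + s) (x + p)) (fun t x => v (t + s) (x + p)) t x y =
    travelTime c v (t + s) (x + p) (y + p) := by
  unfold travelTime reachSet
  congr 1
  ext r
  simp only [Set.mem_ofPred_eq]
  rw [reach_shift_iff, add_right_comm t r s]

end tt

lemma lip_deriv_ii {d : ℕ} {C : NNReal} {γ : ℝ → Euc d} (h : LipschitzWith C γ) (a b : ℝ) :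
    IntervalIntegrable (deriv γ) volume a b := by
  have : IntervalIntegrable (fun _ : ℝ => (C : ℝ)) volume a b := intervalIntegrable_const
  refine this.mono_fun (stronglyMeasurable_deriv γ).aestronglyMeasurable (Eventually.of_forall fun s => ?_)
  rw [Real.norm_eq_abs, abs_of_nonneg C.coe_nonneg]
  exact norm_deriv_le_of_lipschitz h

lemma lip_ftc {d : ℕ} {C : NNReal} {γ : ℝ → Euc d} (h : LipschitzWith C γ) (a b : ℝ) :
    ∫ s in a..b, deriv γ s = γ b - γ a := by
  have hii := lip_deriv_ii h a b
  ext i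
  have h1 := (EuclideanSpace.proj (𝕜 := ℝ) i).intervalIntegral_comp_comm hii
  have h2 : (∫ s in a..b, deriv γ s) i = ∫ s in a..b, (deriv γ s) i := h1.symm
  rw [h2]
  have hl : LipschitzWith (‖(EuclideanSpace.proj (𝕜 := ℝ) i : Euc d →L[ℝ] ℝ)‖₊ * C) (fun s => γ s i) :=
    (EuclideanSpace.proj (𝕜 := ℝ) i : Euc d →L[ℝ] ℝ).lipschitz.comp h
  have h3 := (hl.lipschitzOnWith (s := Set.uIcc a b)).absolutelyContinuousOnInterval.integral_deriv_eq_sub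
  rw [PiLp.sub_apply, ← h3]
  refine intervalIntegral.integral_congr_ae ?_
  filter_upwards [h.ae_differentiableAt_real] with s hs _
  exact (((EuclideanSpace.proj (𝕜 := ℝ) i : Euc d →L[ℝ] ℝ).hasFDerivAt.comp_hasDerivAt s hs.hasDerivAt).deriv).symm

/-- scale on which pair constraints hold -/
noncomputable def rhoG (K Lc : ℝ) (δ : ℝ → ℝ) (e : ℝ) : ℝ := min (δ (e / 4)) (e / 2 / (4 * Lc * K + 1))

lemma rhoG_pos {K Lc : ℝ} {δ : ℝ → ℝ} (hK : 0 ≤ K) (hL : 0 ≤ Lc) (hδ : ∀ ε, 0 < ε → 0 < δ ε) {e : ℝ} (he : 0 < e) :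
    0 < rhoG K Lc δ e := lt_min (hδ _ (by positivity)) (by positivity)

/-- path data of a reachable pair -/
lemma path_pair {d : ℕ} {K Lc : ℝ} {δ : ℝ → ℝ} {c : ℝ → Euc d → ℝ} {v : ℝ → Euc d → Euc d}
    (hK : 0 ≤ K) (hL : 0 ≤ Lc) (H : GReg K Lc δ c v) {t0 t1 : ℝ} {x0 x1 : Euc d} (h : Reachable c v t0 x0 t1 x1) :
    ∃ γ : ℝ → Euc d, γ t0 = x0 ∧ γ t1 = x1 ∧ ∀ s s', t0 ≤ s → s ≤ s' → s' ≤ t1 →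
      ‖γ s' - γ s‖ ≤ 2 * K * (s' - s) ∧ ∀ e, 0 < e → s' - s ≤ rhoG K Lc δ e →
        ‖γ s' - γ s - (s' - s) • v s (γ s)‖ ≤ (s' - s) * (c s (γ s) + e) := by
  obtain ⟨h01, γ, g, i, p, e, a⟩ := h
  rw [ae_restrict_iff' measurableSet_Icc] at a
  have hii : ∀ s s', t0 ≤ s → s ≤ s' → s' ≤ t1 → IntervalIntegrable g volume s s' := by
    intro s s' h1 h2 h3
    refine i.mono_set ?_
    rw [Set.uIcc_of_le h2, Set.uIcc_of_le h01]
    exact Set.Icc_subset_Icc h1 h3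
  have hdiff : ∀ s s', t0 ≤ s → s ≤ s' → s' ≤ t1 → γ s' - γ s = ∫ u in s..s', g u := by
    intro s s' h1 h2 h3
    rw [p s' ⟨by linarith, h3⟩, p s ⟨h1, by linarith⟩, add_sub_add_left_eq_sub,
      intervalIntegral.integral_interval_sub_left (hii _ _ le_rfl (by linarith) h3) (hii _ _ le_rfl h1 (by linarith))]
  have hlip : ∀ s s', t0 ≤ s → s ≤ s' → s' ≤ t1 → ‖γ s' - γ s‖ ≤ 2 * K * (s' - s) := by
    intro s s' h1 h2 h3
    rw [hdiff s s' h1 h2 h3]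
    have := intervalIntegral.norm_integral_le_of_norm_le_const_ae (a := s) (b := s') (f := g)
      (C := 2 * K) ?_
    · rwa [abs_of_nonneg (by linarith)] at this
    · filter_upwards [a] with u hu hm
      rw [Set.uIoc_of_le h2] at hm
      have k1 := hu ⟨by linarith [hm.1], by linarith [hm.2]⟩
      have k2 := H.cK u (γ u)
      have k3 := H.vK u (γ u)
      have := norm_add_le (g u - v u (γ u)) (v u (γ u))
      rw [sub_add_cancel] at this
      linarith
  refine ⟨γ, ?_, e, fun s s' h1 h2 h3 => ⟨hlip s s' h1 h2 h3, fun e he hρ => ?_⟩⟩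
  · rw [p t0 ⟨le_rfl, h01⟩]; simp
  have hc : (s' - s) • v s (γ s) = ∫ u in s..s', v s (γ s) := by simp
  rw [hdiff s s' h1 h2 h3, hc, ← intervalIntegral.integral_sub (hii s s' h1 h2 h3) intervalIntegrable_const]
  have := intervalIntegral.norm_integral_le_of_norm_le_const_ae (a := s) (b := s') (f := fun u => g u - v s (γ s))
      (C := c s (γ s) + e) ?_
  · rwa [abs_of_nonneg (by linarith), mul_comm] at this
  · filter_upwards [a] with u hu hm
    rw [Set.uIoc_of_le h2] at hm
    have k1 := hu ⟨by linarith [hm.1], by linarith [hm.2]⟩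
    have hus : u - s ≤ rhoG K Lc δ e := by linarith [hm.2]
    have k2 := H.md (e / 4) (by positivity) u s (by
      rw [abs_of_pos (by linarith [hm.1])]; exact hus.trans (min_le_left _ _)) (γ u)
    have k3 := H.lip s (γ u) (γ s)
    have k4 := hlip s u h1 hm.1.le (by linarith [hm.2])
    have k5 : Lc * ‖γ u - γ s‖ ≤ e / 4 := by
      have q1 := mul_le_mul_of_nonneg_left k4 hL
      have q2 := hus.trans (min_le_right _ _)
      rw [le_div_iff₀ (by positivity)] at q2
      nlinarith [hm.1]
    have k6 := (abs_le.1 k2.1).2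
    have k7 := (abs_le.1 k3.1).2
    have e1 : g u - v s (γ s) = (g u - v u (γ u)) + (v u (γ u) - v s (γ u)) + (v s (γ u) - v s (γ s)) := by abel
    rw [e1]
    have k8 := norm_add_le ((g u - v u (γ u)) + (v u (γ u) - v s (γ u))) (v s (γ u) - v s (γ s))
    have k9 := norm_add_le (g u - v u (γ u)) (v u (γ u) - v s (γ u))
    linarith [k2.2, k3.2]

lemma reach_of_pair {d : ℕ} {C : NNReal} {c : ℝ → Euc d → ℝ} {v : ℝ → Euc d → Euc d} {ρ : ℝ → ℝ}
    (hρ : ∀ e, 0 < e → 0 < ρ e) {t0 t1 : ℝ} (h01 : t0 ≤ t1) {γ : ℝ → Euc d} (hl : LipschitzWith C γ)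
    (hp : ∀ s s', t0 ≤ s → s < s' → s' ≤ t1 → ∀ n : ℕ, s' - s < ρ (1 / ((n:ℝ) + 1)) →
        ‖γ s' - γ s - (s' - s) • v s (γ s)‖ ≤ (s' - s) * (c s (γ s) + 1 / ((n:ℝ) + 1))) :
    Reachable c v t0 (γ t0) t1 (γ t1) := by
  refine ⟨h01, γ, deriv γ, lip_deriv_ii hl _ _, fun t _ => by rw [lip_ftc hl]; abel, rfl, ?_⟩
  have h1 : ∀ᵐ s : ℝ, s ≠ t1 := by
    rw [ae_iff]; simp
  rw [ae_restrict_iff' measurableSet_Icc]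
  filter_upwards [hl.ae_differentiableAt_real, h1] with s hs hst hm
  have hlt : s < t1 := lt_of_le_of_ne hm.2 hst
  have hlim : ∀ n : ℕ, ‖deriv γ s - v s (γ s)‖ ≤ c s (γ s) + 1 / ((n:ℝ) + 1) := by
    intro n
    have ht : Tendsto (fun s' => ‖slope γ s s' - v s (γ s)‖) (nhdsWithin s (Set.Ioi s)) (nhds ‖deriv γ s - v s (γ s)‖) := by
      have := (hasDerivAt_iff_tendsto_slope.1 hs.hasDerivAt).mono_left
        (nhdsWithin_mono s (fun x (hx : x ∈ Set.Ioi s) => ne_of_gt hx))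
      exact (this.sub_const _).norm
    have hpos : 0 < ρ (1 / ((n:ℝ) + 1)) := hρ _ (by positivity)
    refine le_of_tendsto ht ?_
    have hev : Set.Ioo s (min t1 (s + ρ (1 / ((n:ℝ) + 1)))) ∈ nhdsWithin s (Set.Ioi s) :=
      Ioo_mem_nhdsGT (lt_min hlt (by linarith))
    filter_upwards [hev] with s' hs'
    have a1 : s' ≤ t1 := hs'.2.le.trans (min_le_left _ _)
    have a2 : s' < s + ρ (1 / ((n:ℝ) + 1)) := hs'.2.trans_le (min_le_right _ _)
    have hp1 := hp s s' hm.1 hs'.1 a1 n (by linarith)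
    have hd : 0 < s' - s := by linarith [hs'.1]
    have e1 : slope γ s s' - v s (γ s) = (s' - s)⁻¹ • (γ s' - γ s - (s' - s) • v s (γ s)) := by
      rw [slope_def_module, smul_sub _ (γ s' - γ s), smul_smul, inv_mul_cancel₀ hd.ne', one_smul]
    rw [e1, norm_smul, norm_inv, Real.norm_eq_abs, abs_of_pos hd, inv_mul_le_iff₀ hd]
    exact hp1
  have ht2 : Tendsto (fun n : ℕ => c s (γ s) + 1 / ((n:ℝ) + 1)) atTop (nhds (c s (γ s) + 0)) :=
    tendsto_one_div_add_atTop_nhds_zero_nat.const_add _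
  rw [add_zero] at ht2
  exact ge_of_tendsto' ht2 hlim

lemma GReg.tend {d : ℕ} {K Lc : ℝ} {δ : ℝ → ℝ} {c : ℝ → Euc d → ℝ} {v : ℝ → Euc d → Euc d} 
    (H : GReg K Lc δ c v) {ι : Type*} {l : Filter ι} {a : ι → ℝ} {p : ι → Euc d} {a0 : ℝ} {p0 : Euc d}
    (ha : Tendsto a l (nhds a0)) (hp : Tendsto p l (nhds p0)) :
    Tendsto (fun i => c (a i) (p i)) l (nhds (c a0 p0)) ∧ Tendsto (fun i => v (a i) (p i)) l (nhds (v a0 p0)) := by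
  have h1 : Tendsto (fun i => Lc * ‖p i - p0‖) l (nhds 0) := by
    have := ((hp.sub_const p0).norm).const_mul Lc
    simpa using this
  have key : ∀ ε, 0 < ε → ∀ᶠ i in l, |a i - a0| ≤ δ (ε / 2) ∧ Lc * ‖p i - p0‖ < ε / 2 := by
    intro ε hε
    have h2 := (Metric.tendsto_nhds.1 ha) (δ (ε / 2)) (H.δpos _ (by positivity))
    filter_upwards [h2, h1.eventually (gt_mem_nhds (show (0:ℝ) < ε / 2 by positivity))] with i hi hj
    exact ⟨by rw [← Real.dist_eq]; exact hi.le, hj⟩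
  constructor
  · rw [Metric.tendsto_nhds]
    intro ε hε
    filter_upwards [key ε hε] with i hi
    have q1 := (H.md (ε / 2) (by positivity) (a i) a0 hi.1 (p i)).1
    have q2 := (H.lip a0 (p i) p0).1
    rw [Real.dist_eq]
    have := abs_sub_le (c (a i) (p i)) (c a0 (p i)) (c a0 p0)
    linarith [hi.2]
  · rw [Metric.tendsto_nhds]
    intro ε hε
    filter_upwards [key ε hε] with i hi
    have q1 := (H.md (ε / 2) (by positivity) (a i) a0 hi.1 (p i)).2
    have q2 := (H.lip a0 (p i) p0).2
    rw [dist_eq_norm]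
    have := norm_sub_le_norm_sub_add_norm_sub (v (a i) (p i)) (v a0 (p i)) (v a0 p0)
    linarith [hi.2]

/-- discrete approximate chains -/
def chainEv {d : ℕ} (K : ℝ) (ρ : ℝ → ℝ) (t r B : ℝ) (x y : Euc d) (c : ℝ → Euc d → ℝ) (v : ℝ → Euc d → Euc d)
    (N k : ℕ) (z : ℕ → Euc d) : Prop :=
  (k ≤ N + 1 ∧ ‖z 0 - x‖ ≤ 1 / ((N:ℝ) + 1) ∧ ‖z k - y‖ ≤ B * (1 / ((N:ℝ) + 1))) ∧
  ∀ i j : ℕ, i ≤ j → j ≤ k →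
    ‖z j - z i‖ ≤ 2 * K * (j * (r / (N + 1)) - i * (r / (N + 1))) + 1 / ((N:ℝ) + 1) ∧
    ∀ m : ℕ, j * (r / (N + 1)) - i * (r / (N + 1)) ≤ ρ (1 / ((m:ℝ) + 1)) →
      ‖z j - z i - ((j:ℝ) * (r / (N + 1)) - i * (r / (N + 1))) • v (t + i * (r / (N + 1))) (z i)‖ ≤
      (j * (r / (N + 1)) - i * (r / (N + 1))) * (c (t + i * (r / (N + 1))) (z i) + 1 / ((m:ℝ) + 1)) +
        1 / ((N:ℝ) + 1)

lemma chain_forward {d : ℕ} {K Lc T0 : ℝ} {δ : ℝ → ℝ} {c : ℝ → Euc d → ℝ} {v : ℝ → Euc d → Euc d}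
    (hK : 0 ≤ K) (hL : 0 ≤ Lc) (H : GReg K Lc δ c v) (C : Ctl K T0 c v) {t r : ℝ} (hr : 0 < r) {x y : Euc d}
    (h : travelTime c v t x y ≤ r) (N : ℕ) :
    ∃ (k : ℕ) (f : Fin (N + 2) → ℕ), chainEv K (rhoG K Lc δ) t r (2 * K * (r + 1) + 1) x y c v N k
      (fun i => TopologicalSpace.denseSeq (Euc d) (f (Fin.ofNat (N + 2) i))) := by
  set D := TopologicalSpace.denseSeq (Euc d) with hD
  set η : ℝ := 1 / ((N:ℝ) + 1) with hη
  have hn : (0:ℝ) < N + 1 := by positivity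
  have hηp : 0 < η := by positivity
  obtain ⟨s, hs0, hsr, -, hreach⟩ := tt_exists C t x y (r := r + η) (by linarith)
  obtain ⟨γ, g0, g1, hγ⟩ := path_pair hK hL H hreach
  set q := r / ((N:ℝ) + 1) with hq
  have hqp : 0 < q := by positivity
  set k := ⌊min s r / q⌋₊ with hk
  have hm0 : 0 ≤ min s r := le_min hs0 hr.le
  have hk1 : k * q ≤ min s r := by rw [← le_div_iff₀ hqp]; exact Nat.floor_le (by positivity)
  have hk2 : min s r < (k + 1) * q := by rw [← div_lt_iff₀ hqp]; exact Nat.lt_floor_add_one _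
  have hkr : k * q ≤ r := hk1.trans (min_le_right _ _)
  have hks : k * q ≤ s := hk1.trans (min_le_left _ _)
  have hqn : ((N:ℝ) + 1) * q = r := by rw [hq]; field_simp
  have hkN : k ≤ N + 1 := by
    have : (k : ℝ) ≤ N + 1 := by
      rw [← hqn] at hkr
      exact le_of_mul_le_mul_right hkr hqp
    exact_mod_cast this
  set η' := η / (2 + 2 * r * Lc) with hη'
  have hden : 0 < 2 + 2 * r * Lc := by positivity
  have hη'p : 0 < η' := by positivity
  have hη'e : η' * (2 + 2 * r * Lc) = η := by rw [hη']; field_simp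
  have hrL : 0 ≤ η' * (r * Lc) := by positivity
  have hF : ∀ p : Euc d, ∃ a : ℕ, ‖D a - p‖ ≤ η' := by
    intro p
    obtain ⟨_, ha, ⟨a, rfl⟩⟩ := Metric.dense_iff.1 (TopologicalSpace.denseRange_denseSeq (Euc d)) p η' hη'p
    exact ⟨a, by rw [← dist_eq_norm]; exact (mem_ball.1 ha).le⟩
  choose F hF using hF
  have hz : ∀ i, i ≤ k → ((Fin.ofNat (N + 2) i : Fin (N + 2)) : ℕ) = i := by
    intro i hi
    rw [Fin.val_ofNat]; exact Nat.mod_eq_of_lt (by omega)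
  refine ⟨k, fun a => F (γ (t + (a : ℕ) * q)), ⟨hkN, ?_, ?_⟩, ?_⟩
  · simp only [hz 0 (Nat.zero_le _)]
    have := hF (γ (t + ((0:ℕ):ℝ) * q))
    simp only [Nat.cast_zero, zero_mul, add_zero, g0] at this ⊢
    nlinarith
  · simp only [hz k le_rfl]
    have e1 := hF (γ (t + k * q))
    have e2 := (hγ (t + k * q) (t + s) (by simp; positivity) (by linarith) le_rfl).1
    rw [g1, norm_sub_rev] at e2
    have e3 := norm_sub_le_norm_sub_add_norm_sub (D (F (γ (t + k * q)))) (γ (t + k * q)) y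
    have e4 : s ≤ min s r + η := by
      rcases le_total s r with h | h
      · rw [min_eq_left h]; linarith
      · rw [min_eq_right h]; linarith
    have e5 : q = r * η := by rw [hq, hη]; ring
    have e6 : t + s - (t + k * q) ≤ (r + 1) * η := by
      rw [add_mul, one_mul, ← e5]; linarith
    have e7 : 2 * K * (t + s - (t + k * q)) ≤ 2 * K * ((r + 1) * η) := mul_le_mul_of_nonneg_left e6 (by positivity)
    have e8 : η' ≤ η := by nlinarith
    linarith
  · intro i j hij hjk
    simp only [hz i (hij.trans hjk), hz j hjk]
    have ci : (i : ℝ) * q ≤ j * q := mul_le_mul_of_nonneg_right (by exact_mod_cast hij) hqp.le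
    have cj : (j : ℝ) * q ≤ k * q := mul_le_mul_of_nonneg_right (by exact_mod_cast hjk) hqp.le
    have c0 : 0 ≤ (i : ℝ) * q := by positivity
    obtain ⟨p1, p2⟩ := hγ (t + i * q) (t + j * q) (by linarith) (by linarith) (by linarith)
    rw [add_sub_add_left_eq_sub] at p1 p2
    set a := γ (t + i * q)
    set b := γ (t + j * q)
    have fa := hF a
    have fb := hF b
    set h := (j:ℝ) * q - i * q with hh
    have hh0 : 0 ≤ h := by linarith
    have hhr : h ≤ r := by linarith
    constructor
    · have e : D (F b) - D (F a) = (D (F b) - b) + (b - a) + (a - D (F a)) := by abel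
      rw [e]
      have n1 := norm_add_le ((D (F b) - b) + (b - a)) (a - D (F a))
      have n2 := norm_add_le (D (F b) - b) (b - a)
      rw [norm_sub_rev a] at n1
      nlinarith
    · intro m hm
      have p3 := p2 _ (by positivity) hm
      obtain ⟨l1, l2⟩ := H.lip (t + i * q) a (D (F a))
      rw [norm_sub_rev a] at l1 l2
      have l1' := (abs_le.1 l1).2
      have l3 : Lc * ‖D (F a) - a‖ ≤ Lc * η' := mul_le_mul_of_nonneg_left fa hL
      have e : D (F b) - D (F a) - h • v (t + i * q) (D (F a)) = (D (F b) - b) + (a - D (F a)) +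
          (b - a - h • v (t + i * q) a) + h • (v (t + i * q) a - v (t + i * q) (D (F a))) := by
        rw [smul_sub]; abel
      rw [e]
      have n1 := norm_add_le ((D (F b) - b) + (a - D (F a)) + (b - a - h • v (t + i * q) a))
        (h • (v (t + i * q) a - v (t + i * q) (D (F a))))
      have n2 := norm_add_le ((D (F b) - b) + (a - D (F a))) (b - a - h • v (t + i * q) a)
      have n3 := norm_add_le (D (F b) - b) (a - D (F a))
      rw [norm_sub_rev a] at n3
      rw [norm_smul h, Real.norm_eq_abs, abs_of_nonneg hh0] at n1
      have m1 : h * ‖v (t + i * q) a - v (t + i * q) (D (F a))‖ ≤ h * (Lc * η') :=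
        mul_le_mul_of_nonneg_left (l2.trans l3) hh0
      have m2 : h * c (t + i * q) a ≤ h * (c (t + i * q) (D (F a)) + Lc * η') :=
        mul_le_mul_of_nonneg_left (by linarith) hh0
      have m3 : h * (Lc * η') ≤ r * (Lc * η') := mul_le_mul_of_nonneg_right hhr (by positivity)
      linarith

lemma ulim {E : Type*} [NormedAddCommGroup E] [ProperSpace E] (f : ℕ → E) (B : ℝ) (h : ∀ n, ‖f n‖ ≤ B) :
    ∃ l, Tendsto f (hyperfilter ℕ : Filter ℕ) (nhds l) := by
  obtain ⟨l, -, hl⟩ := (isCompact_closedBall (0:E) B).ultrafilter_le_nhds ((hyperfilter ℕ).map f) (by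
    rw [le_principal_iff]
    exact Filter.mem_map.2 (Filter.univ_mem' fun n => by simpa using h n))
  exact ⟨l, hl⟩

lemma chain_backward {d : ℕ} {K Lc B : ℝ} {δ : ℝ → ℝ} {c : ℝ → Euc d → ℝ} {v : ℝ → Euc d → Euc d}
    (hK : 0 ≤ K) (hL : 0 ≤ Lc) (H : GReg K Lc δ c v) {t r : ℝ} (hr : 0 < r) {x y : Euc d}
    (k : ℕ → ℕ) (z : ℕ → ℕ → Euc d) (h : ∀ N, chainEv K (rhoG K Lc δ) t r B x y c v N (k N) (z N)) :
    travelTime c v t x y ≤ r := by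
  set U : Filter ℕ := (hyperfilter ℕ : Filter ℕ) with hU
  have hUle : U ≤ atTop := Nat.hyperfilter_le_atTop
  have hη : Tendsto (fun N : ℕ => 1 / ((N:ℝ) + 1)) U (nhds 0) :=
    tendsto_one_div_add_atTop_nhds_zero_nat.mono_left hUle
  have hq : Tendsto (fun N : ℕ => r / ((N:ℝ) + 1)) U (nhds 0) := by
    have := hη.const_mul r
    simpa only [mul_one_div, mul_zero] using this
  have hqp : ∀ N : ℕ, 0 < r / ((N:ℝ) + 1) := fun N => by positivity
  have hkr : ∀ N, (k N : ℝ) * (r / (N + 1)) ≤ r := by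
    intro N
    have h1 : (k N : ℝ) ≤ N + 1 := by exact_mod_cast (h N).1.1
    calc (k N : ℝ) * (r / (N + 1)) ≤ (N + 1) * (r / (N + 1)) := mul_le_mul_of_nonneg_right h1 (hqp N).le
      _ = r := by field_simp
  obtain ⟨S, hS⟩ := ulim (fun N => (k N : ℝ) * (r / (N + 1))) r (fun N => by
    rw [Real.norm_eq_abs, abs_of_nonneg (mul_nonneg (Nat.cast_nonneg _) (hqp N).le)]; exact hkr N)
  have hS0 : 0 ≤ S := ge_of_tendsto' hS fun N => mul_nonneg (Nat.cast_nonneg _) (hqp N).le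
  have hSr : S ≤ r := le_of_tendsto' hS hkr
  set idx : ℕ → ℝ → ℕ := fun N u => min ⌊u / (r / ((N:ℝ) + 1))⌋₊ (k N) with hidx
  have hidk : ∀ N u, idx N u ≤ k N := fun N u => min_le_right _ _
  set cl : ℝ → ℝ := fun u => min (max u 0) S with hcl
  have hθ : ∀ u, Tendsto (fun N => (idx N u : ℝ) * (r / (N + 1))) U (nhds (cl u)) := by
    intro u
    have e : ∀ N, (idx N u : ℝ) * (r / (N + 1)) =
        min ((⌊u / (r / ((N:ℝ) + 1))⌋₊ : ℝ) * (r / (N + 1))) ((k N : ℝ) * (r / (N + 1))) := by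
      intro N
      rw [hidx]; push_cast
      exact min_mul_of_nonneg _ _ (hqp N).le
    simp_rw [e]
    refine Tendsto.min ?_ hS
    have hlow : Tendsto (fun N : ℕ => max u 0 - r / ((N:ℝ) + 1)) U (nhds (max u 0)) := by
      have := hq.const_sub (max u 0)
      simpa using this
    refine tendsto_of_tendsto_of_tendsto_of_le_of_le hlow tendsto_const_nhds (fun N => ?_) (fun N => ?_)
    · have h1 : u / (r / ((N:ℝ) + 1)) < (⌊u / (r / ((N:ℝ) + 1))⌋₊ : ℝ) + 1 := Nat.lt_floor_add_one _
      rw [div_lt_iff₀ (hqp N)] at h1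
      have h2 : (0:ℝ) ≤ (⌊u / (r / ((N:ℝ) + 1))⌋₊ : ℝ) * (r / (N + 1)) := mul_nonneg (Nat.cast_nonneg _) (hqp N).le
      have h3 := hqp N
      show max u 0 - r / ((N:ℝ) + 1) ≤ _
      rcases max_choice u 0 with h | h <;> rw [h] <;> linarith
    · show (⌊u / (r / ((N:ℝ) + 1))⌋₊ : ℝ) * (r / (N + 1)) ≤ _
      rcases le_total 0 u with hu | hu
      · rw [max_eq_left hu, ← le_div_iff₀ (hqp N)]
        exact Nat.floor_le (div_nonneg hu (hqp N).le)
      · rw [max_eq_right hu, Nat.floor_of_nonpos (div_nonpos_of_nonpos_of_nonneg hu (hqp N).le)]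
        simp
  have hmono : ∀ N u u', u ≤ u' → idx N u ≤ idx N u' := by
    intro N u u' huu
    exact min_le_min_right _ (Nat.floor_le_floor (div_le_div_of_nonneg_right huu (hqp N).le))
  have hbd : ∀ N i, i ≤ k N → ‖z N i‖ ≤ 2 * K * r + 2 + ‖x‖ := by
    intro N i hi
    have h1 := ((h N).2 0 i (Nat.zero_le _) hi).1
    have h2 := (h N).1.2.1
    have h3 : 1 / ((N:ℝ) + 1) ≤ 1 := by
      rw [div_le_one (by positivity)]; linarith [Nat.cast_nonneg (α := ℝ) N]
    have h4 : (i:ℝ) * (r / (N + 1)) ≤ r :=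
      (mul_le_mul_of_nonneg_right (by exact_mod_cast hi) (hqp N).le).trans (hkr N)
    have h5 : 2 * K * (i * (r / (N + 1)) - (0:ℕ) * (r / (N + 1))) ≤ 2 * K * r :=
      mul_le_mul_of_nonneg_left (by simpa using h4) (by positivity)
    have e : z N i = (z N i - z N 0) + (z N 0 - x) + x := by abel
    rw [e]
    have n1 := norm_add_le ((z N i - z N 0) + (z N 0 - x)) x
    have n2 := norm_add_le (z N i - z N 0) (z N 0 - x)
    linarith
  choose γ hγ using fun u => ulim (fun N => z N (idx N u)) _ (fun N => hbd N _ (hidk N u))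
  -- pairwise Lipschitz bound
  have hlip : ∀ u u', u ≤ u' → ‖γ u' - γ u‖ ≤ 2 * K * (cl u' - cl u) := by
    intro u u' huu
    have h1 := (((hθ u').sub (hθ u)).const_mul (2 * K)).add hη
    rw [add_zero] at h1
    exact le_of_tendsto_of_tendsto' ((hγ u').sub (hγ u)).norm h1
      (fun N => ((h N).2 _ _ (hmono N u u' huu) (hidk N u')).1)
  have hcl1 : ∀ u u', u ≤ u' → cl u' - cl u ≤ u' - u := by
    intro u u' huu
    simp only [hcl]
    rcases max_choice u 0 with e1 | e1 <;> rcases max_choice u' 0 with e2 | e2 <;>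
      rcases min_choice (max u 0) S with e3 | e3 <;> rcases min_choice (max u' 0) S with e4 | e4 <;>
      rw [e3, e4] <;>
      linarith [le_max_left u 0, le_max_right u 0, le_max_left u' 0, le_max_right u' 0, min_le_left (max u 0) S,
        min_le_right (max u 0) S, min_le_left (max u' 0) S, min_le_right (max u' 0) S]
  have hlip2 : ∀ u u', ‖γ u' - γ u‖ ≤ 2 * K * |u' - u| := by
    intro u u'
    rcases le_total u u' with h1 | h1
    · rw [abs_of_nonneg (by linarith)]
      exact (hlip u u' h1).trans (mul_le_mul_of_nonneg_left (hcl1 u u' h1) (by positivity))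
    · rw [abs_of_nonpos (by linarith), norm_sub_rev, neg_sub]
      exact (hlip u' u h1).trans (mul_le_mul_of_nonneg_left (hcl1 u' u h1) (by positivity))
  have hL2 : LipschitzWith (2 * K).toNNReal (fun s => γ (s - t)) := by
    refine LipschitzWith.of_dist_le_mul fun s s' => ?_
    rw [dist_eq_norm, Real.dist_eq, Real.coe_toNNReal _ (by positivity)]
    have := hlip2 (s' - t) (s - t)
    rwa [sub_sub_sub_cancel_right] at this
  have hx : γ 0 = x := by
    refine tendsto_nhds_unique (hγ 0) ?_
    rw [tendsto_iff_norm_sub_tendsto_zero]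
    refine squeeze_zero (fun _ => norm_nonneg _) (fun N => ?_) hη
    have : idx N 0 = 0 := by simp [hidx]
    rw [this]
    exact (h N).1.2.1
  have hclS : ∀ u, 0 ≤ u → u ≤ S → cl u = u := by
    intro u h1 h2
    simp only [hcl]
    rw [max_eq_left h1, min_eq_left h2]
  have hy : γ S = y := by
    refine tendsto_nhds_unique (hγ S) ?_
    rw [tendsto_iff_norm_sub_tendsto_zero]
    have h1 := (((hS.sub (hθ S)).const_mul (2 * K)).add hη).add (hη.const_mul B)
    rw [hclS S hS0 le_rfl, sub_self, mul_zero, mul_zero, add_zero, add_zero] at h1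
    refine squeeze_zero (fun _ => norm_nonneg _) (fun N => ?_) h1
    have a1 := ((h N).2 _ _ (hidk N S) le_rfl).1
    have a2 := (h N).1.2.2
    have a3 := norm_sub_le_norm_sub_add_norm_sub (z N (idx N S)) (z N (k N)) y
    rw [norm_sub_rev (z N (idx N S)) (z N (k N))] at a3
    linarith
  have hreach := reach_of_pair (c := c) (v := v) (ρ := rhoG K Lc δ) (fun e he => rhoG_pos hK hL H.δpos he)
    (t0 := t) (t1 := t + S) (by linarith) hL2 (by
      intro s s' h1 h2 h3 n hn
      have e1 := hclS (s - t) (by linarith) (by linarith)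
      have e2 := hclS (s' - t) (by linarith) (by linarith)
      have hd := (hθ (s' - t)).sub (hθ (s - t))
      rw [e1, e2, sub_sub_sub_cancel_right] at hd
      have ht1 := (hθ (s - t)).const_add t
      rw [e1, add_sub_cancel] at ht1
      obtain ⟨cc, cv⟩ := H.tend ht1 (hγ (s - t))
      have hev := hd.eventually (gt_mem_nhds hn)
      have hlim := (hd.mul (cc.add_const (1 / ((n:ℝ) + 1)))).add hη
      rw [add_zero] at hlim
      refine le_of_tendsto_of_tendsto (((hγ (s' - t)).sub (hγ (s - t))).sub (hd.smul cv)).norm hlim ?_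
      filter_upwards [hev] with N hN
      exact ((h N).2 _ _ (hmono N _ _ (by linarith)) (hidk N _)).2 n hN.le)
  simp only [sub_self, add_sub_cancel_left, hx, hy] at hreach
  exact (tt_le hreach).trans hSr

lemma measP_imp {Ω : Type*} [MeasurableSpace Ω] {p : Prop} {q : Ω → Prop} (h : p → Measurable q) :
    Measurable (fun ω => p → q ω) := by
  by_cases hp : p
  · simpa [hp] using h hp
  · simp [hp]

lemma tt_meas_pos {d : ℕ} {Ω : Type*} [MeasurableSpace Ω] {K Lc T0 : ℝ} {δ : ℝ → ℝ} {c : ℝ → Euc d → Ω → ℝ}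
    {v : ℝ → Euc d → Ω → Euc d} (hK : 0 ≤ K) (hL : 0 ≤ Lc) 
    (H : ∀ ω, GReg K Lc δ (fun a b => c a b ω) (fun a b => v a b ω))
    (C : ∀ ω, Ctl K T0 (fun a b => c a b ω) (fun a b => v a b ω)) {t r : ℝ} (hr : 0 < r) (x y : Euc d)
    (hm : ∀ s, t ≤ s → s ≤ t + r → ∀ x, Measurable (c s x) ∧ Measurable (v s x)) :
    MeasurableSet {ω | travelTime (fun a b => c a b ω) (fun a b => v a b ω) t x y ≤ r} := by
  have e : {ω | travelTime (fun a b => c a b ω) (fun a b => v a b ω) t x y ≤ r} =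
      {ω | ∀ N : ℕ, ∃ (k : ℕ) (f : Fin (N + 2) → ℕ), chainEv K (rhoG K Lc δ) t r (2 * K * (r + 1) + 1) x y
        (fun a b => c a b ω) (fun a b => v a b ω) N k
        (fun i => TopologicalSpace.denseSeq (Euc d) (f (Fin.ofNat (N + 2) i)))} := by
    ext ω
    constructor
    · intro h N
      exact chain_forward hK hL (H ω) (C ω) hr h N
    · intro h
      choose k f hf using h
      exact chain_backward hK hL (H ω) hr k _ hf
  rw [e]
  refine measurableSet_setOfPred.2 (Measurable.forall fun N => Measurable.exists fun k => Measurable.exists fun f => ?_)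
  unfold chainEv
  by_cases h1 : (k ≤ N + 1 ∧ ‖TopologicalSpace.denseSeq (Euc d) (f (Fin.ofNat (N + 2) 0)) - x‖ ≤ 1 / ((N:ℝ) + 1) ∧
    ‖TopologicalSpace.denseSeq (Euc d) (f (Fin.ofNat (N + 2) k)) - y‖ ≤ (2 * K * (r + 1) + 1) * (1 / ((N:ℝ) + 1)))
  swap
  · simp only [h1, false_and]
    exact measurable_const
  refine (measurable_const (a := _)).and (Measurable.forall fun i => Measurable.forall fun j => measP_imp fun hij =>
    measP_imp fun hjk => (measurable_const).and (Measurable.forall fun m => measP_imp fun _ => ?_))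
  have hqp : 0 ≤ r / ((N:ℝ) + 1) := by positivity
  have h2 : (i:ℝ) * (r / (N + 1)) ≤ r := by
    have h1 : (i : ℝ) ≤ N + 1 := by exact_mod_cast (hij.trans hjk).trans h1.1
    calc (i : ℝ) * (r / (N + 1)) ≤ (N + 1) * (r / (N + 1)) := mul_le_mul_of_nonneg_right h1 hqp
      _ = r := by field_simp
  obtain ⟨m1, m2⟩ := hm (t + i * (r / (N + 1))) (by linarith [mul_nonneg (Nat.cast_nonneg (α := ℝ) i) hqp]) (by linarith)
    (TopologicalSpace.denseSeq (Euc d) (f (Fin.ofNat (N + 2) i)))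
  exact measurableSet_setOfPred.1 (measurableSet_le (by fun_prop) (by fun_prop))

structure PSys {d : ℕ} {Ω : Type*} [MeasurableSpace Ω] (P : Measure Ω) (T : ℝ → Euc d → Euc d → Ω → ℝ)
    (Fm Fp : ℝ → MeasurableSpace Ω) (φ : ℝ → ℝ) (T0 : ℝ) : Prop where
  T1 : 1 ≤ T0
  meas : ∀ t x y, Measurable (T t x y)
  nonneg : ∀ t x y ω, 0 ≤ T t x y ω
  ub : ∀ t x y ω, T t x y ω ≤ T0 * (1 + ‖y - x‖)
  minus : ∀ t x y r r', r ≤ r' → MeasurableSet[Fm (t + r')] {ω | T t x y ω ≤ r}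
  plus : ∀ t x y r, MeasurableSet[Fp t] {ω | r ≤ T t x y ω}
  phi : ∀ t s E F, MeasurableSet E → MeasurableSet F → MeasurableSet[Fm t] E → MeasurableSet[Fp (t + s)] F →
    P.real (F ∩ E) ≤ P.real E * (P.real F + φ s)
  phi0 : ∀ s, 0 ≤ φ s
  split : ∀ t x y z σ ω, T t x y ω + T0 < σ → T t x z ω ≤ σ + T (t + σ) y z ω
  start : ∀ t x t1 x1 z ω, T0 * (1 + ‖x1 - x‖) ≤ t1 - t → T t x z ω ≤ (t1 - t) + T t1 x1 z ω
  target : ∀ t x z z1 ω, T t x z1 ω ≤ T t x z ω + T0 * (1 + ‖z1 - z‖)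
  stat : ∀ (s : ℝ) (p : Euc d), ∃ Θ : Ω → Ω, MeasurePreserving Θ P P ∧
    ∀ t x y ω, T t x y (Θ ω) = T (t + s) (x + p) (y + p) ω

lemma phi_fun {Ω : Type*} [MeasurableSpace Ω] {P : Measure Ω} [IsProbabilityMeasure P] {E : Set Ω}
    {Y : Ω → ℝ} {B q : ℝ} (hE : MeasurableSet E) (hY : Measurable Y) (h0 : ∀ ω, 0 ≤ Y ω) (hB : ∀ ω, Y ω ≤ B)
    (hB0 : 0 ≤ B)
    (h : ∀ u, P.real ({ω | u ≤ Y ω} ∩ E) ≤ P.real E * (P.real {ω | u ≤ Y ω} + q)) :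
    ∫ ω in E, Y ω ∂P ≤ P.real E * (∫ ω, Y ω ∂P + q * B) := by
  have hi : Integrable Y P := Integrable.of_mem_Icc 0 B hY.aemeasurable (.of_forall fun ω => ⟨h0 ω, hB ω⟩)
  have mono : ∀ μ : Measure Ω, IsFiniteMeasure μ →
      IntegrableOn (fun t => μ.real {a | t ≤ Y a}) (Set.Ioc 0 B) volume := by
    intro μ hμ
    have : AntitoneOn (fun t => μ.real {a | t ≤ Y a}) (Set.Icc 0 B) := by
      intro s _ t _ hst
      exact measureReal_mono (fun a (ha : t ≤ Y a) => hst.trans ha)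
    exact (this.integrableOn_isCompact isCompact_Icc).mono_set Set.Ioc_subset_Icc_self
  rw [hi.integral_eq_integral_Ioc_meas_le (.of_forall h0) (.of_forall hB),
    hi.integrableOn.integral_eq_integral_Ioc_meas_le (.of_forall h0) (.of_forall hB)]
  have e1 : q * B = ∫ t in Set.Ioc 0 B, q := by
    simp [hB0, mul_comm]
  rw [e1, ← integral_add (mono P inferInstance) (by simp), ← integral_const_mul]
  refine setIntegral_mono (mono _ inferInstance) (((mono P inferInstance).add (by simp)).const_mul _) ?_
  intro u
  have hm : MeasurableSet {ω | u ≤ Y ω} := measurableSet_le measurable_const hY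
  simp only [measureReal_restrict_apply hm]
  exact h u

section
variable {d : ℕ} {Ω : Type*} [MeasurableSpace Ω] {P : Measure Ω} [IsProbabilityMeasure P]
  {T : ℝ → Euc d → Euc d → Ω → ℝ} {Fm Fp : ℝ → MeasurableSpace Ω} {φ : ℝ → ℝ} {T0 : ℝ}

lemma PSys.int_shift (S : PSys P T Fm Fp φ T0) (t : ℝ) (x y : Euc d) (p : ℕ) :
    ∫ ω, (T t x (x + y) ω) ^ p ∂P = ∫ ω, (T 0 0 y ω) ^ p ∂P := by
  obtain ⟨Θ, h1, h2⟩ := S.stat t x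
  have e : ∀ ω, T t x (x + y) ω = T 0 0 y (Θ ω) := by
    intro ω
    rw [h2, zero_add, zero_add, add_comm y x]
  simp only [e]
  have hm : AEStronglyMeasurable (fun ω => (T 0 0 y ω) ^ p) (Measure.map Θ P) :=
    ((S.meas 0 0 y).pow_const p).aestronglyMeasurable
  have h3 := integral_map h1.measurable.aemeasurable hm
  rw [h1.map_eq] at h3
  exact h3.symm

lemma PSys.integrable (S : PSys P T Fm Fp φ T0) (t : ℝ) (x y : Euc d) (p : ℕ) :
    Integrable (fun ω => (T t x y ω) ^ p) P := by
  refine Integrable.of_mem_Icc 0 ((T0 * (1 + ‖y - x‖)) ^ p) ((S.meas t x y).pow_const p).aemeasurable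
    (.of_forall fun ω => ⟨pow_nonneg (S.nonneg _ _ _ _) _, pow_le_pow_left₀ (S.nonneg _ _ _ _) (S.ub _ _ _ _) _⟩)

lemma PSys.haltIneq (S : PSys P T Fm Fp φ T0) {s : ℝ} (x y : Euc d) {p : ℕ} (hp : p ≠ 0) (N : Ω → ℕ) (n : ℕ)
    (hN : ∀ ω, N ω < n) (hE : ∀ k, MeasurableSet {ω | N ω = k})
    (hE2 : ∀ k : ℕ, MeasurableSet[Fm (k * s - s)] {ω | N ω = k}) (f : ℕ → ℝ) (hf : ∀ k, 0 ≤ f k) :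
    Integrable (fun ω => f (N ω) * (T (N ω * s) x (x + y) ω) ^ p) P ∧ Integrable (fun ω => f (N ω)) P ∧
    ∫ ω, f (N ω) * (T (N ω * s) x (x + y) ω) ^ p ∂P ≤
      (∫ ω, f (N ω) ∂P) * (∫ ω, (T 0 0 y ω) ^ p ∂P + φ s * (T0 * (1 + ‖y‖)) ^ p) := by
  have hT0 : 0 ≤ T0 := by linarith [S.T1]
  have e1 : ∀ g : ℕ → Ω → ℝ, (fun ω => g (N ω) ω) = 
      fun ω => ∑ k ∈ Finset.range n, Set.indicator {ω | N ω = k} (g k) ω := by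
    intro g
    funext ω
    rw [Finset.sum_eq_single (N ω)]
    · simp
    · intro k _ hk
      exact Set.indicator_of_notMem (s := {ω | N ω = k}) (fun h : N ω = k => hk h.symm) (g k)
    · intro h
      exact absurd (Finset.mem_range.2 (hN ω)) h
  have ib : ∀ g : ℕ → Ω → ℝ, (∀ k, Integrable (g k) P) → Integrable (fun ω => g (N ω) ω) P ∧
      ∫ ω, g (N ω) ω ∂P = ∑ k ∈ Finset.range n, ∫ ω in {ω | N ω = k}, g k ω ∂P := by
    intro g hg
    rw [e1 g]
    refine ⟨integrable_finsetSum _ fun k _ => (hg k).indicator (hE k), ?_⟩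
    rw [integral_finsetSum _ fun k _ => (hg k).indicator (hE k)]
    refine Finset.sum_congr rfl fun k _ => ?_
    rw [integral_indicator (hE k)]
  obtain ⟨i1, j1⟩ := ib (fun k ω => f k * (T (k * s) x (x + y) ω) ^ p)
    (fun k => (S.integrable _ _ _ p).const_mul _)
  obtain ⟨i2, j2⟩ := ib (fun k ω => f k) (fun k => integrable_const _)
  refine ⟨i1, i2, ?_⟩
  rw [j1, j2, Finset.sum_mul]
  refine Finset.sum_le_sum fun k _ => ?_
  rw [integral_const_mul, setIntegral_const, smul_eq_mul, mul_comm (P.real _) (f k), mul_assoc]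
  refine mul_le_mul_of_nonneg_left ?_ (hf k)
  rw [← S.int_shift (k * s) x y p]
  refine phi_fun (hE k) ((S.meas _ _ _).pow_const p) (fun ω => pow_nonneg (S.nonneg _ _ _ _) _) ?_ (by positivity) ?_
  · intro ω
    have := S.ub (k * s) x (x + y) ω
    rw [add_sub_cancel_left] at this
    exact pow_le_pow_left₀ (S.nonneg _ _ _ _) this _
  · intro u
    have key : ∃ u', {ω | u ≤ (T (k * s) x (x + y) ω) ^ p} = {ω | u' ≤ T (k * s) x (x + y) ω} := by
      by_cases hu : u ≤ 0
      · refine ⟨0, ?_⟩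
        ext ω
        simp only [Set.mem_ofPred_eq, S.nonneg, iff_true]
        exact hu.trans (pow_nonneg (S.nonneg _ _ _ _) _)
      · push Not at hu
        refine ⟨u ^ ((p:ℝ)⁻¹), ?_⟩
        ext ω
        simp only [Set.mem_ofPred_eq]
        have hq : (u ^ ((p:ℝ)⁻¹)) ^ p = u := Real.rpow_inv_natCast_pow hu.le hp
        conv_lhs => rw [← hq]
        exact pow_le_pow_iff_left₀ (by positivity) (S.nonneg _ _ _ _) hp
    obtain ⟨u', hu'⟩ := key
    rw [hu']
    refine S.phi (k * s - s) s _ _ (hE k) (measurableSet_le measurable_const (S.meas _ _ _)) (hE2 k) ?_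
    rw [sub_add_cancel]
    exact S.plus _ _ _ _

lemma PSys.compose (S : PSys P T Fm Fp φ T0) {s : ℝ} (hs : T0 < s) (x y : Euc d) :
    (∫ ω, T 0 0 (x + y) ω ∂P ≤ ∫ ω, T 0 0 x ω ∂P + 2 * s + ∫ ω, T 0 0 y ω ∂P + φ s * (T0 * (1 + ‖y‖))) ∧
    (∫ ω, (T 0 0 (x + y) ω) ^ 2 ∂P ≤ ∫ ω, (T 0 0 x ω + 2 * s) ^ 2 ∂P
      + 2 * (∫ ω, T 0 0 x ω ∂P + 2 * s) * (∫ ω, T 0 0 y ω ∂P + φ s * (T0 * (1 + ‖y‖)))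
      + (∫ ω, (T 0 0 y ω) ^ 2 ∂P + φ s * (T0 * (1 + ‖y‖)) ^ 2)) := by
  have hT0 : 0 < T0 := by linarith [S.T1]
  have hs0 : 0 < s := by linarith
  set N : Ω → ℕ := fun ω => ⌈T 0 0 x ω / s⌉₊ + 1 with hNdef
  have hlo : ∀ ω, T 0 0 x ω + T0 < N ω * s := by
    intro ω
    have := Nat.le_ceil (T 0 0 x ω / s)
    rw [div_le_iff₀ hs0] at this
    simp only [hNdef]; push_cast; linarith
  have hhi : ∀ ω, N ω * s ≤ T 0 0 x ω + 2 * s := by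
    intro ω
    have := (Nat.ceil_lt_add_one (div_nonneg (S.nonneg 0 0 x ω) hs0.le)).le
    have h2 := mul_le_mul_of_nonneg_right this hs0.le
    rw [add_mul, div_mul_cancel₀ _ hs0.ne'] at h2
    simp only [hNdef]; push_cast; linarith
  have hle : ∀ ω (k : ℕ), N ω ≤ k + 1 ↔ T 0 0 x ω ≤ k * s := by
    intro ω k
    simp only [hNdef, add_le_add_iff_right, Nat.ceil_le, div_le_iff₀ hs0]
  have hset : ∀ k : ℕ, {ω | N ω = k + 2} = {ω | T 0 0 x ω ≤ (k + 1 : ℕ) * s} \ {ω | T 0 0 x ω ≤ k * s} := by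
    intro k
    ext ω
    simp only [Set.mem_ofPred_eq, Set.mem_sdiff, ← hle]
    omega
  have hset0 : {ω | N ω = 0} = ∅ := by
    ext ω; simp [hNdef]
  have hset1 : {ω | N ω = 1} = {ω | T 0 0 x ω ≤ (0:ℕ) * s} := by
    ext ω
    simp only [Set.mem_ofPred_eq, ← hle]
    simp only [hNdef]
    omega
  have hE : ∀ k, MeasurableSet {ω | N ω = k} := by
    have hm : ∀ r, MeasurableSet {ω | T 0 0 x ω ≤ r} := fun r => measurableSet_le (S.meas _ _ _) measurable_const
    rintro (_ | _ | k)
    · rw [hset0]; exact MeasurableSet.empty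
    · rw [zero_add, hset1]; exact hm _
    · rw [hset]; exact (hm _).diff (hm _)
  have hE2 : ∀ k : ℕ, MeasurableSet[Fm (k * s - s)] {ω | N ω = k} := by
    rintro (_ | _ | k)
    · rw [hset0]; exact @MeasurableSet.empty _ (_)
    · rw [zero_add, hset1]
      have := S.minus 0 0 x ((0:ℕ) * s) ((1:ℕ) * s - s) (by simp)
      rwa [zero_add] at this
    · rw [hset]
      have h1 := S.minus 0 0 x ((k+1:ℕ) * s) ((k + 1 + 1:ℕ) * s - s) (by push_cast; linarith)
      have h2 := S.minus 0 0 x (k * s) ((k + 1 + 1:ℕ) * s - s) (by push_cast; linarith)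
      rw [zero_add] at h1 h2
      exact @MeasurableSet.diff _ (_) _ _ h1 h2
  set n : ℕ := ⌈T0 * (1 + ‖x‖) / s⌉₊ + 2 with hn
  have hN : ∀ ω, N ω < n := by
    intro ω
    have := S.ub 0 0 x ω
    rw [sub_zero] at this
    have := Nat.ceil_mono (div_le_div_of_nonneg_right this hs0.le)
    simp only [hNdef, hn]
    omega
  have hpt : ∀ ω, T 0 0 (x + y) ω ≤ N ω * s + T (N ω * s) x (x + y) ω := by
    intro ω
    have := S.split 0 0 x (x + y) (N ω * s) ω (hlo ω)
    rwa [zero_add] at this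
  obtain ⟨i1, -, j1⟩ := S.haltIneq (s := s) x y one_ne_zero N n hN hE hE2 (fun _ => 1) (fun _ => zero_le_one)
  obtain ⟨i2, -, j2⟩ := S.haltIneq (s := s) x y two_ne_zero N n hN hE hE2 (fun _ => 1) (fun _ => zero_le_one)
  obtain ⟨i3, i4, j3⟩ := S.haltIneq (s := s) x y one_ne_zero N n hN hE hE2 (fun k => k * s) (fun _ => by positivity)
  obtain ⟨-, i5, -⟩ := S.haltIneq (s := s) x y one_ne_zero N n hN hE hE2 (fun k => (k * s) ^ 2) (fun _ => by positivity)
  simp only [pow_one, one_mul, integral_const, probReal_univ, smul_eq_mul] at i1 i2 i3 j1 j2 j3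
  have iX := S.integrable 0 0 x 1
  have iXY := S.integrable 0 0 (x + y) 1
  have iXY2 := S.integrable 0 0 (x + y) 2
  have iX2 := S.integrable 0 0 x 2
  simp only [pow_one] at iX iXY
  have hσ : ∫ ω, (N ω * s) ∂P ≤ ∫ ω, T 0 0 x ω ∂P + 2 * s := by
    calc _ ≤ ∫ ω, (T 0 0 x ω + 2 * s) ∂P := integral_mono i4 (iX.add (integrable_const _)) hhi
      _ = _ := by rw [integral_add iX (integrable_const _)]; simp
  have iS : Integrable (fun ω => (T 0 0 x ω + 2 * s) ^ 2) P := by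
    have : (fun ω => (T 0 0 x ω + 2 * s) ^ 2) = fun ω => T 0 0 x ω ^ 2 + (4 * s * T 0 0 x ω + 4 * s ^ 2) := by
      funext ω; ring
    rw [this]
    exact iX2.add ((iX.const_mul _).add (integrable_const _))
  have hσ2 : ∫ ω, (N ω * s) ^ 2 ∂P ≤ ∫ ω, (T 0 0 x ω + 2 * s) ^ 2 ∂P := by
    refine integral_mono i5 iS fun ω => ?_
    exact pow_le_pow_left₀ (by positivity) (hhi ω) _
  constructor
  · have := integral_mono iXY (i4.add i1) hpt
    rw [integral_add' i4 i1] at this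
    linarith
  · have h1 : ∀ ω, (T 0 0 (x + y) ω) ^ 2 ≤ (N ω * s) ^ 2 + (2 * (N ω * s * T (N ω * s) x (x + y) ω) + (T (N ω * s) x (x + y) ω) ^ 2) := by
      intro ω
      refine (pow_le_pow_left₀ (S.nonneg _ _ _ _) (hpt ω) 2).trans (le_of_eq ?_)
      ring
    have := integral_mono iXY2 (i5.add ((i3.const_mul 2).add i2)) h1
    rw [integral_add' i5 ((i3.const_mul 2).add i2), integral_add' (i3.const_mul 2) i2, integral_const_mul] at this
    have hy0 : 0 ≤ ∫ ω, T 0 0 y ω ∂P + φ s * (T0 * (1 + ‖y‖)) := by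
      have := integral_nonneg (μ := P) (f := T 0 0 y) (S.nonneg 0 0 y)
      have := S.phi0 s
      positivity
    have := mul_le_mul_of_nonneg_right hσ hy0
    linarith
end

lemma subadd_limit {A E : ℝ → ℝ} {D u0 : ℝ} (hD : 0 ≤ D) (hu0 : 0 < u0) (hA : ∀ r, 0 ≤ A r) (hE : ∀ r, 0 ≤ E r)
    (hlip : ∀ r r', A r' ≤ A r + D * (1 + |r' - r|)) (hEl : Tendsto (fun u => E u / u) atTop (nhds 0))
    (hsub : ∀ u, u0 ≤ u → ∀ k : ℕ, A ((k + 1) * u) ≤ A (k * u) + A u + E u) :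
    ∃ L, Tendsto (fun r => A r / r) atTop (nhds L) := by
  have h1 : ∀ u, u0 ≤ u → ∀ k : ℕ, A (k * u) ≤ A 0 + k * (A u + E u) := by
    intro u hu k
    induction k with
    | zero => simp
    | succ k ih =>
      have := hsub u hu k
      push_cast
      linarith
  have h2 : ∀ u, u0 ≤ u → ∀ r, 0 < r → A r / r ≤ (A 0 + D * (1 + u)) / r + (A u / u + E u / u) := by
    intro u hu r hr
    have hu' : 0 < u := hu0.trans_le hu
    have e1 := Nat.floor_le (div_nonneg hr.le hu'.le)
    have e2 := (Nat.lt_floor_add_one (r / u)).le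
    have e3 := mul_le_mul_of_nonneg_right e1 hu'.le
    have e4 := mul_le_mul_of_nonneg_right e2 hu'.le
    rw [div_mul_cancel₀ _ hu'.ne'] at e3 e4
    have e5 := h1 u hu ⌊r / u⌋₊
    have e6 := hlip (⌊r / u⌋₊ * u) r
    rw [abs_of_nonneg (by linarith)] at e6
    have e7 : D * (1 + (r - ⌊r / u⌋₊ * u)) ≤ D * (1 + u) := mul_le_mul_of_nonneg_left (by linarith) hD
    have e8 := mul_le_mul_of_nonneg_right e1 (add_nonneg (hA u) (hE u))
    rw [div_le_iff₀ hr]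
    have : ((A 0 + D * (1 + u)) / r + (A u / u + E u / u)) * r = A 0 + D * (1 + u) + r / u * (A u + E u) := by
      field_simp
    rw [this]
    linarith
  have hbd : ∃ B, ∀ᶠ r in atTop, A r / r ≤ B := by
    refine ⟨(A 0 + D * (1 + u0)) / 1 + (A u0 / u0 + E u0 / u0), ?_⟩
    filter_upwards [eventually_ge_atTop 1] with r hr
    refine (h2 u0 le_rfl r (by linarith)).trans ?_
    have := hA 0
    gcongr
  obtain ⟨B, hB⟩ := hbd
  have hb1 : IsBoundedUnder (· ≤ ·) atTop (fun r => A r / r) := ⟨B, by simpa using hB⟩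
  have hb2 : IsBoundedUnder (· ≥ ·) atTop (fun r => A r / r) := ⟨0, by
    simp only [eventually_map]
    filter_upwards [eventually_ge_atTop 1] with r hr
    exact div_nonneg (hA r) (by linarith)⟩
  have h3 : ∀ u, u0 ≤ u → limsup (fun r => A r / r) atTop ≤ A u / u + E u / u := by
    intro u hu
    have t1 : Tendsto (fun r => (A 0 + D * (1 + u)) / r + (A u / u + E u / u)) atTop (nhds (A u / u + E u / u)) := by
      have := (tendsto_const_nhds (x := A 0 + D * (1 + u))).div_atTop tendsto_id
      simpa using this.add_const (A u / u + E u / u)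
    rw [← t1.limsup_eq]
    refine limsup_le_limsup ?_ hb2.isCoboundedUnder_le t1.isBoundedUnder_le
    filter_upwards [eventually_gt_atTop 0] with r hr using h2 u hu r hr
  refine ⟨limsup (fun r => A r / r) atTop, ?_⟩
  rw [tendsto_order]
  constructor
  · intro a ha
    have := hEl.eventually (gt_mem_nhds (sub_pos.2 ha))
    filter_upwards [this, eventually_ge_atTop u0] with u h4 h5
    have := h3 u h5
    linarith
  · intro a ha
    exact eventually_lt_of_limsup_lt ha hb1

lemma hammersley {V b err : ℕ → ℝ} (hV : ∀ j, 0 ≤ V j) (he : ∀ j, 0 ≤ err j) (hs : Summable err)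
    (h : ∀ j, V (j + 1) + (b (j + 1)) ^ 2 ≤ V j / 2 + (b j) ^ 2 + err j) : Summable V := by
  have key : ∀ J, (∑ j ∈ Finset.range J, V j) / 2 + V J + (b J) ^ 2 ≤ V 0 + (b 0) ^ 2 + ∑ j ∈ Finset.range J, err j := by
    intro J
    induction J with
    | zero => simp
    | succ J ih =>
      rw [Finset.sum_range_succ, Finset.sum_range_succ]
      have := h J
      linarith
  refine summable_of_sum_range_le (c := 2 * (V 0 + (b 0) ^ 2 + ∑' j, err j)) hV fun J => ?_
  have h1 := key J
  have h2 := hs.sum_le_tsum (Finset.range J) (fun i _ => he i)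
  have h3 := hV J
  have h4 := sq_nonneg (b J)
  linarith

lemma dyadic_limit {g : ℝ → ℝ} {D L : ℝ} {n0 : ℕ} (hD : 0 ≤ D)
    (hlip : ∀ r r', |g r' - g r| ≤ D * (1 + |r' - r|))
    (h : ∀ m : ℕ, n0 ≤ m → Tendsto (fun j : ℕ => g (m * 2 ^ j) / (m * 2 ^ j)) atTop (nhds L)) :
    Tendsto (fun r => g r / r) atTop (nhds L) := by
  rw [Metric.tendsto_nhds]
  intro ε hε
  obtain ⟨M0, hM⟩ := exists_nat_gt (max (n0 + 1 : ℝ) ((D + |L|) / (ε / 3)))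
  have hM1 : (n0:ℝ) + 1 < M0 := (le_max_left _ _).trans_lt hM
  have hM2 : (D + |L|) / (ε / 3) < M0 := (le_max_right _ _).trans_lt hM
  have hM0 : (0:ℝ) < M0 := by have : (0:ℝ) ≤ n0 := Nat.cast_nonneg _; linarith
  have hn0 : n0 ≤ M0 := by exact_mod_cast (by linarith : (n0:ℝ) ≤ M0)
  have hM3 : (D + |L|) / M0 < ε / 3 := by
    rw [div_lt_iff₀ (by positivity)] at hM2
    rw [div_lt_iff₀ hM0]; linarith
  have hev : ∀ᶠ j : ℕ in atTop, ∀ m ∈ Finset.Icc M0 (2 * M0), |g (m * 2 ^ j) / (m * 2 ^ j) - L| < ε / 3 := by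
    rw [Filter.eventually_all_finset]
    intro m hm
    have := (h m (hn0.trans (Finset.mem_Icc.1 hm).1))
    rw [Metric.tendsto_nhds] at this
    simpa [Real.dist_eq] using this (ε / 3) (by positivity)
  obtain ⟨J, hJ⟩ := eventually_atTop.1 hev
  have hDr : ∀ᶠ r : ℝ in atTop, D / r < ε / 3 := by
    have := (tendsto_const_nhds (x := D)).div_atTop (tendsto_id (α := ℝ) (x := atTop))
    exact this.eventually (gt_mem_nhds (by positivity))
  filter_upwards [hDr, eventually_ge_atTop (M0 * 2 ^ J : ℝ)] with r hr1 hr2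
  have hr0 : 0 < r := lt_of_lt_of_le (by positivity) hr2
  obtain ⟨j, hj1, hj2⟩ : ∃ j : ℕ, (2:ℝ) ^ j ≤ r / M0 ∧ r / M0 < 2 ^ (j + 1) := by
    refine exists_nat_pow_near ?_ one_lt_two
    rw [le_div_iff₀ hM0, one_mul]
    refine le_trans ?_ hr2
    exact le_mul_of_one_le_right hM0.le (one_le_pow₀ one_le_two)
  have hJj : J ≤ j := by
    have : (2:ℝ) ^ J < 2 ^ (j + 1) := lt_of_le_of_lt (by rw [le_div_iff₀ hM0]; linarith) hj2
    have := (pow_lt_pow_iff_right₀ (one_lt_two (α := ℝ))).1 this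
    omega
  have hp : (0:ℝ) < 2 ^ j := by positivity
  rw [le_div_iff₀ hM0] at hj1
  rw [div_lt_iff₀ hM0, pow_succ] at hj2
  set m := ⌊r / 2 ^ j⌋₊ with hm
  have e1 := Nat.floor_le (div_nonneg hr0.le hp.le)
  have e2 := (Nat.lt_floor_add_one (r / 2 ^ j)).le
  have e3 := mul_le_mul_of_nonneg_right e1 hp.le
  have e4 := mul_le_mul_of_nonneg_right e2 hp.le
  rw [div_mul_cancel₀ _ hp.ne', ← hm] at e3 e4
  have hm1 : M0 ≤ m := by
    refine Nat.le_floor ?_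
    rw [le_div_iff₀ hp]; linarith
  have hm2 : m ≤ 2 * M0 := by
    refine Nat.floor_le_of_le ?_
    rw [div_le_iff₀ hp]; push_cast; linarith
  have k1 := hJ j hJj m (Finset.mem_Icc.2 ⟨hm1, hm2⟩)
  have k2 := hlip (m * 2 ^ j) r
  have hmp : (0:ℝ) < m := hM0.trans_le (by exact_mod_cast hm1)
  have hn : 0 < (m:ℝ) * 2 ^ j := by positivity
  set n : ℝ := m * 2 ^ j with hndef
  have hrn : r - n ≤ r / M0 := by rw [le_div_iff₀ hM0]; nlinarith
  rw [abs_of_nonneg (by linarith : 0 ≤ r - n)] at k2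
  rw [Real.dist_eq]
  have k3 : |g n - L * n| ≤ ε / 3 * n := by
    have : g n - L * n = (g n / n - L) * n := by field_simp
    rw [this, abs_mul, abs_of_pos hn]
    exact mul_le_mul_of_nonneg_right k1.le hn.le
  have k4 : |g r - L * r| ≤ D * (1 + (r - n)) + ε / 3 * n + |L| * (r - n) := by
    have : g r - L * r = (g r - g n) + (g n - L * n) + (- (L * (r - n))) := by ring
    rw [this]
    refine (abs_add_three _ _ _).trans ?_
    rw [abs_neg, abs_mul, abs_of_nonneg (by linarith : 0 ≤ r - n)]
    linarith
  have k5 : g r / r - L = (g r - L * r) / r := by field_simp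
  rw [k5, abs_div, abs_of_pos hr0, div_lt_iff₀ hr0]
  rw [div_lt_iff₀ hr0] at hr1
  have k6 : (D + |L|) * (r - n) ≤ ε / 3 * r := by
    calc (D + |L|) * (r - n) ≤ (D + |L|) * (r / M0) := mul_le_mul_of_nonneg_left hrn (by positivity)
      _ = (D + |L|) / M0 * r := by ring
      _ ≤ _ := mul_le_mul_of_nonneg_right hM3.le hr0.le
  have k7 : ε / 3 * n ≤ ε / 3 * r := mul_le_mul_of_nonneg_left (by linarith) (by positivity)
  linarith

section
variable {d : ℕ} {Ω : Type*} [MeasurableSpace Ω] {P : Measure Ω} [IsProbabilityMeasure P]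
  {T : ℝ → Euc d → Euc d → Ω → ℝ} {Fm Fp : ℝ → MeasurableSpace Ω} {φ : ℝ → ℝ} {T0 : ℝ}

lemma PSys.int1 (S : PSys P T Fm Fp φ T0) (t : ℝ) (x y : Euc d) : Integrable (T t x y) P := by
  simpa using S.integrable t x y 1

lemma PSys.mean_lip (S : PSys P T Fm Fp φ T0) (t : ℝ) (x z z1 : Euc d) :
    ∫ ω, T t x z1 ω ∂P ≤ ∫ ω, T t x z ω ∂P + T0 * (1 + ‖z1 - z‖) := by
  calc _ ≤ ∫ ω, (T t x z ω + T0 * (1 + ‖z1 - z‖)) ∂P :=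
        integral_mono (S.int1 _ _ _) ((S.int1 _ _ _).add (integrable_const _)) (S.target t x z z1)
    _ = _ := by rw [integral_add (S.int1 _ _ _) (integrable_const _)]; simp

lemma PSys.mean_ub (S : PSys P T Fm Fp φ T0) (t : ℝ) (x z : Euc d) :
    ∫ ω, T t x z ω ∂P ≤ T0 * (1 + ‖z - x‖) := by
  calc _ ≤ ∫ ω, (T0 * (1 + ‖z - x‖)) ∂P :=
        integral_mono (S.int1 _ _ _) (integrable_const _) (S.ub t x z)
    _ = _ := by simp

lemma PSys.mean_limit (S : PSys P T Fm Fp φ T0) (hφ : Tendsto φ atTop (nhds 0)) {e : Euc d} (he : ‖e‖ = 1) :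
    ∃ L, Tendsto (fun r : ℝ => (∫ ω, T 0 0 (r • e) ω ∂P) / r) atTop (nhds L) := by
  have hT := S.T1
  have hn : ∀ r r' : ℝ, ‖r' • e - r • e‖ = |r' - r| := by
    intro r r'
    rw [← sub_smul, norm_smul, he, mul_one, Real.norm_eq_abs]
  refine subadd_limit (E := fun u => 2 * √u + φ (√u) * (T0 * (1 + |u|))) (D := T0) (u0 := T0 ^ 2 + 1)
    (by linarith) (by positivity) (fun r => integral_nonneg (S.nonneg _ _ _)) ?_ ?_ ?_ ?_
  · intro r
    have := S.phi0 (√r)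
    positivity
  · intro r r'
    have := S.mean_lip 0 0 (r • e) (r' • e)
    rwa [hn] at this
  · have t1 : Tendsto (fun u : ℝ => 2 * (√u)⁻¹ + φ (√u) * (2 * T0)) atTop (nhds 0) := by
      have := ((tendsto_inv_atTop_zero.comp Real.tendsto_sqrt_atTop).const_mul 2).add
        ((hφ.comp Real.tendsto_sqrt_atTop).mul_const (2 * T0))
      simpa using this
    refine squeeze_zero' ?_ ?_ t1
    · filter_upwards [eventually_gt_atTop 0] with u hu
      have := S.phi0 (√u)
      positivity
    · filter_upwards [eventually_ge_atTop 1] with u hu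
      have hu0 : 0 < u := by linarith
      have h1 := S.phi0 (√u)
      have hsq : √u * √u = u := Real.mul_self_sqrt hu0.le
      have hs : 0 < √u := Real.sqrt_pos.2 hu0
      rw [abs_of_pos hu0, div_le_iff₀ hu0, add_mul]
      have e1 : 2 * (√u)⁻¹ * u = 2 * √u := by
        rw [← hsq]; field_simp; simp
      rw [e1, mul_assoc]
      refine add_le_add le_rfl (mul_le_mul_of_nonneg_left ?_ h1)
      nlinarith
  · intro u hu k
    have hu0 : 0 < u := by nlinarith
    have hs : T0 < √u := Real.lt_sqrt_of_sq_lt (by linarith)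
    have := (S.compose hs ((k * u) • e) (u • e)).1
    rw [← add_smul, norm_smul, he, mul_one, Real.norm_eq_abs] at this
    rw [add_mul, one_mul]
    linarith

lemma PSys.sq_expand (S : PSys P T Fm Fp φ T0) (t : ℝ) (x y : Euc d) (b : ℝ) :
    Integrable (fun ω => (T t x y ω + b) ^ 2) P ∧ ∫ ω, (T t x y ω + b) ^ 2 ∂P =
      ∫ ω, (T t x y ω) ^ 2 ∂P + 2 * b * ∫ ω, T t x y ω ∂P + b ^ 2 := by
  have e : (fun ω => (T t x y ω + b) ^ 2) = fun ω => ((T t x y ω) ^ 2 + 2 * b * T t x y ω) + b ^ 2 := by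
    funext ω; ring
  have i1 := S.integrable t x y 2
  have i2 : Integrable (fun ω => 2 * b * T t x y ω) P := (S.int1 t x y).const_mul (2 * b)
  have i3 : Integrable (fun ω => (T t x y ω) ^ 2 + 2 * b * T t x y ω) P := i1.add i2
  rw [e]
  refine ⟨i3.add (integrable_const _), ?_⟩
  rw [integral_add i3 (integrable_const _), integral_add i1 i2, integral_const_mul]
  simp

lemma moment_alg {D n s f g a B m2 m4 : ℝ} (hD2 : 2 ≤ D) (hn0 : 0 < n) (hsq : s * s = n) (hsp : 1 ≤ s)
    (hf0 : 0 ≤ f) (hf : f ≤ g) (ha0 : 0 ≤ a) (ha : a ≤ B) (hB : B ≤ D * n)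
    (key : m4 ≤ m2 + 2 * (2 * s) * a + (2 * s) ^ 2 + 2 * (a + 2 * s) * (a + f * B) + (m2 + f * B ^ 2)) :
    m4 / (2 * n) ^ 2 ≤ m2 / n ^ 2 / 2 + (a / n) ^ 2 / 2 + (4 * D ^ 2 + 4 * D + 4) * (s⁻¹ + g) := by
  have hg0 : 0 ≤ g := hf0.trans hf
  have hs0 : 0 < s := by linarith
  have hsn : s ≤ n := by rw [← hsq]; exact le_mul_of_one_le_left hs0.le hsp
  have haD : a ≤ D * n := ha.trans hB
  have hB0 : 0 ≤ B := ha0.trans ha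
  have b1 : 8 * s * a ≤ 8 * D * (s * n) := by
    calc 8 * s * a ≤ 8 * s * (D * n) := by gcongr
      _ = _ := by ring
  have b2 : 4 * s ^ 2 ≤ 4 * (s * n) := by
    rw [pow_two]; gcongr
  have b3 : f * (2 * a * B + 4 * s * B + B ^ 2) ≤ g * (2 * (D * n) * (D * n) + 4 * n * (D * n) + (D * n) ^ 2) := by
    gcongr
  have tot : m4 ≤ 2 * m2 + 2 * a ^ 2 + (8 * D + 4) * (s * n) + g * ((3 * D ^ 2 + 4 * D) * n ^ 2) := by
    linarith
  have r1 : m4 / (2 * n) ^ 2 ≤ (2 * m2 + 2 * a ^ 2 + (8 * D + 4) * (s * n) + g * ((3 * D ^ 2 + 4 * D) * n ^ 2)) / (2 * n) ^ 2 := by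
    gcongr
  refine r1.trans ?_
  have r2 : (s * n) / n ^ 2 = s⁻¹ := by
    rw [← hsq]; field_simp
  have r3 : (2 * m2 + 2 * a ^ 2 + (8 * D + 4) * (s * n) + g * ((3 * D ^ 2 + 4 * D) * n ^ 2)) / (2 * n) ^ 2
      = m2 / n ^ 2 / 2 + (a / n) ^ 2 / 2 + (2 * D + 1) * ((s * n) / n ^ 2) + g * ((3 * D ^ 2 + 4 * D) / 4) := by
    field_simp; ring
  rw [r3, r2]
  have r4 : 0 ≤ s⁻¹ := by positivity
  have r5 : (2 * D + 1) * s⁻¹ ≤ (4 * D ^ 2 + 4 * D + 4) * s⁻¹ := by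
    apply mul_le_mul_of_nonneg_right _ r4; linarith [sq_nonneg D]
  have r6 : (3 * D ^ 2 + 4 * D) / 4 * g ≤ (4 * D ^ 2 + 4 * D + 4) * g := by
    apply mul_le_mul_of_nonneg_right _ hg0; linarith [sq_nonneg D]
  linarith

lemma PSys.moment_step (S : PSys P T Fm Fp φ T0) {α : ℝ} (hφ : ∀ᶠ s in atTop, φ s ≤ s ^ (-α)) {e : Euc d}
    (he : ‖e‖ = 1) : ∃ C : ℝ, 0 ≤ C ∧ ∃ n1 : ℕ, 1 ≤ n1 ∧ ∀ n : ℝ, n1 ≤ n →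
      (∫ ω, (T 0 0 ((2 * n) • e) ω) ^ 2 ∂P) / (2 * n) ^ 2 ≤ (∫ ω, (T 0 0 (n • e) ω) ^ 2 ∂P) / n ^ 2 / 2
        + ((∫ ω, T 0 0 (n • e) ω ∂P) / n) ^ 2 / 2 + C * ((√n)⁻¹ + (√n) ^ (-α)) := by
  have hT := S.T1
  obtain ⟨s0, hs0⟩ := eventually_atTop.1 hφ
  obtain ⟨n1, hn1⟩ := exists_nat_gt (max (T0 ^ 2) (s0 ^ 2))
  set D := 2 * T0 with hD
  refine ⟨4 * D ^ 2 + 4 * D + 4, by positivity, n1 + 1, by omega, ?_⟩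
  intro n hn
  push_cast at hn
  have h1 : T0 ^ 2 < n := by linarith [(le_max_left (T0 ^ 2) (s0 ^ 2))]
  have h2 : s0 ^ 2 < n := by linarith [(le_max_right (T0 ^ 2) (s0 ^ 2))]
  have h3 : 1 ≤ n := by linarith [Nat.cast_nonneg (α := ℝ) n1]
  have hn0 : 0 < n := by linarith
  have hs1 : T0 < √n := Real.lt_sqrt_of_sq_lt h1
  have hs2 : s0 ≤ √n := (Real.lt_sqrt_of_sq_lt h2).le
  have hf := hs0 _ hs2
  have hf0 := S.phi0 (√n)
  have hsq : √n * √n = n := Real.mul_self_sqrt hn0.le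
  have hsp : 1 ≤ √n := Real.one_le_sqrt.2 h3
  have key := (S.compose hs1 (n • e) (n • e)).2
  have ha := S.mean_ub 0 0 (n • e)
  have ha0 : 0 ≤ ∫ ω, T 0 0 (n • e) ω ∂P := integral_nonneg (S.nonneg _ _ _)
  rw [← add_smul, ← two_mul n, (S.sq_expand 0 0 (n • e) (2 * √n)).2] at key
  rw [sub_zero] at ha
  have hnn : ‖n • e‖ = n := by rw [norm_smul, he, mul_one, Real.norm_eq_abs, abs_of_pos hn0]
  rw [hnn] at key ha
  have hB : T0 * (1 + n) ≤ D * n := by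
    rw [hD, mul_comm 2, mul_assoc]
    exact mul_le_mul_of_nonneg_left (by linarith) (by linarith)
  exact moment_alg (by linarith) hn0 hsq hsp hf0 hf ha0 ha hB key
end

section
variable {d : ℕ} {Ω : Type*} [MeasurableSpace Ω] {P : Measure Ω} [IsProbabilityMeasure P]
  {T : ℝ → Euc d → Euc d → Ω → ℝ} {Fm Fp : ℝ → MeasurableSpace Ω} {φ : ℝ → ℝ} {T0 : ℝ}

lemma ae_tendsto_of_summable {f : ℕ → Ω → ℝ} (hi : ∀ j, Integrable (f j) P) (h0 : ∀ j ω, 0 ≤ f j ω)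
    (hs : Summable (fun j => ∫ ω, f j ω ∂P)) : ∀ᵐ ω ∂P, Tendsto (fun j => f j ω) atTop (nhds 0) := by
  have h1 : ∫⁻ ω, ∑' j, ENNReal.ofReal (f j ω) ∂P ≠ ⊤ := by
    rw [lintegral_tsum fun j => (hi j).aemeasurable.ennreal_ofReal]
    have : ∀ j, ∫⁻ ω, ENNReal.ofReal (f j ω) ∂P = ENNReal.ofReal (∫ ω, f j ω ∂P) := fun j =>
      (ofReal_integral_eq_lintegral_ofReal (hi j) (.of_forall (h0 j))).symm
    simp only [this]
    exact hs.tsum_ofReal_ne_top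
  have h2 := ae_lt_top' (AEMeasurable.tsum fun j => (hi j).aemeasurable.ennreal_ofReal) h1
  filter_upwards [h2] with ω hω
  have h3 := ENNReal.tendsto_atTop_zero_of_tsum_ne_top hω.ne
  have h4 := (ENNReal.tendsto_toReal (ENNReal.zero_ne_top)).comp h3
  simpa [Function.comp_def, ENNReal.toReal_ofReal (h0 _ _)] using h4

lemma PSys.ae_dyadic (S : PSys P T Fm Fp φ T0) {α : ℝ} (hα : 0 < α) {e : Euc d} {C L : ℝ} (hC : 0 ≤ C) {n1 : ℕ}
    (hn1 : 1 ≤ n1) (hL : Tendsto (fun r : ℝ => (∫ ω, T 0 0 (r • e) ω ∂P) / r) atTop (nhds L))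
    (h : ∀ n : ℝ, n1 ≤ n →
      (∫ ω, (T 0 0 ((2 * n) • e) ω) ^ 2 ∂P) / (2 * n) ^ 2 ≤ (∫ ω, (T 0 0 (n • e) ω) ^ 2 ∂P) / n ^ 2 / 2
        + ((∫ ω, T 0 0 (n • e) ω ∂P) / n) ^ 2 / 2 + C * ((√n)⁻¹ + (√n) ^ (-α))) (m : ℕ) (hm : n1 ≤ m) :
    ∀ᵐ ω ∂P, Tendsto (fun j : ℕ => T 0 0 (((m:ℝ) * 2 ^ j) • e) ω / (m * 2 ^ j)) atTop (nhds L) := by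
  set n : ℕ → ℝ := fun j => (m:ℝ) * 2 ^ j with hn
  have hm1 : (1:ℝ) ≤ m := by exact_mod_cast hn1.trans hm
  have hnp : ∀ j, 0 < n j := fun j => by simp only [hn]; positivity
  have hn2 : ∀ j, n (j + 1) = 2 * n j := fun j => by simp only [hn, pow_succ]; ring
  have hnl : ∀ j, (2:ℝ) ^ j ≤ n j := fun j => le_mul_of_one_le_left (by positivity) hm1
  have hnn1 : ∀ j, (n1:ℝ) ≤ n j := fun j => by
    have h1 : (n1:ℝ) ≤ m := by exact_mod_cast hm
    exact h1.trans (le_mul_of_one_le_right (by linarith) (one_le_pow₀ one_le_two))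
  have hntop : Tendsto n atTop atTop :=
    tendsto_atTop_mono hnl (tendsto_pow_atTop_atTop_of_one_lt one_lt_two)
  set b : ℕ → ℝ := fun j => (∫ ω, T 0 0 (n j • e) ω ∂P) / n j with hb
  have hbL : Tendsto b atTop (nhds L) := hL.comp hntop
  set f : ℕ → Ω → ℝ := fun j ω => (T 0 0 (n j • e) ω / n j - b j) ^ 2 with hf
  have hfe : ∀ j, f j = fun ω => ((n j) ^ 2)⁻¹ * (T 0 0 (n j • e) ω + (-∫ ω, T 0 0 (n j • e) ω ∂P)) ^ 2 := by
    intro j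
    funext ω
    have := (hnp j).ne'
    simp only [hf, hb]
    field_simp
    ring
  have hfi : ∀ j, Integrable (f j) P := fun j => by
    rw [hfe]
    exact (S.sq_expand 0 0 (n j • e) _).1.const_mul _
  have hf0 : ∀ j ω, 0 ≤ f j ω := fun j ω => sq_nonneg _
  have hV : ∀ j, ∫ ω, f j ω ∂P = (∫ ω, (T 0 0 (n j • e) ω) ^ 2 ∂P) / (n j) ^ 2 - (b j) ^ 2 := by
    intro j
    rw [hfe, integral_const_mul, (S.sq_expand 0 0 (n j • e) _).2]
    have := (hnp j).ne'
    simp only [hb]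
    field_simp
    ring
  have hsum : Summable (fun j => ∫ ω, f j ω ∂P) := by
    refine hammersley (b := b) (err := fun j => C * (((√2)⁻¹) ^ j + ((√2) ^ (-α)) ^ j))
      (fun j => integral_nonneg (hf0 j)) (fun j => by positivity) ?_ ?_
    · have h2 : 1 < √2 := Real.one_lt_sqrt_two
      refine ((summable_geometric_of_lt_one (by positivity) (inv_lt_one_of_one_lt₀ h2)).add
        (summable_geometric_of_lt_one (by positivity) ?_)).mul_left C
      exact Real.rpow_lt_one_of_one_lt_of_neg h2 (by linarith)
    · intro j
      rw [hV, hV, hn2]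
      have h1 := h (n j) (hnn1 j)
      have h2 : (√2) ^ j ≤ √(n j) := by
        refine Real.le_sqrt_of_sq_le ?_
        rw [← pow_mul, mul_comm, pow_mul, Real.sq_sqrt (by norm_num)]
        exact hnl j
      have h2p : 0 < (√2) ^ j := by positivity
      have h3 : (√(n j))⁻¹ ≤ ((√2)⁻¹) ^ j := by
        rw [inv_pow]
        exact inv_anti₀ h2p h2
      have h4 : (√(n j)) ^ (-α) ≤ ((√2) ^ (-α)) ^ j := by
        have : ((√2) ^ (-α)) ^ j = ((√2) ^ j) ^ (-α) := by
          rw [← Real.rpow_natCast, ← Real.rpow_natCast, ← Real.rpow_mul (by positivity),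
            ← Real.rpow_mul (by positivity), mul_comm]
        rw [this]
        exact Real.rpow_le_rpow_of_nonpos h2p h2 (by linarith)
      have h5 := mul_le_mul_of_nonneg_left (add_le_add h3 h4) hC
      have : ∀ z : ℝ, z - b (j+1) ^ 2 + b (j+1) ^ 2 = z := fun z => by ring
      rw [this]
      have hbj : b j = (∫ ω, T 0 0 (n j • e) ω ∂P) / n j := rfl
      rw [← hbj] at h1
      linarith
  filter_upwards [ae_tendsto_of_summable hfi hf0 hsum] with ω hω
  have h1 := (Real.continuous_sqrt.tendsto 0).comp hω
  rw [Real.sqrt_zero] at h1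
  have h2 : Tendsto (fun j => T 0 0 (n j • e) ω / n j - b j) atTop (nhds 0) := by
    refine (tendsto_zero_iff_abs_tendsto_zero _).2 ?_
    simpa [Function.comp_def, hf, Real.sqrt_sq_eq_abs] using h1
  simpa using h2.add hbL

lemma PSys.main (S : PSys P T Fm Fp φ T0) {α : ℝ} (hα : 0 < α) (hφ : ∀ᶠ s in atTop, φ s ≤ s ^ (-α)) {e : Euc d}
    (he : ‖e‖ = 1) : ∃ L : ℝ, 
      (∀ t0 x0, Tendsto (fun r : ℝ => (∫ ω, T t0 x0 (x0 + r • e) ω ∂P) / r) atTop (nhds L)) ∧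
      ∃ W : Set Ω, MeasurableSet W ∧ P W = 1 ∧ ∀ t0 x0, ∀ ω ∈ W, 
        Tendsto (fun r : ℝ => T t0 x0 (x0 + r • e) ω / r) atTop (nhds L) := by
  have hT := S.T1
  have hφ0 : Tendsto φ atTop (nhds 0) := by
    refine squeeze_zero' (.of_forall S.phi0) hφ (tendsto_rpow_neg_atTop hα)
  obtain ⟨L, hL⟩ := S.mean_limit hφ0 he
  obtain ⟨C, hC, n1, hn1, hst⟩ := S.moment_step hφ he
  refine ⟨L, ?_, ?_⟩
  · intro t0 x0
    refine hL.congr fun r => ?_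
    have := S.int_shift t0 x0 (r • e) 1
    simp only [pow_one] at this
    rw [this]
  have hae : ∀ᵐ ω ∂P, ∀ q : ℤ, ∀ m : ℕ, n1 ≤ m →
      Tendsto (fun j : ℕ => T q 0 (((m:ℝ) * 2 ^ j) • e) ω / (m * 2 ^ j)) atTop (nhds L) := by
    rw [ae_all_iff]; intro q
    rw [ae_all_iff]; intro m
    rw [eventually_imp_distrib_left]; intro hm
    obtain ⟨Θ, h1, h2⟩ := S.stat q 0
    have h3 := h1.quasiMeasurePreserving.ae (S.ae_dyadic hα hC hn1 hL hst m hm)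
    filter_upwards [h3] with ω hω
    simpa [h2] using hω
  obtain ⟨W, hW1, hW2, hW3⟩ : ∃ W : Set Ω, MeasurableSet W ∧ P W = 1 ∧ ∀ ω ∈ W, ∀ q : ℤ, ∀ m : ℕ, n1 ≤ m →
      Tendsto (fun j : ℕ => T q 0 (((m:ℝ) * 2 ^ j) • e) ω / (m * 2 ^ j)) atTop (nhds L) := by
    obtain ⟨N, hN1, hN2, hN3⟩ := exists_measurable_superset_of_null (ae_iff.1 hae)
    refine ⟨Nᶜ, hN2.compl, (prob_compl_eq_one_iff hN2).2 hN3, fun ω hω => ?_⟩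
    by_contra hh
    exact hω (hN1 hh)
  refine ⟨W, hW1, hW2, fun t0 x0 ω hω => ?_⟩
  have hq : ∀ q : ℤ, Tendsto (fun r : ℝ => T q 0 (r • e) ω / r) atTop (nhds L) := by
    intro q
    refine dyadic_limit (g := fun r => T q 0 (r • e) ω) (D := T0) (n0 := n1) (by linarith) ?_ (hW3 ω hω q)
    intro r r'
    have hn : ∀ r r' : ℝ, ‖r' • e - r • e‖ = |r' - r| := by
      intro r r'
      rw [← sub_smul, norm_smul, he, mul_one, Real.norm_eq_abs]
    have a1 := S.target q 0 (r • e) (r' • e) ω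
    have a2 := S.target q 0 (r' • e) (r • e) ω
    rw [hn] at a1 a2
    rw [abs_sub_comm r r'] at a2
    rw [abs_le]
    constructor <;> linarith
  obtain ⟨q1, hq1⟩ := exists_int_gt (t0 + T0 * (1 + ‖x0‖))
  obtain ⟨q2, hq2⟩ := exists_int_lt (t0 - T0 * (1 + ‖x0‖))
  have lim : ∀ (q : ℤ) (B : ℝ), Tendsto (fun r : ℝ => (T q 0 (r • e) ω + B) / r) atTop (nhds L) := by
    intro q B
    have := (hq q).add ((tendsto_const_nhds (x := B)).div_atTop tendsto_id)
    rw [add_zero] at this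
    refine this.congr fun r => ?_
    simp [add_div]
  refine tendsto_of_tendsto_of_tendsto_of_le_of_le' (lim q2 (-((t0 - q2) + T0 * (1 + ‖x0‖))))
    (lim q1 ((q1 - t0) + T0 * (1 + ‖x0‖))) ?_ ?_
  · filter_upwards [eventually_gt_atTop 0] with r hr
    refine div_le_div_of_nonneg_right ?_ hr.le
    have a1 := S.start q2 0 t0 x0 (x0 + r • e) ω (by rw [sub_zero]; linarith)
    have a2 := S.target q2 0 (x0 + r • e) (r • e) ω
    rw [sub_add_cancel_right, norm_neg] at a2
    linarith
  · filter_upwards [eventually_gt_atTop 0] with r hr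
    refine div_le_div_of_nonneg_right ?_ hr.le
    have a1 := S.start t0 x0 q1 0 (x0 + r • e) ω (by rw [zero_sub, norm_neg]; linarith)
    have a2 := S.target q1 0 (r • e) (x0 + r • e) ω
    rw [add_sub_cancel_right] at a2
    linarith
end

lemma phiH_le {d : ℕ} {Ω : Type*} [MeasurableSpace Ω] (P : Measure Ω) [IsProbabilityMeasure P]
    (c : ℝ → Euc d → Ω → ℝ) (v : ℝ → Euc d → Ω → Euc d) (s t : ℝ) (Ev Fv : Set Ω)
    (h1 : MeasurableSet[sigmaMinus c v t] Ev) (h2 : MeasurableSet[sigmaPlus c v (t + s)] Fv) :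
    P.real (Fv ∩ Ev) ≤ P.real Ev * (P.real Fv + phiH P c v s) := by
  by_cases h0 : P Ev = 0
  · have : P.real (Fv ∩ Ev) = 0 := by
      rw [measureReal_def, measure_mono_null Set.inter_subset_right h0]; simp
    have h3 : P.real Ev = 0 := by rw [measureReal_def, h0]; simp
    rw [this, h3, zero_mul]
  have hpos : 0 < P Ev := pos_iff_ne_zero.2 h0
  have hbd : BddAbove {r | ∃ t : ℝ, ∃ Ev Fv : Set Ω,
      MeasurableSet[sigmaMinus c v t] Ev ∧ MeasurableSet[sigmaPlus c v (t + s)] Fv ∧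
      0 < P Ev ∧ r = |(P (Fv ∩ Ev)).toReal / (P Ev).toReal - (P Fv).toReal|} := by
    refine ⟨1, ?_⟩
    rintro r ⟨t, E, F, -, -, hE, rfl⟩
    have a1 : (P (F ∩ E)).toReal / (P E).toReal ≤ 1 :=
      div_le_one_of_le₀ (measureReal_mono (μ := P) Set.inter_subset_right) ENNReal.toReal_nonneg
    have a2 : 0 ≤ (P (F ∩ E)).toReal / (P E).toReal := by positivity
    have a3 : (P F).toReal ≤ 1 := measureReal_le_one (μ := P)
    have a4 : 0 ≤ (P F).toReal := ENNReal.toReal_nonneg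
    rw [abs_le]
    constructor <;> linarith
  have key := le_csSup hbd ⟨t, Ev, Fv, h1, h2, hpos, rfl⟩
  have k2 := (le_abs_self _).trans key
  have hp : 0 < (P Ev).toReal := ENNReal.toReal_pos h0 (measure_ne_top _ _)
  change _ ≤ phiH P c v s at k2
  have k3 : (P (Fv ∩ Ev)).toReal / (P Ev).toReal ≤ (P Fv).toReal + phiH P c v s := by linarith
  rw [div_le_iff₀ hp] at k3
  simp only [measureReal_def]
  linarith

lemma phiH_nonneg {d : ℕ} {Ω : Type*} [MeasurableSpace Ω] (P : Measure Ω)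
    (c : ℝ → Euc d → Ω → ℝ) (v : ℝ → Euc d → Ω → Euc d) (s : ℝ) : 0 ≤ phiH P c v s := by
  refine Real.sSup_nonneg ?_
  rintro r ⟨t, E, F, -, -, -, rfl⟩
  exact abs_nonneg _

lemma sigmaMinus_meas {d : ℕ} {Ω : Type*} [MeasurableSpace Ω]
    (c : ℝ → Euc d → Ω → ℝ) (v : ℝ → Euc d → Ω → Euc d) {s t : ℝ} (h : s ≤ t) (x : Euc d) :
    Measurable[sigmaMinus c v t] (c s x) ∧ Measurable[sigmaMinus c v t] (v s x) := by
  have : Measurable[sigmaMinus c v t] (fun ω => (c s x ω, v s x ω)) := by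
    rw [measurable_iff_comap_le]
    exact le_iSup_of_le s (le_iSup_of_le h (le_iSup (fun x => MeasurableSpace.comap (fun ω => (c s x ω, v s x ω)) inferInstance) x))
  exact ⟨measurable_fst.comp this, measurable_snd.comp this⟩

lemma sigmaPlus_meas {d : ℕ} {Ω : Type*} [MeasurableSpace Ω]
    (c : ℝ → Euc d → Ω → ℝ) (v : ℝ → Euc d → Ω → Euc d) {s t : ℝ} (h : t ≤ s) (x : Euc d) :
    Measurable[sigmaPlus c v t] (c s x) ∧ Measurable[sigmaPlus c v t] (v s x) := by
  have : Measurable[sigmaPlus c v t] (fun ω => (c s x ω, v s x ω)) := by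
    rw [measurable_iff_comap_le]
    exact le_iSup_of_le s (le_iSup_of_le h (le_iSup (fun x => MeasurableSpace.comap (fun ω => (c s x ω, v s x ω)) inferInstance) x))
  exact ⟨measurable_fst.comp this, measurable_snd.comp this⟩

lemma tt_meas_all {d : ℕ} {Ω : Type*} [m : MeasurableSpace Ω] {K Lc T0 : ℝ} {δ : ℝ → ℝ} {c : ℝ → Euc d → Ω → ℝ}
    {v : ℝ → Euc d → Ω → Euc d} (hK : 0 < K) (hL : 0 ≤ Lc)
    (H : ∀ ω, GReg K Lc δ (fun a b => c a b ω) (fun a b => v a b ω))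
    (C : ∀ ω, Ctl K T0 (fun a b => c a b ω) (fun a b => v a b ω)) {t r : ℝ} (x y : Euc d)
    (hm : ∀ s, t ≤ s → s ≤ t + r → ∀ x, Measurable (c s x) ∧ Measurable (v s x)) :
    MeasurableSet {ω | travelTime (fun a b => c a b ω) (fun a b => v a b ω) t x y ≤ r} := by
  rcases lt_trichotomy r 0 with hr | hr | hr
  · convert MeasurableSet.empty
    ext ω
    simp only [Set.mem_ofPred_eq, Set.mem_empty_iff_false, iff_false, not_le]
    exact hr.trans_le (tt_nonneg _ _ t x y)
  · subst hr
    by_cases hxy : x = y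
    · subst hxy
      convert MeasurableSet.univ
      ext ω
      simp only [Set.mem_ofPred_eq, Set.mem_univ, iff_true]
      refine tt_le ?_
      rw [add_zero]
      exact reach_refl _ _
    · convert MeasurableSet.empty
      ext ω
      simp only [Set.mem_ofPred_eq, Set.mem_empty_iff_false, iff_false, not_le]
      by_contra hh
      have h1 := tt_lb (C ω) hK t x y
      have h2 : 0 < ‖y - x‖ := norm_pos_iff.2 (sub_ne_zero.2 (Ne.symm hxy))
      nlinarith
  · exact tt_meas_pos hK.le hL H C hr x y hm

lemma meas_ge_of_le {Ω : Type*} [MeasurableSpace Ω] {f : Ω → ℝ} (h : ∀ r, MeasurableSet {ω | f ω ≤ r}) (r : ℝ) :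
    MeasurableSet {ω | r ≤ f ω} :=
  measurableSet_le measurable_const (measurable_of_Iic h)

lemma psys_of {d : ℕ} {Ω : Type*} [MeasurableSpace Ω] (P : Measure Ω) [IsProbabilityMeasure P]
    {K Lc T0 : ℝ} {δ : ℝ → ℝ} {c : ℝ → Euc d → Ω → ℝ}
    {v : ℝ → Euc d → Ω → Euc d} (hK : 0 < K) (hL : 0 ≤ Lc) (hT : 1 ≤ T0)
    (H : ∀ ω, GReg K Lc δ (fun a b => c a b ω) (fun a b => v a b ω))
    (C : ∀ ω, Ctl K T0 (fun a b => c a b ω) (fun a b => v a b ω))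
    (Υ : ℝ × Euc d → Ω → Ω) (hmp : ∀ p, MeasurePreserving (Υ p) P P)
    (hstat : ∀ t s : ℝ, ∀ x y : Euc d, ∀ ω,
      c t x (Υ (s, y) ω) = c (t + s) (x + y) ω ∧ v t x (Υ (s, y) ω) = v (t + s) (x + y) ω)
    (hτmeas : ∀ t0 : ℝ, ∀ x0 x : Euc d,
      Measurable fun ω => travelTime (fun a b => c a b ω) (fun a b => v a b ω) t0 x0 x) :
    PSys P (fun t x y ω => travelTime (fun a b => c a b ω) (fun a b => v a b ω) t x y)
      (sigmaMinus c v) (sigmaPlus c v) (phiH P c v) T0 where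
  T1 := hT
  meas := hτmeas
  nonneg t x y ω := tt_nonneg _ _ t x y
  ub t x y ω := tt_ub (C ω) t x y
  minus t x y r r' h := by
    refine @tt_meas_all d Ω (sigmaMinus c v (t + r')) K Lc T0 δ c v hK hL H C t r x y ?_
    intro s h1 h2 x
    exact sigmaMinus_meas c v (by linarith) x
  plus t x y r := by
    refine @meas_ge_of_le Ω (sigmaPlus c v t) _ (fun r => ?_) r
    refine @tt_meas_all d Ω (sigmaPlus c v t) K Lc T0 δ c v hK hL H C t r x y ?_
    intro s h1 h2 x
    exact sigmaPlus_meas c v h1 x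
  phi t s E F _ _ h1 h2 := phiH_le P c v s t E F h1 h2
  phi0 s := phiH_nonneg P c v s
  split t x y z σ ω h := by
    have := tt_after (C ω) z (tt_reach (C ω) h)
    rwa [add_sub_cancel_left] at this
  start t x t1 x1 z ω h := by
    have := (C ω).ctl t x x1 (t1 - t) h
    rw [add_sub_cancel] at this
    exact tt_after (C ω) z this
  target t x z z1 ω := tt_target (C ω) t x z z1
  stat s p := by
    refine ⟨Υ (s, p), hmp _, fun t x y ω => ?_⟩
    simp only [fun t x => (hstat t s x p ω).1, fun t x => (hstat t s x p ω).2]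
    exact tt_shift (fun a b => c a b ω) (fun a b => v a b ω) s p t x y

/-- **Almost-sure law of large numbers for G-equation travel times.**
Under the G-equation hypotheses and polynomial decay of the mixing coefficient `φ_H`, there are
`M ≥ 1` and deterministic direction-dependent travel times `τ̄(e) ∈ [M⁻¹, M]` such that for every
unit `e` there is a full-measure event on which `τ^{t₀}(x₀, x₀+re, ω)/r → τ̄(e)` and
`E[τ^{t₀}(x₀, x₀+re, ·)]/r → τ̄(e)`, for every `(t₀,x₀)`; moreover `τ̄` and `1/τ̄` are
`M³`-Lipschitz on the sphere. -/
theorem gequation_travel_time_lln_almost_sure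
    {d : ℕ} {Ω : Type*} [MeasurableSpace Ω] (P : Measure Ω) [IsProbabilityMeasure P]
    (c : ℝ → Euc d → Ω → ℝ) (v : ℝ → Euc d → Ω → Euc d)
    -- `c` is positive, `(c,v)` are bounded
    (hc_pos : ∀ t x ω, 0 < c t x ω)
    (hbdd : ∃ K : ℝ, ∀ t x ω, c t x ω ≤ K ∧ ‖v t x ω‖ ≤ K)
    -- uniform continuity in `t`, uniformly in `(x,ω)`
    (huct : ∀ ε : ℝ, 0 < ε → ∃ δ : ℝ, 0 < δ ∧ ∀ t t' : ℝ, |t - t'| ≤ δ → ∀ x ω,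
      |c t x ω - c t' x ω| ≤ ε ∧ ‖v t x ω - v t' x ω‖ ≤ ε)
    -- uniform Lipschitz continuity in `x`
    (hlip : ∃ L : ℝ, ∀ t : ℝ, ∀ x x' : Euc d, ∀ ω,
      |c t x ω - c t x' ω| ≤ L * ‖x - x'‖ ∧ ‖v t x ω - v t x' ω‖ ≤ L * ‖x - x'‖)
    -- `v(t,·,ω)` is divergence-free (a.e. vanishing trace of the a.e. derivative)
    (hdiv : ∀ t : ℝ, ∀ ω, ∀ᵐ x ∂(volume : Measure (Euc d)),
      LinearMap.trace ℝ (Euc d) (fderiv ℝ (fun y => v t y ω) x).toLinearMap = 0)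
    -- the averaged smallness condition (1.14): inf_L sup |avg of v over L-boxes| < inf c
    (hGc4 : ∃ L : ℝ, 0 < L ∧ ∃ a b : ℝ, a < b ∧
      (∀ t x ω,
        ‖(L ^ d)⁻¹ • ∫ y in {y : Euc d | ∀ i, y i ∈ Set.Icc (0:ℝ) L}, v t (x + y) ω‖ ≤ a) ∧
      (∀ t x ω, b ≤ c t x ω))
    -- space-time stationarity with respect to a measure-preserving group
    (Υ : ℝ × Euc d → Ω → Ω)
    (hmp : ∀ p, MeasurePreserving (Υ p) P P)
    (hid : Υ 0 = id)
    (hgrp : ∀ p q, Υ p ∘ Υ q = Υ (p + q))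
    (hstat : ∀ t s : ℝ, ∀ x y : Euc d, ∀ ω,
      c t x (Υ (s, y) ω) = c (t + s) (x + y) ω ∧ v t x (Υ (s, y) ω) = v (t + s) (x + y) ω)
    -- measurability in ω of the travel times
    (hτmeas : ∀ t0 : ℝ, ∀ x0 x : Euc d,
      Measurable fun ω => travelTime (fun a b => c a b ω) (fun a b => v a b ω) t0 x0 x)
    -- polynomial decay of the mixing coefficient
    (α : ℝ) (hα : 0 < α)
    (hmix : Tendsto (fun s : ℝ => s ^ α * phiH P c v s) atTop (nhds 0)) :
    ∃ M : ℝ, 1 ≤ M ∧ ∃ τbar : Euc d → ℝ,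
      (∀ e : Euc d, ‖e‖ = 1 → τbar e ∈ Set.Icc M⁻¹ M ∧
        ∃ Ωe : Set Ω, MeasurableSet Ωe ∧ P Ωe = 1 ∧
          ∀ t0 : ℝ, ∀ x0 : Euc d, ∀ ω ∈ Ωe,
            Tendsto (fun r : ℝ =>
                travelTime (fun a b => c a b ω) (fun a b => v a b ω) t0 x0 (x0 + r • e) / r)
              atTop (nhds (τbar e)) ∧
            Tendsto (fun r : ℝ =>
                (∫ ω1, travelTime (fun a b => c a b ω1) (fun a b => v a b ω1)
                  t0 x0 (x0 + r • e) ∂P) / r)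
              atTop (nhds (τbar e))) ∧
      ∀ e e1 : Euc d, ‖e‖ = 1 → ‖e1‖ = 1 →
        max |τbar e - τbar e1| |(τbar e)⁻¹ - (τbar e1)⁻¹| ≤ M ^ 3 * ‖e - e1‖ := by
  obtain ⟨K0, hK0⟩ := hbdd
  obtain ⟨L0, hL0⟩ := hlip
  obtain ⟨ℓ, hℓ, a, b, hab, havg, hcb⟩ := hGc4
  have hne : Nonempty Ω := by
    by_contra hh
    rw [not_nonempty_iff] at hh
    have := measure_univ (μ := P)
    rw [Set.univ_eq_empty_iff.2 hh, measure_empty] at this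
    exact zero_ne_one this
  obtain ⟨ω0⟩ := hne
  have ha0 : 0 ≤ a := (norm_nonneg _).trans (havg 0 0 ω0)
  choose! δ hδ using huct
  set K := max K0 1 with hKdef
  set Lc := max L0 0 with hLdef
  have hK1 : 1 ≤ K := le_max_right _ _
  have hLc0 : 0 ≤ Lc := le_max_right _ _
  have hG : ∀ ω, GCls K Lc δ ℓ a b (fun a b => c a b ω) (fun a b => v a b ω) := fun ω =>
    { cpos := fun t x => (hc_pos t x ω).le
      cK := fun t x => (hK0 t x ω).1.trans (le_max_left _ _)
      vK := fun t x => (hK0 t x ω).2.trans (le_max_left _ _)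
      δpos := fun ε hε => (hδ ε hε).1
      md := fun ε hε t t' h x => (hδ ε hε).2 t t' h x ω
      lip := fun t x x' => ⟨(hL0 t x x' ω).1.trans (mul_le_mul_of_nonneg_right (le_max_left _ _) (norm_nonneg _)),
        (hL0 t x x' ω).2.trans (mul_le_mul_of_nonneg_right (le_max_left _ _) (norm_nonneg _))⟩
      cb := fun t x => hcb t x ω
      div := fun t => hdiv t ω
      avg := fun t x => havg t x ω }
  obtain ⟨T0, hT0, hctl⟩ := ctl_global d (⟨hK1, hLc0, hℓ, ha0, hab⟩ : GConst K Lc ℓ a b) δ (fun ε hε => (hδ ε hε).1)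
  have C : ∀ ω, Ctl K T0 (fun a b => c a b ω) (fun a b => v a b ω) := fun ω => hctl _ _ (hG ω)
  have S := psys_of P (by linarith) hLc0 hT0 (fun ω => (hG ω).toGReg) C Υ hmp hstat hτmeas
  have hφ : ∀ᶠ s in atTop, phiH P c v s ≤ s ^ (-α) := by
    filter_upwards [hmix.eventually (gt_mem_nhds zero_lt_one), eventually_gt_atTop 0] with s h1 h2
    have hp : 0 < s ^ α := Real.rpow_pos_of_pos h2 α
    rw [Real.rpow_neg h2.le, ← one_div, le_div_iff₀ hp, mul_comm]
    exact h1.le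
  have hmain := fun e : Euc d => fun he : ‖e‖ = 1 => S.main hα hφ he
  choose! τ hτ1 hτ2 using hmain
  have hub : ∀ e, ‖e‖ = 1 → τ e ≤ T0 := by
    intro e he
    have l1 : Tendsto (fun r : ℝ => T0 / r + T0) atTop (nhds T0) := by
      have := ((tendsto_const_nhds (x := T0)).div_atTop (tendsto_id (α := ℝ) (x := atTop))).add_const T0
      simpa using this
    refine le_of_tendsto_of_tendsto (hτ1 e he 0 0) l1 ?_
    filter_upwards [eventually_gt_atTop 0] with r hr
    have := S.mean_ub 0 0 (0 + r • e)
    rw [zero_add, sub_zero, norm_smul, he, mul_one, Real.norm_eq_abs, abs_of_pos hr] at this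
    rw [zero_add, div_le_iff₀ hr, add_mul, div_mul_cancel₀ _ hr.ne']
    linarith
  have hlb : ∀ e, ‖e‖ = 1 → (2 * K)⁻¹ ≤ τ e := by
    intro e he
    refine ge_of_tendsto (hτ1 e he 0 0) ?_
    filter_upwards [eventually_gt_atTop 0] with r hr
    rw [le_div_iff₀ hr]
    have h1 : ∫ ω : Ω, (2 * K)⁻¹ * r ∂P = (2 * K)⁻¹ * r := by simp
    rw [← h1]
    refine integral_mono (integrable_const _) (S.int1 0 0 (0 + r • e)) fun ω => ?_
    have := tt_lb (C ω) (by linarith) 0 0 (0 + r • e)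
    rw [zero_add, sub_zero, norm_smul, he, mul_one, Real.norm_eq_abs, abs_of_pos hr] at this
    rw [inv_mul_le_iff₀ (by linarith), zero_add]
    exact this
  have hli1 : ∀ e e1, ‖e‖ = 1 → ‖e1‖ = 1 → τ e ≤ τ e1 + T0 * ‖e - e1‖ := by
    intro e e1 he he1
    have l1 : Tendsto (fun r : ℝ => T0 / r + T0 * ‖e - e1‖) atTop (nhds (T0 * ‖e - e1‖)) := by
      have := ((tendsto_const_nhds (x := T0)).div_atTop (tendsto_id (α := ℝ) (x := atTop))).add_const (T0 * ‖e - e1‖)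
      simpa using this
    refine le_of_tendsto_of_tendsto (hτ1 e he 0 0) ((hτ1 e1 he1 0 0).add l1) ?_
    filter_upwards [eventually_gt_atTop 0] with r hr
    have := S.mean_lip 0 0 (0 + r • e1) (0 + r • e)
    rw [add_sub_add_left_eq_sub, ← smul_sub, norm_smul, Real.norm_eq_abs, abs_of_pos hr] at this
    rw [div_le_iff₀ hr, add_mul, add_mul, div_mul_cancel₀ _ hr.ne', div_mul_cancel₀ _ hr.ne']
    linarith
  have hli : ∀ e e1, ‖e‖ = 1 → ‖e1‖ = 1 → |τ e - τ e1| ≤ T0 * ‖e - e1‖ := by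
    intro e e1 he he1
    have h1 := hli1 e e1 he he1
    have h2 := hli1 e1 e he1 he
    rw [norm_sub_rev] at h2
    rw [abs_le]
    constructor <;> linarith
  set M := max T0 (2 * K) with hM
  have hM1 : T0 ≤ M := le_max_left _ _
  have hM2 : 2 * K ≤ M := le_max_right _ _
  have hM0 : 1 ≤ M := hT0.trans hM1
  have hMlb : ∀ e, ‖e‖ = 1 → M⁻¹ ≤ τ e := fun e he => (inv_anti₀ (by linarith) hM2).trans (hlb e he)
  have hpos : ∀ e, ‖e‖ = 1 → 0 < τ e := fun e he => lt_of_lt_of_le (by positivity) (hMlb e he)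
  have hinv : ∀ e, ‖e‖ = 1 → (τ e)⁻¹ ≤ M := fun e he => inv_le_of_inv_le₀ (by linarith) (hMlb e he)
  refine ⟨M, hM0, τ, ?_, ?_⟩
  · intro e he
    refine ⟨⟨hMlb e he, (hub e he).trans hM1⟩, ?_⟩
    obtain ⟨W, hW1, hW2, hW3⟩ := hτ2 e he
    exact ⟨W, hW1, hW2, fun t0 x0 ω hω => ⟨hW3 t0 x0 ω hω, hτ1 e he t0 x0⟩⟩
  · intro e e1 he he1
    have h1 := hli e e1 he he1
    have hn := norm_nonneg (e - e1)
    have hMM : M ≤ M ^ 3 := le_self_pow₀ hM0 (by norm_num)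
    refine max_le ?_ ?_
    · exact h1.trans (mul_le_mul_of_nonneg_right (hM1.trans hMM) hn)
    · have p0 := hpos e he
      have p1 := hpos e1 he1
      have h2 : (τ e)⁻¹ - (τ e1)⁻¹ = -((τ e)⁻¹ * (τ e1)⁻¹ * (τ e - τ e1)) := by
        field_simp; ring
      rw [h2, abs_neg, abs_mul, abs_of_pos (by positivity)]
      calc (τ e)⁻¹ * (τ e1)⁻¹ * |τ e - τ e1| ≤ M * M * (M * ‖e - e1‖) := by
            refine mul_le_mul (mul_le_mul (hinv e he) (hinv e1 he1) (by positivity) (by positivity))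
              (h1.trans (mul_le_mul_of_nonneg_right hM1 hn)) (abs_nonneg _) (by positivity)
        _ = M ^ 3 * ‖e - e1‖ := by ring
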